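/- arXiv:2503.22546 — 5 statements merged into one kernel-verified Lean document; each statement's English description precedes it below -/
import Mathlib

section
/- Let A be a finite alphabet and L ⊆ A* a language. Then L is star-free if and only if the syntactic monoid of L is finite and aperiodic. (Schützenberger's theorem.) -/
/-- The class of star-free languages over the alphabet `A`: the smallest class of
languages containing `∅`, `{ε}` (which is `1`), and the single-letter languages,
closed under binary union (`+`), complement within `A*`, and concatenation (`*`). -/
inductive StarFree {A : Type} : Language A → Prop
  | empty : StarFree (0 : Language A)
  | eps : StarFree (1 : Language A)
  | letter (a : A) : StarFree {[a]}
  | union {L M : Language A} : StarFree L → StarFree M → StarFree (L + M)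
  | compl {L : Language A} : StarFree L → StarFree Lᶜ
  | concat {L M : Language A} : StarFree L → StarFree M → StarFree (L * M)

/-- The syntactic congruence of a language `L ⊆ A*` on the free monoid `A*`:
`u ∼ v` iff for all contexts `s, t`, `s·u·t ∈ L ↔ s·v·t ∈ L`. -/
def syntacticCon {A : Type} (L : Language A) : Con (FreeMonoid A) where
  r u v := ∀ s t : FreeMonoid A, (s * u * t ∈ L ↔ s * v * t ∈ L)
  iseqv := ⟨fun _ _ _ => Iff.rfl, fun h s t => (h s t).symm,
    fun h₁ h₂ s t => (h₁ s t).trans (h₂ s t)⟩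
  mul' := by
    intro w x y z h₁ h₂ s t
    have e₁ : s * (w * y) * t = s * w * (y * t) := by simp [mul_assoc]
    have e₂ : s * (x * y) * t = s * x * (y * t) := by simp [mul_assoc]
    have e₃ : s * (x * y) * t = (s * x) * y * t := by simp [mul_assoc]
    have e₄ : s * (x * z) * t = (s * x) * z * t := by simp [mul_assoc]
    rw [e₁, e₄]
    exact (h₁ s (y * t)).trans (by rw [← e₂, e₃]; exact h₂ (s * x) t)


theorem sf_univ {A : Type} : StarFree (Set.univ : Set (List A)) := by
  have h := StarFree.compl (StarFree.empty (A := A))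
  have e : (0 : Language A)ᶜ = (Set.univ : Set (List A)) := Set.compl_empty
  rwa [e] at h

theorem sf_congr {A : Type} {L M : Language A} (h : StarFree L) (e : ∀ w : List A, w ∈ L ↔ w ∈ M) :
    StarFree M := by
  have : L = M := Set.ext e
  rwa [← this]

theorem sf_iUnion {A : Type} {ι : Type*} [Finite ι] (f : ι → Language A)
    (h : ∀ i, StarFree (f i)) : ∃ M : Language A, StarFree M ∧ ∀ w : List A, w ∈ M ↔ ∃ i, w ∈ f i := by
  have key : ∀ s : Set ι, s.Finite →
      ∃ M : Language A, StarFree M ∧ ∀ w : List A, w ∈ M ↔ ∃ i ∈ s, w ∈ f i := by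
    intro s hs
    induction s, hs using Set.Finite.induction_on with
    | empty => exact ⟨0, StarFree.empty, fun w => by simp⟩
    | @insert a s _ _ ih =>
      obtain ⟨M, hM, e⟩ := ih
      refine ⟨f a + M, StarFree.union (h a) hM, fun w => ?_⟩
      rw [Language.mem_add, e]
      simp
  obtain ⟨M, hM, e⟩ := key Set.univ Set.finite_univ
  exact ⟨M, hM, fun w => by simp [e]⟩

theorem sf_inter {A : Type} {L M : Language A} (hL : StarFree L) (hM : StarFree M) :
    ∃ N : Language A, StarFree N ∧ ∀ w : List A, w ∈ N ↔ w ∈ L ∧ w ∈ M := by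
  refine ⟨(Lᶜ + Mᶜ)ᶜ, (hL.compl.union hM.compl).compl, fun w => ?_⟩
  have h1 : w ∈ (Lᶜ + Mᶜ)ᶜ ↔ ¬ (w ∈ Lᶜ + Mᶜ) := Iff.rfl
  have h2 : w ∈ Lᶜ ↔ ¬ (w ∈ L) := Iff.rfl
  have h3 : w ∈ Mᶜ ↔ ¬ (w ∈ M) := Iff.rfl
  rw [h1, Language.mem_add, h2, h3]
  tauto

section aper
variable {M : Type*} [Monoid M]

theorem ap_lemma {n : ℕ} (hn : ∀ x : M, x ^ (n + 1) = x ^ n) {m p q : M} (h : m = p * m * q) :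
    p * m = m ∧ m * q = m := by
  have hk : ∀ k : ℕ, m = p ^ k * m * q ^ k := by
    intro k
    induction k with
    | zero => simp
    | succ k ih =>
      calc m = p ^ k * m * q ^ k := ih
        _ = p ^ k * (p * m * q) * q ^ k := by rw [← h]
        _ = p ^ (k + 1) * m * q ^ (k + 1) := by
          rw [pow_succ p, pow_succ' q]; simp only [mul_assoc]
  have h1 := hk n
  constructor
  · calc p * m = p * (p ^ n * m * q ^ n) := by rw [← h1]
      _ = p ^ (n + 1) * m * q ^ n := by rw [pow_succ']; simp only [mul_assoc]
      _ = m := by rw [hn, ← h1]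
  · calc m * q = (p ^ n * m * q ^ n) * q := by rw [← h1]
      _ = p ^ n * m * q ^ (n + 1) := by rw [pow_succ]; simp only [mul_assoc]
      _ = m := by rw [hn, ← h1]

/-- `n` is strictly above `m` in the two-sided ideal order. -/
def JLt (n m : M) : Prop := (∃ p q, m = p * n * q) ∧ ¬ ∃ p q, n = p * m * q

theorem jlt_wf [Finite M] : WellFounded (JLt : M → M → Prop) := by
  have : IsTrans M JLt := ⟨by
    rintro a b c ⟨⟨p, q, h1⟩, h2⟩ ⟨⟨p', q', h3⟩, h4⟩
    refine ⟨⟨p' * p, q * q', by rw [h3, h1]; simp only [mul_assoc]⟩, ?_⟩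
    rintro ⟨x, y, h5⟩
    exact h4 ⟨p * x, y * q, by rw [h1, h5]; simp only [mul_assoc]⟩⟩
  have : Std.Irrefl (JLt : M → M → Prop) := ⟨fun a h => h.2 h.1⟩
  exact Finite.wellFounded_of_trans_of_irrefl _

end aper

theorem exists_first_cut {A : Type} (P : List A → Prop) (h0 : ¬ P []) (w : List A) (hw : P w) :
    ∃ u a v, w = u ++ [a] ++ v ∧ ¬ P u ∧ P (u ++ [a]) := by
  induction w using List.reverseRecOn with
  | nil => exact absurd hw h0
  | append_singleton u a ih =>
    by_cases h : P u
    · obtain ⟨u', b, v, e, h1, h2⟩ := ih h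
      exact ⟨u', b, v ++ [a], by rw [e]; simp, h1, h2⟩
    · exact ⟨u, a, [], by simp, h, hw⟩

theorem exists_last_cut {A : Type} (P : List A → Prop) (h0 : ¬ P []) (w : List A) (hw : P w) :
    ∃ u a v, w = u ++ ([a] ++ v) ∧ ¬ P v ∧ P ([a] ++ v) := by
  induction w with
  | nil => exact absurd hw h0
  | cons a u ih =>
    by_cases h : P u
    · obtain ⟨u', b, v, e, h1, h2⟩ := ih h
      exact ⟨a :: u', b, v, by rw [e]; simp, h1, h2⟩
    · exact ⟨[], a, u, by simp, h, hw⟩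

theorem factor_lemma {A : Type} (P : List A → Prop) (h0 : ¬ P []) :
    ∀ (N : ℕ) (w : List A), w.length ≤ N → P w →
    ∃ x f y, w = x ++ f ++ y ∧ P f ∧ ((∃ a, f = [a]) ∨
      ∃ a g b, f = [a] ++ g ++ [b] ∧ ¬ P ([a] ++ g) ∧ ¬ P (g ++ [b])) := by
  intro N
  induction N with
  | zero =>
    intro w hl hw
    have : w = [] := List.length_eq_zero_iff.mp (by omega)
    subst this
    exact absurd hw h0
  | succ N ih =>
    intro w hl hw
    rcases w with _ | ⟨a, t⟩
    · exact absurd hw h0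
    rcases List.eq_nil_or_concat t with rfl | ⟨g, b, rfl⟩
    · exact ⟨[], [a], [], by simp, hw, Or.inl ⟨a, rfl⟩⟩
    simp only [List.concat_eq_append, List.length_cons, List.length_append, List.length_nil] at hl hw ⊢
    by_cases h1 : P ([a] ++ g)
    · obtain ⟨x, f, y, e, h⟩ := ih ([a] ++ g) (by simp; omega) h1
      refine ⟨x, f, y ++ [b], ?_, h⟩
      have : a :: (g ++ [b]) = ([a] ++ g) ++ [b] := by simp
      rw [this, e]; simp
    by_cases h2 : P (g ++ [b])
    · obtain ⟨x, f, y, e, h⟩ := ih (g ++ [b]) (by simp; omega) h2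
      exact ⟨a :: x, f, y, by rw [e]; simp, h⟩
    exact ⟨[], a :: (g ++ [b]), [], by simp, hw, Or.inr ⟨a, g, b, by simp, h1, h2⟩⟩

/-- The fiber of a map. -/
def fib {A M : Type} (φ : List A → M) (m : M) : Language A := ({w | φ w = m} : Set (List A))

theorem sf_fiber {A : Type} [Fintype A] {M : Type} [Monoid M] [Finite M] {n : ℕ}
    (hn : ∀ x : M, x ^ (n + 1) = x ^ n) (φ : List A → M) (φ1 : φ [] = 1)
    (φm : ∀ u v, φ (u ++ v) = φ u * φ v) (m : M) :
    StarFree (fib φ m) := by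
  refine (jlt_wf (M := M)).induction (C := fun m => StarFree (fib φ m)) m ?_
  clear m
  intro m IH
  have hu : StarFree (Set.univ : Set (List A)) := sf_univ
  -- the ideal part
  have hW : ∃ W : Language A, StarFree W ∧ ∀ w : List A, w ∈ W ↔ ¬ ∃ p q, m = p * φ w * q := by
    obtain ⟨W1, sW1, eW1⟩ := sf_iUnion
      (fun i : {a : A // ¬ ∃ p q, m = p * φ [a] * q} => ({[i.1]} : Language A))
      (fun i => StarFree.letter i.1)
    obtain ⟨W2, sW2, eW2⟩ := sf_iUnion
      (fun i : {i : A × M × A // JLt i.2.1 m ∧ ¬ ∃ p q, m = p * (φ [i.1] * i.2.1 * φ [i.2.2]) * q} =>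
        (({[i.1.1]} : Language A) * fib φ i.1.2.1 * {[i.1.2.2]} : Language A))
      (fun i => ((StarFree.letter _).concat (IH _ i.2.1)).concat (StarFree.letter _))
    refine ⟨_, (hu.concat (sW1.union sW2)).concat hu, fun w => ?_⟩
    constructor
    · rintro ⟨_, ⟨x, -, f, hf, rfl⟩, y, -, rfl⟩ ⟨p, q, h⟩
      have key : ∃ p q, m = p * φ f * q :=
        ⟨p * φ x, φ y * q, by rw [h]; simp only [φm, mul_assoc]⟩
      rcases hf with hf | hf
      · obtain ⟨i, hi⟩ := (eW1 f).1 hf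
        have hi : f = [i.1] := hi
        subst hi
        exact i.2 key
      · obtain ⟨i, hi⟩ := (eW2 f).1 hf
        obtain ⟨_, ⟨_, rfl, g, hg, rfl⟩, _, rfl, rfl⟩ := hi
        have hg : φ g = i.1.2.1 := hg
        apply i.2.2
        simpa only [φm, hg] using key
    · intro h
      obtain ⟨x, f, y, rfl, hf, hc⟩ := factor_lemma (fun w => ¬ ∃ p q, m = p * φ w * q)
        (by rw [φ1]; exact fun h => h ⟨m, 1, by simp⟩) _ w le_rfl h
      refine ⟨_, ⟨x, trivial, f, ?_, rfl⟩, y, trivial, rfl⟩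
      rcases hc with ⟨a, rfl⟩ | ⟨a, g, b, rfl, h1, h2⟩
      · exact Or.inl ((eW1 _).2 ⟨⟨a, hf⟩, rfl⟩)
      · rw [not_not] at h1 h2
        obtain ⟨p, q, h1⟩ := h1
        obtain ⟨p', q', h2⟩ := h2
        refine Or.inr ((eW2 _).2 ⟨⟨(a, φ g, b), ⟨?_, ?_⟩, ?_⟩, ?_⟩)
        · exact ⟨p * φ [a], q, by rw [h1, φm]; simp only [mul_assoc]⟩
        · rintro ⟨x, y, h3⟩
          dsimp only at h3
          rw [φm, h3] at h1 h2
          have e1 := ap_lemma hn (m := m) (p := p * φ [a] * x) (q := y * q)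
            (by conv_lhs => rw [h1]
                simp only [mul_assoc])
          have e2 := ap_lemma hn (m := m) (p := p' * x) (q := y * φ [b] * q')
            (by conv_lhs => rw [h2]
                simp only [mul_assoc])
          apply hf
          refine ⟨p, q', ?_⟩
          rw [φm, φm, h3]
          calc m = p * φ [a] * x * m := e1.1.symm
            _ = p * φ [a] * x * (m * (y * φ [b] * q')) := by rw [e2.2]
            _ = _ := by simp only [mul_assoc]
        · simpa only [φm] using hf
        · exact ⟨_, ⟨[a], rfl, g, rfl, rfl⟩, [b], rfl, rfl⟩
  obtain ⟨W, sW, eW⟩ := hW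
  by_cases hm1 : m = 1
  · -- the identity
    refine sf_congr sW.compl fun w => ?_
    have h1 : w ∈ Wᶜ ↔ ¬ (w ∈ W) := Iff.rfl
    rw [h1, eW, not_not]
    constructor
    · rintro ⟨p, q, h⟩
      change φ w = m
      subst hm1
      have e1 := (ap_lemma hn (m := (1 : M)) (p := p * φ w) (q := q) (by simpa using h))
      have e2 := (ap_lemma hn (m := (1 : M)) (p := p) (q := φ w * q) (by simpa [mul_assoc] using h))
      simp only [mul_one, one_mul] at e1 e2
      have := e1.1
      rwa [e2.1, one_mul] at this
    · intro h
      have h : φ w = m := h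
      exact ⟨1, 1, by simp [h]⟩
  have hr : ¬ ∃ z, (1 : M) = m * z := by
    rintro ⟨z, h⟩
    have := (ap_lemma hn (m := (1 : M)) (p := m) (q := z) (by simpa using h)).1
    exact hm1 (by simpa using this)
  have hl : ¬ ∃ z, (1 : M) = z * m := by
    rintro ⟨z, h⟩
    have := (ap_lemma hn (m := (1 : M)) (p := z) (q := m) (by simpa using h)).2
    exact hm1 (by simpa using this)
  obtain ⟨U, sU, eU⟩ := sf_iUnion
    (fun i : {i : M × A // JLt i.1 m ∧ ∃ z, i.1 * φ [i.2] = m * z} =>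
      (fib φ i.1.1 * {[i.1.2]} : Language A))
    (fun i => StarFree.concat (IH _ i.2.1) (StarFree.letter _))
  obtain ⟨V, sV, eV⟩ := sf_iUnion
    (fun i : {i : M × A // JLt i.1 m ∧ ∃ z, φ [i.2] * i.1 = z * m} =>
      (({[i.1.2]} : Language A) * fib φ i.1.1 : Language A))
    (fun i => StarFree.concat (StarFree.letter _) (IH _ i.2.1))
  obtain ⟨X, sX, eX⟩ := sf_inter (sU.concat hu) (hu.concat sV)
  obtain ⟨Y, sY, eY⟩ := sf_inter sX sW.compl
  refine sf_congr sY fun w => ?_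
  have h1 : w ∈ Wᶜ ↔ ¬ (w ∈ W) := Iff.rfl
  rw [eY, eX, h1, eW, not_not]
  constructor
  · rintro ⟨⟨hU, hV⟩, p, q, h⟩
    change φ w = m
    have hx : ∃ x, φ w = m * x := by
      obtain ⟨u, hu, v, -, rfl⟩ := hU
      obtain ⟨⟨⟨i, a⟩, hi, z, hz⟩, u, hu', _, rfl, rfl⟩ := (eU u).1 hu
      have hu' : φ u = i := hu'
      subst hu'
      dsimp only at hz ⊢
      exact ⟨z * φ v, by rw [← mul_assoc, ← hz, ← φm, ← φm]⟩
    have hy : ∃ x, φ w = x * m := by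
      obtain ⟨v, -, u, hu, rfl⟩ := hV
      obtain ⟨⟨⟨i, a⟩, hi, z, hz⟩, _, rfl, u, hu', rfl⟩ := (eV u).1 hu
      have hu' : φ u = i := hu'
      subst hu'
      dsimp only at hz ⊢
      exact ⟨φ v * z, by rw [mul_assoc, ← hz, ← φm, ← φm]⟩
    obtain ⟨x, hx⟩ := hx
    obtain ⟨y, hy⟩ := hy
    have e1 := ap_lemma hn (m := m) (p := p) (q := x * q)
      (by conv_lhs => rw [h, hx]
          simp only [mul_assoc])
    have e2 := ap_lemma hn (m := m) (p := p * y) (q := q)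
      (by conv_lhs => rw [h, hy]
          simp only [mul_assoc])
    calc φ w = y * (m * q) := by rw [e2.2, hy]
      _ = φ w * q := by rw [hy, mul_assoc]
      _ = m * (x * q) := by rw [hx, mul_assoc]
      _ = m := e1.2
  · intro h
    have h : φ w = m := h
    refine ⟨⟨?_, ?_⟩, 1, 1, by simp [h]⟩
    · obtain ⟨u, a, v, rfl, h2, h3⟩ := exists_first_cut (fun w => ∃ z, φ w = m * z)
        (by rw [φ1]; exact hr) w ⟨1, by simp [h]⟩
      refine ⟨u ++ [a], (eU _).2 ⟨⟨(φ u, a), ⟨⟨1, φ [a] * φ v, ?_⟩, ?_⟩, ?_⟩, ?_⟩, v, trivial, rfl⟩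
      · rw [← h]; simp only [φm, mul_assoc, one_mul]
      · rintro ⟨x, y, h4⟩
        dsimp only at h4
        have h5 : m = x * m * (y * (φ [a] * φ v)) := by
          conv_lhs => rw [← h, φm, φm, h4]
          simp only [mul_assoc]
        exact h2 ⟨y, by rw [h4, (ap_lemma hn h5).1]⟩
      · simpa only [φm] using h3
      · exact ⟨u, rfl, [a], rfl, rfl⟩
    · obtain ⟨u, a, v, rfl, h2, h3⟩ := exists_last_cut (fun w => ∃ z, φ w = z * m)
        (by rw [φ1]; exact hl) w ⟨1, by simp [h]⟩
      refine ⟨u, trivial, [a] ++ v, (eV _).2 ⟨⟨(φ v, a), ⟨⟨φ u * φ [a], 1, ?_⟩, ?_⟩, ?_⟩, ?_⟩, rfl⟩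
      · rw [← h]; simp only [φm, mul_assoc, mul_one]
      · rintro ⟨x, y, h4⟩
        dsimp only at h4
        have h5 : m = (φ u * φ [a] * x) * m * y := by
          conv_lhs => rw [← h, φm, φm, h4]
          simp only [mul_assoc]
        exact h2 ⟨x, by rw [h4, mul_assoc, (ap_lemma hn h5).2]⟩
      · simpa only [φm] using h3
      · exact ⟨[a], rfl, v, rfl, rfl⟩

theorem finite_of_map {A : Type} (L : Language A) {T : Type*} [Finite T] (f : FreeMonoid A → T)
    (h : ∀ u v, f u = f v → syntacticCon L u v) : Finite (syntacticCon L).Quotient := by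
  refine Finite.of_injective (fun q : (syntacticCon L).Quotient => f (Quotient.out q)) ?_
  intro q r hqr
  have h1 := h _ _ hqr
  rw [← Quotient.out_eq q, ← Quotient.out_eq r]
  exact Quotient.sound h1

theorem syn_append {A : Type} {L : Language A} {u v : FreeMonoid A} (h : syntacticCon L u v)
    (s t : List A) : (s ++ (FreeMonoid.toList u ++ t) ∈ L ↔ s ++ (FreeMonoid.toList v ++ t) ∈ L) := by
  have := h (FreeMonoid.ofList s) (FreeMonoid.ofList t)
  rw [mul_assoc, mul_assoc] at this
  exact this

theorem syn_of {A : Type} {L : Language A} {u v : FreeMonoid A}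
    (h : ∀ s t : List A, (s ++ (FreeMonoid.toList u ++ t) ∈ L → s ++ (FreeMonoid.toList v ++ t) ∈ L))
    (h' : ∀ s t : List A, (s ++ (FreeMonoid.toList v ++ t) ∈ L → s ++ (FreeMonoid.toList u ++ t) ∈ L)) :
    syntacticCon L u v := by
  intro s t
  rw [mul_assoc, mul_assoc]
  exact ⟨h s t, h' s t⟩

theorem finite_concat {A : Type} (L M : Language A) [Finite (syntacticCon L).Quotient]
    [Finite (syntacticCon M).Quotient] : Finite (syntacticCon (L * M)).Quotient := by
  let f : FreeMonoid A → (syntacticCon L).Quotient × (syntacticCon M).Quotient ×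
      Set ((syntacticCon L).Quotient × (syntacticCon M).Quotient) := fun u =>
    ((u : (syntacticCon L).Quotient), (u : (syntacticCon M).Quotient),
      {p | ∃ x y : FreeMonoid A, x * y = u ∧ p = ((x : (syntacticCon L).Quotient), (y : (syntacticCon M).Quotient))})
  have key : ∀ u v, f u = f v → ∀ s t : List A,
      (s ++ (FreeMonoid.toList u ++ t) ∈ L * M → s ++ (FreeMonoid.toList v ++ t) ∈ L * M) := by
    intro u v h s t
    simp only [f, Prod.mk.injEq] at h
    obtain ⟨hL, hM, hS⟩ := h
    have hL := (Con.eq _).1 hL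
    have hM := (Con.eq _).1 hM
    rintro ⟨x, hx, y, hy, e⟩
    have hx : x ∈ L := hx
    have hy : y ∈ M := hy
    have e : x ++ y = s ++ (FreeMonoid.toList u ++ t) := e
    rcases List.append_eq_append_iff.1 e with ⟨s2, rfl, rfl⟩ | ⟨c, rfl, e2⟩
    · exact ⟨x, hx, s2 ++ (FreeMonoid.toList v ++ t), (syn_append hM s2 t).1 hy, by simp⟩
    rcases List.append_eq_append_iff.1 e2 with ⟨t1, rfl, rfl⟩ | ⟨u2, e3, rfl⟩
    · exact ⟨s ++ (FreeMonoid.toList v ++ t1), (syn_append hL s t1).1 hx, y, hy, by simp⟩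
    · have : (((FreeMonoid.ofList c : FreeMonoid A) : (syntacticCon L).Quotient),
          ((FreeMonoid.ofList u2 : FreeMonoid A) : (syntacticCon M).Quotient)) ∈
          {p : (syntacticCon L).Quotient × (syntacticCon M).Quotient | ∃ x y : FreeMonoid A, x * y = v ∧
            p = ((x : (syntacticCon L).Quotient), (y : (syntacticCon M).Quotient))} := by
        rw [← hS]
        exact ⟨_, _, e3.symm, rfl⟩
      obtain ⟨v1, v2, rfl, h⟩ := this
      rw [Prod.mk.injEq] at h
      have h1 := (Con.eq _).1 h.1
      have h2 := (Con.eq _).1 h.2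
      refine ⟨s ++ FreeMonoid.toList v1, ?_, FreeMonoid.toList v2 ++ t, ?_, ?_⟩
      · have := (syn_append h1 s []).1 (by simpa using hx)
        have h3 : s ++ FreeMonoid.toList v1 ∈ L := by simpa using this
        exact h3
      · exact (syn_append h2 [] t).1 hy
      · simp [FreeMonoid.toList_mul]
  exact finite_of_map _ f fun u v h => syn_of (key u v h) (key v u h.symm)

/-- Power of a list. -/
def lpow {A : Type} (u : List A) (n : ℕ) : List A := FreeMonoid.toList ((FreeMonoid.ofList u) ^ n)

theorem lpow_zero {A : Type} (u : List A) : lpow u 0 = [] := rfl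

theorem lpow_add {A : Type} (u : List A) (m n : ℕ) : lpow u (m + n) = lpow u m ++ lpow u n := by
  unfold lpow
  rw [pow_add, FreeMonoid.toList_mul]

theorem lpow_one {A : Type} (u : List A) : lpow u 1 = u := by
  unfold lpow
  rw [pow_one]; rfl

/-- Aperiodicity of a language. -/
def Aper {A : Type} (n : ℕ) (L : Language A) : Prop :=
  ∀ (k : ℕ), n ≤ k → ∀ u s t : List A, s ++ (lpow u (k + 1) ++ t) ∈ L ↔ s ++ (lpow u k ++ t) ∈ L

theorem aper_iff {A : Type} (n : ℕ) (L : Language A) : Aper n L ↔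
    ∀ m : (syntacticCon L).Quotient, m ^ (n + 1) = m ^ n := by
  constructor
  · intro h m
    induction m using Con.induction_on with
    | _ u =>
    change ((u ^ (n + 1) : FreeMonoid A) : (syntacticCon L).Quotient) = ((u ^ n : FreeMonoid A) : (syntacticCon L).Quotient)
    refine (Con.eq _).2 (syn_of (fun s t => (h n le_rfl (FreeMonoid.toList u) s t).1)
      (fun s t => (h n le_rfl (FreeMonoid.toList u) s t).2))
  · intro h k hk u s t
    have h1 := h ((FreeMonoid.ofList u : FreeMonoid A) : (syntacticCon L).Quotient)
    have h2 : ((FreeMonoid.ofList u : FreeMonoid A) : (syntacticCon L).Quotient) ^ (k + 1)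
      = ((FreeMonoid.ofList u : FreeMonoid A) : (syntacticCon L).Quotient) ^ k := by
      obtain ⟨d, rfl⟩ := Nat.exists_eq_add_of_le hk
      rw [show n + d + 1 = (n + 1) + d by omega, pow_add, h1, ← pow_add]
    change ((FreeMonoid.ofList u ^ (k + 1) : FreeMonoid A) : (syntacticCon L).Quotient) = ((FreeMonoid.ofList u ^ k : FreeMonoid A) : (syntacticCon L).Quotient) at h2
    exact syn_append ((Con.eq _).1 h2) s t

theorem lpow_split {A : Type} (u : List A) (k : ℕ) : ∀ c d : List A, lpow u k = c ++ d →
    (∃ i j u1 u2, i + j + 1 = k ∧ u = u1 ++ u2 ∧ c = lpow u i ++ u1 ∧ d = u2 ++ lpow u j) ∨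
      (c = [] ∧ d = [] ∧ k = 0) := by
  induction k with
  | zero =>
    intro c d h
    rw [lpow_zero] at h
    right
    have := List.append_eq_nil_iff.1 h.symm
    exact ⟨this.1, this.2, rfl⟩
  | succ k ih =>
    intro c d h
    left
    rw [lpow_add, lpow_one] at h
    rcases List.append_eq_append_iff.1 h with ⟨e, rfl, e2⟩ | ⟨e, e1, rfl⟩
    · exact ⟨k, 0, e, d, by omega, e2, rfl, by simp [lpow_zero]⟩
    · rcases ih c e e1 with ⟨i, j, u1, u2, h1, h2, h3, h4⟩ | ⟨rfl, rfl, rfl⟩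
      · exact ⟨i, j + 1, u1, u2, by omega, h2, h3, by rw [h4, lpow_add, lpow_one]; simp⟩
      · exact ⟨0, 0, [], u, by omega, by simp, by simp [lpow_zero], by simp [lpow_zero]⟩

theorem aper_concat {A : Type} {n m : ℕ} {L M : Language A} (hL : Aper n L) (hM : Aper m M) :
    Aper (n + m + 1) (L * M) := by
  -- a decomposition transfers between exponents
  have key : ∀ k k' : ℕ, n + m + 1 ≤ k → (k' = k + 1 ∨ k = k' + 1 ∧ n + m + 1 ≤ k') →
      ∀ u s t : List A, s ++ (lpow u k ++ t) ∈ L * M → s ++ (lpow u k' ++ t) ∈ L * M := by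
    intro k k' hk hk' u s t
    have tL : ∀ i i', n ≤ i → n ≤ i' → (i' = i + 1 ∨ i = i' + 1) → ∀ s t : List A,
        s ++ (lpow u i ++ t) ∈ L → s ++ (lpow u i' ++ t) ∈ L := by
      rintro i i' h1 h2 (rfl | rfl) s t h
      · exact (hL i h1 u s t).2 h
      · exact (hL i' h2 u s t).1 h
    have tM : ∀ i i', m ≤ i → m ≤ i' → (i' = i + 1 ∨ i = i' + 1) → ∀ s t : List A,
        s ++ (lpow u i ++ t) ∈ M → s ++ (lpow u i' ++ t) ∈ M := by
      rintro i i' h1 h2 (rfl | rfl) s t h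
      · exact (hM i h1 u s t).2 h
      · exact (hM i' h2 u s t).1 h
    rintro ⟨x, hx, y, hy, e⟩
    have hx : x ∈ L := hx
    have hy : y ∈ M := hy
    have e : x ++ y = s ++ (lpow u k ++ t) := e
    rcases List.append_eq_append_iff.1 e with ⟨s2, rfl, rfl⟩ | ⟨c, rfl, e2⟩
    · exact ⟨x, hx, s2 ++ (lpow u k' ++ t),
        tM k k' (by omega) (by omega) (by omega) s2 t hy, by simp⟩
    rcases List.append_eq_append_iff.1 e2 with ⟨t1, rfl, rfl⟩ | ⟨d, e3, rfl⟩
    · exact ⟨s ++ (lpow u k' ++ t1), tL k k' (by omega) (by omega) (by omega) s t1 hx, y, hy, by simp⟩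
    rcases lpow_split u k c d e3 with ⟨i, j, u1, u2, h1, h2, rfl, rfl⟩ | ⟨_, _, h⟩
    swap
    · omega
    have pw : ∀ i j, lpow u (i + j + 1) = (lpow u i ++ u1) ++ (u2 ++ lpow u j) := by
      intro i j
      rw [show i + j + 1 = i + (1 + j) by omega, lpow_add, lpow_add, lpow_one]
      nth_rewrite 2 [h2]
      simp
    by_cases hi : n ≤ i ∧ (k' = k + 1 ∨ n + 1 ≤ i)
    · obtain ⟨i', hi'⟩ : ∃ i', i' + k = i + k' := ⟨i + k' - k, by omega⟩
      obtain rfl : k' = i' + j + 1 := by omega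
      refine ⟨s ++ (lpow u i' ++ u1), tL i i' hi.1 (by omega) (by omega) s u1 hx,
        u2 ++ lpow u j ++ t, hy, ?_⟩
      rw [pw]; simp
    · obtain ⟨j', hj'⟩ : ∃ j', j' + k = j + k' := ⟨j + k' - k, by omega⟩
      obtain rfl : k' = i + j' + 1 := by omega
      refine ⟨s ++ (lpow u i ++ u1), hx,
        u2 ++ lpow u j' ++ t, ?_, ?_⟩
      · have := tM j j' (by omega) (by omega) (by omega) u2 t (by simpa using hy)
        have h3 : u2 ++ lpow u j' ++ t ∈ M := by simpa using this
        exact h3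
      · rw [pw]; simp
  intro k hk u s t
  exact ⟨key _ _ (by omega) (Or.inr ⟨rfl, hk⟩) u s t, key _ _ hk (Or.inl rfl) u s t⟩

theorem Aper.mono {A : Type} {n m : ℕ} {L : Language A} (hL : Aper n L) (h : n ≤ m) : Aper m L :=
  fun k hk => hL k (h.trans hk)

theorem lpow_length {A : Type} (u : List A) (n : ℕ) : (lpow u n).length = n * u.length := by
  induction n with
  | zero => simp [lpow_zero]
  | succ n ih => rw [lpow_add, lpow_one, List.length_append, ih]; ring

theorem aper_bounded {A : Type} {N : ℕ} {L : Language A} (h : ∀ w : List A, w ∈ L → w.length ≤ N) :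
    Aper (N + 1) L := by
  intro k hk u s t
  rcases eq_or_ne u [] with rfl | hu
  · have : ∀ n, lpow ([] : List A) n = [] := fun n =>
      List.length_eq_zero_iff.1 (by rw [lpow_length]; simp)
    rw [this, this]
  · have hu := List.length_pos_iff.2 hu
    have hbig : ∀ i, N + 1 ≤ i → s ++ (lpow u i ++ t) ∉ L := by
      intro i hi hm
      have := h _ hm
      simp only [List.length_append, lpow_length] at this
      nlinarith
    exact iff_of_false (hbig _ (by omega)) (hbig _ hk)

/-- Words of length at least two behave identically for languages of words of length ≤ 1. -/
theorem finite_bounded {A : Type} [Fintype A] {L : Language A}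
    (h : ∀ w : List A, w ∈ L → w.length ≤ 1) : Finite (syntacticCon L).Quotient := by
  classical
  refine finite_of_map L (T := Option (Option A)) (fun u => match FreeMonoid.toList u with
    | [] => none
    | [a] => some (some a)
    | _ => some none) ?_
  have key : ∀ w : List A, 2 ≤ w.length → ∀ s t : List A, s ++ (w ++ t) ∉ L := by
    intro w hw s t hm
    have := h _ hm
    simp only [List.length_append] at this
    omega
  intro u v huv
  suffices FreeMonoid.toList u = FreeMonoid.toList v ∨
      (2 ≤ (FreeMonoid.toList u).length ∧ 2 ≤ (FreeMonoid.toList v).length) by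
    rcases this with h1 | ⟨h1, h2⟩
    · have : u = v := FreeMonoid.toList.injective h1
      subst this
      exact (syntacticCon L).refl u
    · exact syn_of (fun s t hm => absurd hm (key _ h1 s t)) (fun s t hm => absurd hm (key _ h2 s t))
  generalize FreeMonoid.toList u = u at huv
  generalize FreeMonoid.toList v = v at huv
  rcases u with _ | ⟨a, _ | ⟨b, u⟩⟩ <;> rcases v with _ | ⟨c, _ | ⟨d, v⟩⟩ <;> simp_all

theorem forward {A : Type} [Fintype A] {L : Language A} (h : StarFree L) :
    Finite (syntacticCon L).Quotient ∧ ∃ n, Aper n L := by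
  induction h with
  | empty =>
    have h : ∀ w : List A, w ∈ (0 : Language A) → w.length ≤ 1 :=
      fun w hw => absurd hw (Language.notMem_zero w)
    exact ⟨finite_bounded h, _, aper_bounded h⟩
  | eps =>
    have h : ∀ w : List A, w ∈ (1 : Language A) → w.length ≤ 1 := by
      intro w hw
      rw [Language.mem_one] at hw
      simp [hw]
    exact ⟨finite_bounded h, _, aper_bounded h⟩
  | letter a =>
    have h : ∀ w : List A, w ∈ ({[a]} : Language A) → w.length ≤ 1 := by
      intro w hw
      have hw : w = [a] := hw
      simp [hw]
    exact ⟨finite_bounded h, _, aper_bounded h⟩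
  | @union L M _ _ ih1 ih2 =>
    obtain ⟨f1, n, h1⟩ := ih1
    obtain ⟨f2, m, h2⟩ := ih2
    refine ⟨?_, max n m, ?_⟩
    · refine finite_of_map _ (T := (syntacticCon L).Quotient × (syntacticCon M).Quotient)
        (fun u => (↑u, ↑u)) ?_
      intro u v h s t
      rw [Prod.mk.injEq] at h
      exact or_congr ((Con.eq _).1 h.1 s t) ((Con.eq _).1 h.2 s t)
    · intro k hk u s t
      exact or_congr (h1 k (by omega) u s t) (h2 k (by omega) u s t)
  | @compl L _ ih =>
    obtain ⟨f1, n, h1⟩ := ih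
    refine ⟨?_, n, ?_⟩
    · refine finite_of_map _ (T := (syntacticCon L).Quotient) (fun u => ↑u) ?_
      intro u v h s t
      exact not_congr ((Con.eq _).1 h s t)
    · intro k hk u s t
      exact not_congr (h1 k hk u s t)
  | @concat L M _ _ ih1 ih2 =>
    obtain ⟨f1, n, h1⟩ := ih1
    obtain ⟨f2, m, h2⟩ := ih2
    exact ⟨finite_concat L M, _, aper_concat h1 h2⟩

/-- **Schützenberger's theorem.** A language `L ⊆ A*` over a finite alphabet `A` is
star-free if and only if its syntactic monoid is finite and aperiodic (there is
`n ≥ 1` with `m^(n+1) = m^n` for every element `m` of the syntactic monoid). -/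
theorem schutzenberger {A : Type} [Fintype A] (L : Language A) :
    StarFree L ↔
      (Finite (syntacticCon L).Quotient ∧
        ∃ n : ℕ, 1 ≤ n ∧ ∀ m : (syntacticCon L).Quotient, m ^ (n + 1) = m ^ n) := by
  constructor
  · intro h
    obtain ⟨h1, n, h2⟩ := forward h
    exact ⟨h1, n + 1, by omega, (aper_iff _ _).1 (h2.mono (by omega))⟩
  · rintro ⟨hf, n, -, hn⟩
    let φ : List A → (syntacticCon L).Quotient :=
      fun w => ((FreeMonoid.ofList w : FreeMonoid A) : (syntacticCon L).Quotient)
    have hsf := sf_fiber hn φ rfl (fun u v => rfl)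
    obtain ⟨M, sM, eM⟩ := sf_iUnion
      (fun i : {m : (syntacticCon L).Quotient // ∃ u : List A, u ∈ L ∧ φ u = m} =>
        fib φ i.1) (fun i => hsf i.1)
    refine sf_congr sM fun w => ?_
    rw [eM]
    constructor
    · rintro ⟨⟨m, u, hu, rfl⟩, hw⟩
      have hw : φ w = φ u := hw
      have := syn_append ((Con.eq _).1 hw) [] []
      simpa using this.2 (by simpa using hu)
    · intro hw
      exact ⟨⟨φ w, w, hw, rfl⟩, rfl⟩
end

section
/- Let A be a finite alphabet and L ⊆ A* a language. Then L is piecewise testable if and only if the syntactic monoid of L is finite and J-trivial. (Simon's theorem.) -/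
/-- The class of piecewise testable languages over the alphabet `A`: the closure
under finite unions, finite intersections and complementation within `A*` of the
languages of the form `A* a₁ A* a₂ ⋯ A* a_k A*`, i.e. the sets of words containing
a fixed word `[a₁, …, a_k]` as a (scattered) subword. -/
inductive PiecewiseTestable {A : Type} : Language A → Prop
  | basic (p : List A) : PiecewiseTestable {w : List A | List.Sublist p w}
  | union {L M : Language A} :
      PiecewiseTestable L → PiecewiseTestable M → PiecewiseTestable (L + M)
  | inter {L M : Language A} :
      PiecewiseTestable L → PiecewiseTestable M → PiecewiseTestable (L ⊓ M)
  | compl {L : Language A} : PiecewiseTestable L → PiecewiseTestable Lᶜ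

/-- A monoid `M` is `𝒥`-trivial if equality of two-sided principal ideals
`M s M = M t M` implies `s = t`. -/
def JTrivial (M : Type) [Monoid M] : Prop :=
  ∀ s t : M, {z : M | ∃ x y : M, z = x * s * y} = {z : M | ∃ x y : M, z = x * t * y} → s = t

/-- Simon's congruence: `u` and `v` have the same subwords of length at most `n`. -/
def SEqv {A : Type} (n : ℕ) (u v : List A) : Prop :=
  ∀ r : List A, r.length ≤ n → (List.Sublist r u ↔ List.Sublist r v)

theorem SEqv.symm' {A : Type} {n : ℕ} {u v : List A} (h : SEqv n u v) : SEqv n v u :=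
  fun r hr => (h r hr).symm

theorem SEqv.trans' {A : Type} {n : ℕ} {u v w : List A} (h : SEqv n u v) (h' : SEqv n v w) :
    SEqv n u w := fun r hr => (h r hr).trans (h' r hr)

theorem SEqv.mono' {A : Type} {n m : ℕ} {u v : List A} (h : SEqv n u v) (hm : m ≤ n) :
    SEqv m u v := fun r hr => h r (hr.trans hm)

theorem SEqv.ctx {A : Type} {n : ℕ} {u v : List A} (h : SEqv n u v) (s t : List A) :
    SEqv n (s ++ u ++ t) (s ++ v ++ t) := by
  have key : ∀ u v : List A, SEqv n u v → ∀ r : List A, r.length ≤ n →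
      List.Sublist r (s ++ u ++ t) → List.Sublist r (s ++ v ++ t) := by
    intro u v h r hr hs
    obtain ⟨r12, r3, rfl, h12, h3⟩ := List.sublist_append_iff.1 hs
    obtain ⟨r1, r2, rfl, h1, h2⟩ := List.sublist_append_iff.1 h12
    refine (h1.append ((h r2 ?_).1 h2)).append h3
    simp at hr; omega
  exact fun r hr => ⟨key u v h r hr, key v u h.symm' r hr⟩

/-- Subword membership when a prefix cannot absorb the first letter. -/
theorem sub_drop {A : Type} {s p y r : List A} {a : A}
    (hn : ¬ List.Sublist (s ++ [a]) p) (h : List.Sublist (s ++ a :: r) (p ++ y)) :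
    List.Sublist (a :: r) y := by
  obtain ⟨l1, l2, he, h1, h2⟩ := List.sublist_append_iff.1 h
  rcases List.append_eq_append_iff.1 he with ⟨c, hc, hc'⟩ | ⟨c, hc, hc'⟩
  · cases c with
    | nil => simp at hc'; rw [hc']; exact h2
    | cons d c =>
      simp at hc'
      obtain ⟨rfl, _⟩ := hc'
      exfalso; apply hn
      rw [hc] at h1
      refine List.Sublist.trans ?_ h1
      simp
  · rw [hc'] at h2
    exact (List.sublist_append_right c _).trans h2

/-- one half of the key step -/
theorem merge_half {A : Type} {n : ℕ} {p x y r1 r2 s1 : List A} {a b : A} (hab : a ≠ b)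
    (h : SEqv n (p ++ a :: x) (p ++ b :: y))
    (hr : (r1 ++ b :: r2).length ≤ n)
    (hr1 : List.Sublist r1 p) (hr2 : List.Sublist r2 (a :: x))
    (hrn : ¬ List.Sublist (r1 ++ b :: r2) (p ++ a :: x))
    (hs1 : List.Sublist s1 p) (hsn : ¬ List.Sublist (s1 ++ [a]) p)
    (hl : s1.length + r2.length + 1 ≤ n) : False := by
  have aux : ∀ t : List A, s1.length + t.length + 1 ≤ n → List.Sublist t x →
      List.Sublist (a :: t) y := by
    intro t ht htx
    have h1 : List.Sublist (s1 ++ a :: t) (p ++ a :: x) := hs1.append (htx.cons_cons a)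
    have h2 := (h _ (by simp; omega)).1 h1
    have h3 := sub_drop hsn h2
    cases h3 with
    | cons _ h => exact h
    | cons_cons _ h => exact absurd rfl hab
  have hry : List.Sublist r2 y := by
    cases hr2 with
    | cons _ h' => exact (List.sublist_cons_self a r2).trans (aux r2 hl h')
    | cons_cons _ h' => exact aux _ (by simp at hl; omega) h'
  exact hrn ((h _ hr).2 (hr1.append (hry.cons_cons b)))

theorem not_seqv_witness {A : Type} {n : ℕ} {p z : List A} {b : A}
    (h : ¬ SEqv n (p ++ z) (p ++ b :: z)) :
    ∃ r1 r2 : List A, (r1 ++ b :: r2).length ≤ n ∧ List.Sublist r1 p ∧ List.Sublist r2 z ∧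
      ¬ List.Sublist (r1 ++ b :: r2) (p ++ z) ∧ ¬ List.Sublist (r1 ++ [b]) p := by
  unfold SEqv at h
  push Not at h
  obtain ⟨r, hr, h⟩ := h
  have h' : List.Sublist r (p ++ b :: z) ∧ ¬ List.Sublist r (p ++ z) := by
    rcases h with ⟨h1, h2⟩ | ⟨h1, h2⟩
    · exact absurd (h1.trans ((List.Sublist.refl p).append (List.sublist_cons_self b z))) h2
    · exact ⟨h2, h1⟩
  obtain ⟨h1, h2⟩ := h'
  obtain ⟨r1, r2, rfl, hr1, hr2⟩ := List.sublist_append_iff.1 h1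
  cases hr2 with
  | cons _ h' => exact absurd (hr1.append h') h2
  | @cons_cons r2 _ _ h' =>
    refine ⟨r1, r2, hr, hr1, h', h2, fun hc => h2 ?_⟩
    have := hc.append h'
    simpa using this

theorem merge {A : Type} {n : ℕ} : ∀ (k : ℕ) (p x y : List A), x.length + y.length ≤ k →
    SEqv n (p ++ x) (p ++ y) →
    ∃ w, List.Sublist (p ++ x) w ∧ List.Sublist (p ++ y) w ∧ SEqv n (p ++ x) w := by
  intro k
  induction k with
  | zero =>
    intro p x y hk h
    have hx : x = [] := List.length_eq_zero_iff.1 (by omega)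
    have hy : y = [] := List.length_eq_zero_iff.1 (by omega)
    subst hx hy
    exact ⟨_, List.Sublist.refl _, List.Sublist.refl _, fun _ _ => Iff.rfl⟩
  | succ k ih =>
    intro p x y hk h
    cases x with
    | nil =>
      exact ⟨p ++ y, (List.Sublist.refl p).append (List.nil_sublist y), List.Sublist.refl _, h⟩
    | cons a x =>
    cases y with
    | nil =>
      exact ⟨p ++ a :: x, List.Sublist.refl _, (List.Sublist.refl p).append (List.nil_sublist _),
        fun _ _ => Iff.rfl⟩
    | cons b y =>
    simp only [List.length_cons] at hk
    by_cases hab : a = b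
    · subst hab
      have := ih (p ++ [a]) x y (by omega) (by simpa using h)
      simpa using this
    · by_cases h1 : SEqv n (p ++ a :: x) (p ++ b :: a :: x)
      · obtain ⟨w, hw1, hw2, hw3⟩ := ih (p ++ [b]) (a :: x) y (by simp; omega)
          (by simpa using h1.symm'.trans' h)
        simp only [List.append_assoc, List.singleton_append] at hw1 hw2 hw3
        exact ⟨w, ((List.Sublist.refl p).append (List.sublist_cons_self b _)).trans hw1, hw2,
          h1.trans' hw3⟩
      · by_cases h2 : SEqv n (p ++ b :: y) (p ++ a :: b :: y)
        · obtain ⟨w, hw1, hw2, hw3⟩ := ih (p ++ [a]) x (b :: y) (by simp; omega)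
            (by simpa using h.trans' h2)
          simp only [List.append_assoc, List.singleton_append] at hw1 hw2 hw3
          exact ⟨w, hw1, ((List.Sublist.refl p).append (List.sublist_cons_self a _)).trans hw2,
            hw3⟩
        · exfalso
          obtain ⟨r1, r2, hr, hr1, hr2, hrn, hrb⟩ := not_seqv_witness h1
          obtain ⟨s1, s2, hs, hs1, hs2, hsn, hsa⟩ := not_seqv_witness h2
          have hr' := hr
          have hs' := hs
          simp only [List.length_append, List.length_cons] at hr' hs'
          by_cases hl : s1.length + r2.length + 1 ≤ n
          · exact merge_half hab h hr hr1 hr2 hrn hs1 hsa hl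
          · exact merge_half (Ne.symm hab) h.symm' hs hs1 hs2 hsn hr1 hrb (by omega)

theorem split_fix {A M : Type} [Monoid M] (g : A → M) (s : M) : ∀ x : List A,
    (∀ c ∈ x, s * g c = s) ∨
    ∃ z b x', x = z ++ b :: x' ∧ (∀ c ∈ z, s * g c = s) ∧ s * g b ≠ s := by
  intro x
  induction x with
  | nil => left; simp
  | cons c x ih =>
    by_cases hc : s * g c = s
    · rcases ih with h | ⟨z, b, x', rfl, hz, hb⟩
      · left; simpa [hc] using h
      · exact Or.inr ⟨c :: z, b, x', rfl, by simpa [hc] using hz, hb⟩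
    · exact Or.inr ⟨[], c, x, rfl, by simp, hc⟩

theorem fix_prod {A M : Type} [Monoid M] (g : A → M) (s : M) : ∀ x : List A,
    (∀ c ∈ x, s * g c = s) → s * (x.map g).prod = s := by
  intro x
  induction x with
  | nil => simp
  | cons c x ih =>
    intro h
    simp only [List.map_cons, List.prod_cons, ← mul_assoc]
    rw [h c (by simp)]
    exact ih fun d hd => h d (by simp [hd])

theorem right_absorb {A M : Type} [Monoid M] [Finite M] (g : A → M)
    (hR : ∀ s b t : M, s = s * b * t → s = s * b) (a : A) :
    ∀ (n : ℕ) (s : M) (x : List A), (Set.range (fun t : M => s * t)).ncard ≤ n →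
      (∀ r : List A, r.length ≤ n → List.Sublist r (x ++ [a]) → List.Sublist r x) →
      s * (x.map g).prod * g a = s * (x.map g).prod := by
  intro n
  induction n with
  | zero =>
    intro s x hn _
    have : 0 < (Set.range (fun t : M => s * t)).ncard :=
      (Set.ncard_pos (Set.toFinite _)).2 ⟨s * 1, 1, rfl⟩
    omega
  | succ n ih =>
    intro s x hn h
    rcases split_fix g s x with hx | ⟨z, b, x', rfl, hz, hb⟩
    · rw [fix_prod g s x hx]
      have := h [a] (by simp) (List.sublist_append_right x [a])
      exact hx a (by simpa using this)
    · have e : s * ((z ++ b :: x').map g).prod = (s * g b) * (x'.map g).prod := by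
        simp only [List.map_append, List.map_cons, List.prod_append, List.prod_cons]
        rw [← mul_assoc, fix_prod g s z hz, mul_assoc]
      rw [e]
      apply ih
      · have : Set.range (fun t : M => s * g b * t) ⊂ Set.range (fun t : M => s * t) := by
          refine ⟨?_, fun hc => ?_⟩
          · rintro _ ⟨t, rfl⟩
            exact ⟨g b * t, by simp [mul_assoc]⟩
          · obtain ⟨t, ht⟩ := hc ⟨1, rfl⟩
            simp only [mul_one] at ht
            exact hb (hR s (g b) t ht.symm).symm
        have := Set.ncard_lt_ncard this (Set.toFinite _)
        omega
      · intro r hr hs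
        have hbz : ¬ List.Sublist ([] ++ [b]) z := by
          intro hc
          exact hb (hz b (by simpa using hc))
        have h1 := h (b :: r) (by simp; omega) (by
          rw [List.append_assoc]
          exact (hs.cons_cons b).trans (List.sublist_append_right z _))
        have h2 := sub_drop (s := []) hbz (by simpa using h1)
        simpa using h2

theorem left_absorb {A M : Type} [Monoid M] [Finite M] (g : A → M)
    (hL : ∀ s b t : M, s = t * b * s → s = b * s) (a : A) (n : ℕ) (y : List A)
    (hn : Nat.card M ≤ n)
    (h : ∀ r : List A, r.length ≤ n → List.Sublist r (a :: y) → List.Sublist r y) :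
    g a * (y.map g).prod = (y.map g).prod := by
  have hfin : Finite Mᵐᵒᵖ := Finite.of_equiv M MulOpposite.opEquiv
  have key := right_absorb (M := Mᵐᵒᵖ) (fun c => MulOpposite.op (g c)) (by
    intro s b t hs
    have := hL s.unop b.unop t.unop (by
      apply MulOpposite.op_injective
      simpa [mul_assoc] using hs)
    apply MulOpposite.unop_injective
    simpa using this) a n 1 y.reverse (by
      refine (Set.ncard_le_card _).trans ?_
      simpa [Nat.card_congr MulOpposite.opEquiv.symm] using hn) (by
      intro r hr hs
      have := h r.reverse (by simpa using hr) (by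
        have := hs.reverse
        simpa using this)
      simpa using this.reverse)
  have e : (y.reverse.map (fun c => MulOpposite.op (g c))).prod
      = MulOpposite.op (y.map g).prod := by
    rw [MulOpposite.op_list_prod, List.map_map, List.map_reverse]
    rfl
  rw [e] at key
  apply MulOpposite.op_injective
  simpa using key

theorem insert_one {A M : Type} [Monoid M] [Finite M] (g : A → M)
    (hR : ∀ s b t : M, s = s * b * t → s = s * b)
    (hL : ∀ s b t : M, s = t * b * s → s = b * s) (a : A) (x y : List A)
    (h : SEqv (2 * Nat.card M) (x ++ y) (x ++ a :: y)) :
    ((x ++ y).map g).prod = ((x ++ a :: y).map g).prod := by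
  by_cases h1 : ∀ r : List A, r.length ≤ Nat.card M → List.Sublist r (x ++ [a]) → List.Sublist r x
  · have := right_absorb g hR a (Nat.card M) 1 x (Set.ncard_le_card _) h1
    simp only [one_mul] at this
    simp only [List.map_append, List.map_cons, List.prod_append, List.prod_cons]
    rw [← mul_assoc, this]
  by_cases h2 : ∀ r : List A, r.length ≤ Nat.card M → List.Sublist r (a :: y) → List.Sublist r y
  · have := left_absorb g hL a (Nat.card M) y le_rfl h2
    simp only [List.map_append, List.map_cons, List.prod_append, List.prod_cons]
    rw [this]
  exfalso
  push Not at h1 h2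
  obtain ⟨r, hr, hra, hrn⟩ := h1
  obtain ⟨s, hs, hsa, hsn⟩ := h2
  obtain ⟨r1, r2, rfl, hr1, hr2⟩ := List.sublist_append_iff.1 hra
  cases hr2 with
  | cons _ h' =>
    simp at h'
    subst h'
    simp at hrn
    exact hrn hr1
  | cons_cons _ h' =>
    simp at h'
    subst h'
    cases hsa with
    | cons _ h' => exact hsn h'
    | @cons_cons s _ _ h' =>
      have h3 := (h (r1 ++ a :: s) (by simp at hr hs ⊢; omega)).2 (hr1.append (h'.cons_cons a))
      exact hsn (sub_drop hrn h3)

theorem insert_many {A M : Type} [Monoid M] [Finite M] (g : A → M)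
    (hR : ∀ s b t : M, s = s * b * t → s = s * b)
    (hL : ∀ s b t : M, s = t * b * s → s = b * s) {u w : List A} (hs : List.Sublist u w) :
    ∀ p : List A, SEqv (2 * Nat.card M) (p ++ u) (p ++ w) →
      ((p ++ u).map g).prod = ((p ++ w).map g).prod := by
  induction hs with
  | slnil => intro p _; rfl
  | @cons u w a hs ih =>
    intro p h
    have h1 : SEqv (2 * Nat.card M) (p ++ u) (p ++ w) := fun r hr =>
      ⟨fun h' => h'.trans ((List.Sublist.refl p).append hs),
       fun h' => (h r hr).2 (h'.trans
        ((List.Sublist.refl p).append (List.sublist_cons_self a w)))⟩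
    exact (ih p h1).trans (insert_one g hR hL a p w (h1.symm'.trans' h))
  | @cons_cons u w a hs ih =>
    intro p h
    have := ih (p ++ [a]) (by simpa using h)
    simpa using this

theorem seqv_prod {A M : Type} [Monoid M] [Finite M] (g : A → M)
    (hR : ∀ s b t : M, s = s * b * t → s = s * b)
    (hL : ∀ s b t : M, s = t * b * s → s = b * s) {u v : List A}
    (h : SEqv (2 * Nat.card M) u v) : (u.map g).prod = (v.map g).prod := by
  obtain ⟨w, h1, h2, h3⟩ := merge _ [] u v le_rfl h
  exact (insert_many g hR hL h1 [] h3).trans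
    (insert_many g hR hL h2 [] (h.symm'.trans' h3)).symm

theorem pt_congr {A : Type} {L M : Language A} (h : PiecewiseTestable M) (e : L = M) :
    PiecewiseTestable L := e ▸ h

theorem pt_of_saturated {A : Type} (F : Finset (List A)) : ∀ L : Language A,
    (∀ u v : List A, (∀ p ∈ F, (List.Sublist p u ↔ List.Sublist p v)) → u ∈ L → v ∈ L) →
    PiecewiseTestable L := by
  classical
  induction F using Finset.induction_on with
  | empty =>
    intro L h
    have hu : PiecewiseTestable ({w : List A | List.Sublist [] w} : Language A) := .basic []
    by_cases hL : ∃ u, u ∈ L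
    · obtain ⟨u, hu'⟩ := hL
      refine pt_congr (hu) ?_
      ext v
      exact ⟨fun _ => List.nil_sublist v, fun _ => h u v (by simp) hu'⟩
    · refine pt_congr (hu.compl) ?_
      ext v
      exact ⟨fun hv => (hL ⟨v, hv⟩).elim, fun hv => (hv (List.nil_sublist v)).elim⟩
  | insert p F hp ih =>
    intro L h
    let P : Language A := {w : List A | List.Sublist p w}
    let L1 : Language A := {w : List A | ∃ u ∈ L, List.Sublist p u ∧
      ∀ q ∈ F, (List.Sublist q u ↔ List.Sublist q w)}
    let L2 : Language A := {w : List A | ∃ u ∈ L, ¬ List.Sublist p u ∧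
      ∀ q ∈ F, (List.Sublist q u ↔ List.Sublist q w)}
    have hP : PiecewiseTestable P := .basic p
    have h1 : PiecewiseTestable L1 := by
      apply ih
      rintro u v huv ⟨w, hw, hpw, hq⟩
      exact ⟨w, hw, hpw, fun q hqF => (hq q hqF).trans (huv q hqF)⟩
    have h2 : PiecewiseTestable L2 := by
      apply ih
      rintro u v huv ⟨w, hw, hpw, hq⟩
      exact ⟨w, hw, hpw, fun q hqF => (hq q hqF).trans (huv q hqF)⟩
    refine pt_congr ((hP.inter h1).union (hP.compl.inter h2)) ?_
    ext v
    rw [Language.mem_add]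
    constructor
    · intro hv
      by_cases hpv : List.Sublist p v
      · exact Or.inl ⟨hpv, v, hv, hpv, fun _ _ => Iff.rfl⟩
      · exact Or.inr ⟨hpv, v, hv, hpv, fun _ _ => Iff.rfl⟩
    · rintro (⟨hpv, u, hu, hpu, hq⟩ | ⟨hpv, u, hu, hpu, hq⟩)
      · refine h u v ?_ hu
        intro q hqF
        rcases Finset.mem_insert.1 hqF with rfl | hqF
        · exact ⟨fun _ => hpv, fun _ => hpu⟩
        · exact hq q hqF
      · refine h u v ?_ hu
        intro q hqF
        rcases Finset.mem_insert.1 hqF with rfl | hqF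
        · exact ⟨fun h => absurd h hpu, fun h => absurd h hpv⟩
        · exact hq q hqF

theorem PiecewiseTestable.exists_seqv {A : Type} {L : Language A} (h : PiecewiseTestable L) :
    ∃ n, ∀ u v : List A, SEqv n u v → (u ∈ L ↔ v ∈ L) := by
  induction h with
  | basic p => exact ⟨p.length, fun u v h => h p le_rfl⟩
  | union _ _ ih1 ih2 =>
    obtain ⟨n, hn⟩ := ih1
    obtain ⟨m, hm⟩ := ih2
    refine ⟨max n m, fun u v h => ?_⟩
    rw [Language.mem_add, Language.mem_add, hn u v (h.mono' (le_max_left _ _)),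
      hm u v (h.mono' (le_max_right _ _))]
  | inter _ _ ih1 ih2 =>
    obtain ⟨n, hn⟩ := ih1
    obtain ⟨m, hm⟩ := ih2
    exact ⟨max n m, fun u v h => and_congr (hn u v (h.mono' (le_max_left _ _)))
      (hm u v (h.mono' (le_max_right _ _)))⟩
  | compl _ ih =>
    obtain ⟨n, hn⟩ := ih
    exact ⟨n, fun u v h => not_congr (hn u v h)⟩

theorem exists_stable {A : Type} [Fintype A] (n : ℕ) (U : ℕ → List A)
    (hU : ∀ k, List.Sublist (U k) (U (k + 1))) : ∃ k, SEqv n (U k) (U (k + 1)) := by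
  by_contra hc
  push Not at hc
  let S : ℕ → Set (List A) := fun k => {r | r.length ≤ n ∧ List.Sublist r (U k)}
  have hfin : ({r : List A | r.length ≤ n}).Finite := List.finite_length_le A n
  have hS : ∀ k, (S k).Finite := fun k => hfin.subset fun r hr => hr.1
  have hlt : ∀ k, (S k).ncard < (S (k + 1)).ncard := by
    intro k
    refine Set.ncard_lt_ncard ⟨fun r hr => ⟨hr.1, hr.2.trans (hU k)⟩, fun h => hc k ?_⟩ (hS _)
    exact fun r hr => ⟨fun h' => h'.trans (hU k), fun h' => (h ⟨hr, h'⟩).2⟩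
  have hle : ∀ k, k ≤ (S k).ncard := by
    intro k
    induction k with
    | zero => omega
    | succ k ih => have := hlt k; omega
  have h1 := hle (({r : List A | r.length ≤ n}).ncard + 1)
  have h2 : (S (({r : List A | r.length ≤ n}).ncard + 1)).ncard
      ≤ ({r : List A | r.length ≤ n}).ncard :=
    Set.ncard_le_ncard (fun r hr => hr.1) hfin
  omega

theorem simon_forward {A : Type} [Fintype A] (L : Language A) (h : PiecewiseTestable L) :
    Finite (syntacticCon L).Quotient ∧ JTrivial (syntacticCon L).Quotient := by
  obtain ⟨n, hn⟩ := h.exists_seqv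
  have hcon : ∀ u v : FreeMonoid A, SEqv n u v →
      ((u : (syntacticCon L).Quotient) = (v : (syntacticCon L).Quotient)) := by
    intro u v huv
    exact (Con.eq _).2 fun s t => hn _ _ (SEqv.ctx huv s t)
  constructor
  · have hfin : ({r : List A | r.length ≤ n}).Finite := List.finite_length_le A n
    have : Finite ↥(Set.powerset {r : List A | r.length ≤ n}) := hfin.finite_subsets.to_subtype
    let T : (syntacticCon L).Quotient → ↥(Set.powerset {r : List A | r.length ≤ n}) := fun q =>
      ⟨{r | r.length ≤ n ∧ List.Sublist r (Quotient.out q : FreeMonoid A)}, fun r hr => hr.1⟩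
    refine Finite.of_injective T ?_
    intro q q' hq
    have e : ∀ q : (syntacticCon L).Quotient,
        (((Quotient.out q : FreeMonoid A)) : (syntacticCon L).Quotient) = q :=
      fun q => Quotient.out_eq q
    rw [← e q, ← e q']
    apply hcon
    intro r hr
    have h1 := congrArg Subtype.val hq
    have h2 := Set.ext_iff.1 h1 r
    exact ⟨fun h => (h2.1 ⟨hr, h⟩).2, fun h => (h2.2 ⟨hr, h⟩).2⟩
  · intro s t hst
    have hs : ∃ x y, s = x * t * y := by
      have : s ∈ {z | ∃ x y, z = x * s * y} := ⟨1, 1, by simp⟩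
      rw [hst] at this
      exact this
    have ht : ∃ x y, t = x * s * y := by
      have : t ∈ {z | ∃ x y, z = x * t * y} := ⟨1, 1, by simp⟩
      rw [← hst] at this
      exact this
    obtain ⟨x, y, hxy⟩ := hs
    obtain ⟨z, w, hzw⟩ := ht
    obtain ⟨X, rfl⟩ := Con.mk'_surjective x
    obtain ⟨Y, rfl⟩ := Con.mk'_surjective y
    obtain ⟨Z, rfl⟩ := Con.mk'_surjective z
    obtain ⟨W, rfl⟩ := Con.mk'_surjective w
    obtain ⟨S, rfl⟩ := Con.mk'_surjective s
    let step : FreeMonoid A → FreeMonoid A := fun u => X * (Z * u * W) * Y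
    let U : ℕ → FreeMonoid A := fun k => step^[k] S
    have hsucc : ∀ k, U (k + 1) = X * (Z * U k * W) * Y := fun k =>
      Function.iterate_succ_apply' step k S
    have sub : ∀ p q r : FreeMonoid A, List.Sublist (α := A) q (p * q * r) := fun p q r =>
      (List.sublist_append_right p q).trans (List.sublist_append_left (α := A) _ r)
    obtain ⟨k, hk⟩ := exists_stable n U (fun k => by
      rw [hsucc]; exact (sub Z (U k) W).trans (sub X _ Y))
    have hUk : ∀ k, (syntacticCon L).mk' (U k) = (syntacticCon L).mk' S := by
      intro k
      induction k with
      | zero => rfl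
      | succ k ih =>
        rw [hsucc]
        simp only [map_mul]
        rw [ih, ← hzw, ← hxy]
    rw [hzw, ← hUk k, ← map_mul, ← map_mul]
    apply hcon
    intro r hr
    refine ⟨fun h => h.trans (sub Z (U k) W), fun h => (hk r hr).2 ?_⟩
    rw [hsucc]
    exact h.trans (sub X _ Y)

theorem simon_backward {A : Type} [Fintype A] (L : Language A)
    (hF : Finite (syntacticCon L).Quotient) (hJ : JTrivial (syntacticCon L).Quotient) :
    PiecewiseTestable L := by
  have hR : ∀ s b t : (syntacticCon L).Quotient, s = s * b * t → s = s * b := by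
    intro s b t h
    apply hJ
    ext z
    constructor
    · rintro ⟨x, y, rfl⟩
      exact ⟨x, t * y, by conv_lhs => rw [h]
                          simp only [mul_assoc]⟩
    · rintro ⟨x, y, rfl⟩
      exact ⟨x, b * y, by simp only [mul_assoc]⟩
  have hL : ∀ s b t : (syntacticCon L).Quotient, s = t * b * s → s = b * s := by
    intro s b t h
    apply hJ
    ext z
    constructor
    · rintro ⟨x, y, rfl⟩
      exact ⟨x * t, y, by conv_lhs => rw [h]
                          simp only [mul_assoc]⟩
    · rintro ⟨x, y, rfl⟩
      exact ⟨x * b, y, by simp only [mul_assoc]⟩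
  let g : A → (syntacticCon L).Quotient := fun a => (syntacticCon L).mk' (FreeMonoid.of a)
  have hg : ∀ w : FreeMonoid A, (syntacticCon L).mk' w = (w.toList.map g).prod := by
    intro w
    rw [← FreeMonoid.lift_apply]
    congr 1
    exact FreeMonoid.hom_eq fun a => by simp [g]
  have hfin : ({r : List A | r.length ≤ 2 * Nat.card (syntacticCon L).Quotient}).Finite :=
    List.finite_length_le A _
  refine pt_of_saturated hfin.toFinset L ?_
  intro u v huv hu
  have h : SEqv (2 * Nat.card (syntacticCon L).Quotient) u v := fun r hr =>
    huv r (hfin.mem_toFinset.2 hr)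
  have h1 : (syntacticCon L).mk' (FreeMonoid.ofList u) = (syntacticCon L).mk' (FreeMonoid.ofList v) := by
    rw [hg, hg]
    exact seqv_prod g hR hL h
  have h2 := (Con.eq _).1 h1 1 1
  simp only [one_mul, mul_one] at h2
  exact h2.1 hu

/-- **Simon's theorem.** A language `L ⊆ A*` over a finite alphabet `A` is piecewise
testable if and only if its syntactic monoid is finite and `𝒥`-trivial. -/
theorem simon {A : Type} [Fintype A] (L : Language A) :
    PiecewiseTestable L ↔
      (Finite (syntacticCon L).Quotient ∧ JTrivial (syntacticCon L).Quotient) := by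
  exact ⟨simon_forward L, fun h => simon_backward L h.1 h.2⟩
end

section
/- Let F be a free group and let H₁, …, Hₙ be finitely generated subgroups of F. Then the product set H₁H₂⋯Hₙ = {h₁h₂⋯hₙ : hᵢ ∈ Hᵢ} is closed in the profinite topology of F; explicitly, for every g ∈ F with g ∉ H₁H₂⋯Hₙ there exists a normal subgroup N of F of finite index such that the coset gN is disjoint from H₁H₂⋯Hₙ. (Ribes–Zalesskiĭ theorem, equivalent to Ash's Type-II theorem via Pin–Reutenauer.) -/
namespace RZ

open Equiv

variable {A : Type}

/-- Words labelling a path inside the edge set `E`, starting at `x`, letters in `S`. -/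
inductive RPath {X : Type} (ρ : FreeGroup A →* Perm X) (S : Finset A) (E : Set (X × A)) (x : X) :
    FreeGroup A → Prop
  | one : RPath ρ S E x 1
  | fwd {w : FreeGroup A} {a : A} : RPath ρ S E x w → a ∈ S → (ρ w x, a) ∈ E →
      RPath ρ S E x (FreeGroup.of a * w)
  | bwd {w : FreeGroup A} {a : A} : RPath ρ S E x w → a ∈ S →
      (ρ ((FreeGroup.of a)⁻¹ * w) x, a) ∈ E → RPath ρ S E x ((FreeGroup.of a)⁻¹ * w)

section basic
variable {X Y : Type} {ρ : FreeGroup A →* Perm X} {ρY : FreeGroup A →* Perm Y} {S : Finset A}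

theorem RPath.trans {E : Set (X × A)} {x : X} {u v : FreeGroup A} (hu : RPath ρ S E x u)
    (hv : RPath ρ S E (ρ u x) v) : RPath ρ S E x (v * u) := by
  induction hv with
  | one => simpa using hu
  | fwd _ ha he ih =>
    rw [mul_assoc]
    exact RPath.fwd ih ha (by simpa using he)
  | bwd _ ha he ih =>
    rw [mul_assoc]
    exact RPath.bwd ih ha (by simpa using he)

theorem RPath.symm {E : Set (X × A)} {x : X} {u : FreeGroup A} (hu : RPath ρ S E x u) :
    RPath ρ S E (ρ u x) u⁻¹ := by
  induction hu with
  | one => simpa using RPath.one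
  | @fwd w a _ ha he ih =>
    have h1 : RPath ρ S E (ρ (FreeGroup.of a * w) x) ((FreeGroup.of a)⁻¹ * 1) :=
      RPath.bwd RPath.one ha (by simpa using he)
    have h2 := h1.trans (v := w⁻¹) (by simpa using ih)
    simpa using h2
  | @bwd w a _ ha he ih =>
    have h1 : RPath ρ S E (ρ ((FreeGroup.of a)⁻¹ * w) x) (FreeGroup.of a * 1) :=
      RPath.fwd RPath.one ha (by simpa using he)
    have h2 := h1.trans (v := w⁻¹) (by simpa using ih)
    simpa using h2

theorem RPath.mono {E E' : Set (X × A)} (h : E ⊆ E') {x : X} {u : FreeGroup A}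
    (hu : RPath ρ S E x u) : RPath ρ S E' x u := by
  induction hu with
  | one => exact .one
  | fwd _ ha he ih => exact .fwd ih ha (h he)
  | bwd _ ha he ih => exact .bwd ih ha (h he)

theorem RPath.pull {f : Y → X} (hf : ∀ w y, f (ρY w y) = ρ w (f y)) {E : Set (X × A)} {y : Y}
    {u : FreeGroup A} (h : RPath ρ S E (f y) u) :
    RPath ρY S {e | (f e.1, e.2) ∈ E} y u := by
  induction h with
  | one => exact .one
  | fwd _ ha he ih => exact .fwd ih ha (by simpa only [Set.mem_ofPred_eq, hf] using he)
  | bwd _ ha he ih => exact .bwd ih ha (by simpa only [Set.mem_ofPred_eq, hf] using he)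

theorem RPath.push {f : Y → X} (hf : ∀ w y, f (ρY w y) = ρ w (f y)) {E : Set (X × A)} {y : Y}
    {u : FreeGroup A} (h : RPath ρY S {e | (f e.1, e.2) ∈ E} y u) :
    RPath ρ S E (f y) u := by
  induction h with
  | one => exact .one
  | fwd _ ha he ih => exact .fwd ih ha (by simpa only [Set.mem_ofPred_eq, hf] using he)
  | bwd _ ha he ih => exact .bwd ih ha (by simpa only [Set.mem_ofPred_eq, hf] using he)

/-- The path visits only reachable vertices. -/
theorem RPath.reach {E : Set (X × A)} {x : X} {u : FreeGroup A} (h : RPath ρ S E x u) :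
    RPath ρ S {e | (∃ v, RPath ρ S E x v ∧ ρ v x = e.1) ∧
      (∃ v, RPath ρ S E x v ∧ ρ v x = ρ (FreeGroup.of e.2) e.1)} x u := by
  induction h with
  | one => exact .one
  | @fwd w a h ha he ih =>
    exact .fwd ih ha ⟨⟨w, h, rfl⟩, ⟨_, .fwd h ha he, by simp⟩⟩
  | @bwd w a h ha he ih =>
    exact .bwd ih ha ⟨⟨_, .bwd h ha he, rfl⟩, ⟨w, h, by simp⟩⟩

/-- Concatenations of paths, the `i`-th one in the `i`-th edge set and ending in the `i`-th
vertex set. -/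
def RChain {X : Type} (ρ : FreeGroup A →* Perm X) (S : Finset A) :
    List (Set (X × A) × Set X) → X → FreeGroup A → Prop
  | [], _, w => w = 1
  | P :: L, x, w => ∃ u v, RPath ρ S P.1 x u ∧ ρ u x ∈ P.2 ∧ RChain ρ S L (ρ u x) v ∧ w = v * u

theorem RChain.single {M : Set (X × A)} {x : X} {u : FreeGroup A} (h : RPath ρ S M x u) :
    RChain ρ S [(M, Set.univ)] x u :=
  ⟨u, 1, h, trivial, rfl, by simp⟩

theorem RChain.of_single {M : Set (X × A)} {Z : Set X} {x : X} {u : FreeGroup A}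
    (h : RChain ρ S [(M, Z)] x u) : RPath ρ S M x u := by
  obtain ⟨u', v, h1, -, h2, rfl⟩ := h
  cases h2
  simpa using h1

theorem RChain.merge {L1 L2 : List (Set (X × A) × Set X)} {M : Set (X × A)} {Z : Set X} {x : X}
    {w1 w2 : FreeGroup A} (h1 : RChain ρ S (L1 ++ [(M, Set.univ)]) x w1)
    (h2 : RChain ρ S ((M, Z) :: L2) (ρ w1 x) w2) :
    RChain ρ S (L1 ++ (M, Z) :: L2) x (w2 * w1) := by
  induction L1 generalizing x w1 with
  | nil =>
    have h1 := RChain.of_single h1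
    obtain ⟨u, v, hu, hz, hv, rfl⟩ := h2
    exact ⟨u * w1, v, h1.trans hu, by simpa using hz, by simpa using hv, by rw [mul_assoc]⟩
  | cons P L1 ih =>
    obtain ⟨u, v, hu, hz, hv, rfl⟩ := h1
    refine ⟨u, w2 * v, hu, hz, ih hv (by simpa using h2), by rw [mul_assoc]⟩

/-- Splitting at the very end. -/
theorem RChain.split_end {L : List (Set (X × A) × Set X)} (hL : L ≠ []) {x : X}
    {w : FreeGroup A} (h : RChain ρ S L x w) :
    ∃ L1 M Z L2, L = L1 ++ (M, Z) :: L2 ∧ RChain ρ S (L1 ++ [(M, Set.univ)]) x w ∧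
      RChain ρ S ((M, Z) :: L2) (ρ w x) 1 := by
  induction L generalizing x w with
  | nil => exact absurd rfl hL
  | cons P L ih =>
    obtain ⟨u, v, hu, hz, hv, rfl⟩ := h
    by_cases hL' : L = []
    · subst hL'
      cases hv
      refine ⟨[], P.1, P.2, [], rfl, ?_, ?_⟩
      · simpa using RChain.single hu
      · exact ⟨1, 1, .one, by simpa using hz, rfl, by simp⟩
    · obtain ⟨L1, M, Z, L2, rfl, h1, h2⟩ := ih hL' hv
      exact ⟨P :: L1, M, Z, L2, rfl, ⟨u, v, hu, hz, h1, rfl⟩, by simpa using h2⟩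

/-- `v` is a vertex on some chain from `y0` to `y1`, up to changing the connecting paths. -/
def Spl {X Y : Type} (ρ : FreeGroup A →* Perm X) (ρY : FreeGroup A →* Perm Y) (S : Finset A)
    (f : Y → X) (L : List (Set (X × A) × Set X)) (y0 y1 v : Y) : Prop :=
  ∃ L1 M Z L2, L = L1 ++ (M, Z) :: L2 ∧
    (∃ w, RChain ρ S (L1 ++ [(M, Set.univ)]) (f y0) w ∧ ρY w y0 = v) ∧
    (∃ w, RChain ρ S ((M, Z) :: L2) (f v) w ∧ ρY w v = y1)

theorem RChain.path_spl {f : Y → X} (hf : ∀ w y, f (ρY w y) = ρ w (f y))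
    {L : List (Set (X × A) × Set X)} {y0 : Y} {w : FreeGroup A} (h : RChain ρ S L (f y0) w) :
    RPath ρY S {e | Spl ρ ρY S f L y0 (ρY w y0) e.1 ∧
      Spl ρ ρY S f L y0 (ρY w y0) (ρY (FreeGroup.of e.2) e.1)} y0 w := by
  induction L generalizing y0 w with
  | nil => cases h; exact .one
  | cons P L ih =>
    obtain ⟨u, v, hu, hz, hv, rfl⟩ := h
    rw [← hf] at hv
    refine RPath.trans (RPath.mono ?_ (hu.pull hf).reach) (RPath.mono ?_ (ih hv))
    · have key : ∀ t : Y, (∃ v, RPath ρY S {e | (f e.1, e.2) ∈ P.1} y0 v ∧ ρY v y0 = t) →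
          Spl ρ ρY S f (P :: L) y0 (ρY (v * u) y0) t := by
        rintro t ⟨r, hr, rfl⟩
        have hr := hr.push hf
        refine ⟨[], P.1, P.2, L, rfl, ⟨r, RChain.single hr, rfl⟩, (v * u) * r⁻¹, ?_, by simp⟩
        refine ⟨u * r⁻¹, v, ?_, ?_, ?_, by rw [mul_assoc]⟩
        · rw [hf]
          exact hr.symm.trans (by simpa using hu)
        · simpa [hf] using hz
        · simpa [hf] using hv
      rintro ⟨t, a⟩ ⟨h1, h2⟩
      exact ⟨key _ h1, key _ h2⟩
    · have key : ∀ t : Y, Spl ρ ρY S f L (ρY u y0) (ρY v (ρY u y0)) t →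
          Spl ρ ρY S f (P :: L) y0 (ρY (v * u) y0) t := by
        rintro t ⟨L1, M, Z, L2, rfl, ⟨w1, hw1, rfl⟩, ⟨w2, hw2, h2⟩⟩
        refine ⟨P :: L1, M, Z, L2, rfl, ⟨w1 * u, ⟨u, w1, hu, hz, by rw [← hf]; exact hw1, rfl⟩,
          by simp⟩, ⟨w2, hw2, by simpa using h2⟩⟩
      rintro ⟨t, a⟩ ⟨h1, h2⟩
      exact ⟨key _ h1, key _ h2⟩

end basic

section ext
open Classical

variable {X : Type} (ρ : FreeGroup A →* Perm X) (S : Finset A)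

/-- The edge `(x, a)` as an indicator function. -/
noncomputable def dl {X : Type} (S : Finset A) (x : X) (a : A) : X × S → ZMod 2 :=
  fun e => if e.1 = x ∧ (e.2 : A) = a then 1 else 0

theorem zmod2_add_self {I : Type} (d : I → ZMod 2) : d + d = 0 := by
  funext i
  exact CharTwo.add_self_eq_zero (d i)

/-- Action of a letter on the mod 2 cover. -/
noncomputable def extPerm (a : A) : Perm (X × (X × S → ZMod 2)) where
  toFun p := (ρ (FreeGroup.of a) p.1, p.2 + dl S p.1 a)
  invFun p := ((ρ (FreeGroup.of a))⁻¹ p.1, p.2 + dl S ((ρ (FreeGroup.of a))⁻¹ p.1) a)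
  left_inv p := by
    ext1
    · simp
    · simp [add_assoc, zmod2_add_self]
  right_inv p := by
    ext1
    · simp
    · simp [add_assoc, zmod2_add_self]

/-- The mod 2 cover. -/
noncomputable def extRho : FreeGroup A →* Perm (X × (X × S → ZMod 2)) :=
  FreeGroup.lift (extPerm ρ S)

theorem extRho_fst (w : FreeGroup A) (p : X × (X × S → ZMod 2)) :
    (extRho ρ S w p).1 = ρ w p.1 := by
  induction w using FreeGroup.induction_on generalizing p with
  | C1 => simp
  | of a => simp [extRho, extPerm]
  | inv_of a _ => simp [extRho, extPerm, Perm.inv_def]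
  | mul u v hu hv => simp [hu, hv]

/-- The invariant attached to a potential. -/
noncomputable def pot [Fintype X] (f : X → ZMod 2) (p : X × (X × S → ZMod 2)) : ZMod 2 :=
  f p.1 + ∑ e, p.2 e * (f (ρ (FreeGroup.of (e.2 : A)) e.1) + f e.1)

theorem pot_step [Fintype X] (f : X → ZMod 2) (p : X × (X × S → ZMod 2)) {a : A} (ha : a ∈ S) :
    pot ρ S f (extPerm ρ S a p) = pot ρ S f p := by
  have h : ∑ e : X × S, dl S p.1 a e * (f (ρ (FreeGroup.of (e.2 : A)) e.1) + f e.1)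
      = f (ρ (FreeGroup.of a) p.1) + f p.1 := by
    rw [Finset.sum_eq_single (p.1, ⟨a, ha⟩)]
    · simp [dl]
    · rintro ⟨b, c, hc⟩ - hne
      have : ¬ (b = p.1 ∧ c = a) := by
        rintro ⟨rfl, rfl⟩
        exact hne rfl
      simp [dl, this]
    · simp
  simp only [pot, extPerm, Equiv.coe_fn_mk, Pi.add_apply, add_mul, Finset.sum_add_distrib, h]
  have h2 := CharTwo.add_self_eq_zero (f (ρ (FreeGroup.of a) p.1))
  linear_combination h2

theorem ext_path [Fintype X] {E : Set (X × A)} {p : X × (X × S → ZMod 2)} {w : FreeGroup A}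
    (h : RPath ρ S E p.1 w) :
    (∀ e : X × S, (e.1, (e.2 : A)) ∉ E → (extRho ρ S w p).2 e = p.2 e) ∧
      ∀ f, pot ρ S f (extRho ρ S w p) = pot ρ S f p := by
  have step : ∀ (a : A) (q : X × (X × S → ZMod 2)), (q.1, a) ∈ E →
      ∀ e : X × S, (e.1, (e.2 : A)) ∉ E → (extPerm ρ S a q).2 e = q.2 e := by
    intro a q hq e he
    have : ¬ (e.1 = q.1 ∧ (e.2 : A) = a) := by
      rintro ⟨h1, h2⟩
      rw [h1, h2] at he
      exact he hq
    simp [extPerm, dl, this]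
  induction h with
  | one => simp
  | @fwd w a _ ha he ih =>
    have h1 : extRho ρ S (FreeGroup.of a * w) p = extPerm ρ S a (extRho ρ S w p) := by
      simp [extRho]
    rw [h1]
    refine ⟨fun e hE => ?_, fun f => ?_⟩
    · rw [step a _ (by rwa [extRho_fst]) e hE, ih.1 e hE]
    · rw [pot_step ρ S f _ ha, ih.2]
  | @bwd w a _ ha he ih =>
    have h1 : extRho ρ S w p = extPerm ρ S a (extRho ρ S ((FreeGroup.of a)⁻¹ * w) p) := by
      simp [extRho]
    rw [h1] at ih
    refine ⟨fun e hE => ?_, fun f => ?_⟩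
    · rw [← ih.1 e hE, step a _ (by rwa [extRho_fst]) e hE]
    · rw [← ih.2 f, pot_step ρ S f _ ha]

/-- Two paths with the same end in the cover: their common part is connected. -/
theorem ext_inter [Finite X] {E D : Set (X × A)} {p : X × (X × S → ZMod 2)} {w w' : FreeGroup A}
    (h : RPath ρ S E p.1 w) (h' : RPath ρ S D p.1 w')
    (heq : extRho ρ S w p = extRho ρ S w' p) :
    ∃ w'', RPath ρ S (E ∩ D) p.1 w'' ∧ ρ w'' p.1 = ρ w p.1 := by
  have := Fintype.ofFinite X
  let f : X → ZMod 2 := fun y => if ∃ v, RPath ρ S (E ∩ D) p.1 v ∧ ρ v p.1 = y then 1 else 0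
  have hf1 : f p.1 = 1 := if_pos ⟨1, .one, by simp⟩
  have hfe : ∀ e : X × S, (e.1, (e.2 : A)) ∈ E ∩ D →
      f (ρ (FreeGroup.of (e.2 : A)) e.1) = f e.1 := by
    rintro ⟨y, a, ha⟩ he
    have : (∃ v, RPath ρ S (E ∩ D) p.1 v ∧ ρ v p.1 = ρ (FreeGroup.of a) y) ↔
        (∃ v, RPath ρ S (E ∩ D) p.1 v ∧ ρ v p.1 = y) := by
      constructor
      · rintro ⟨v, hv, hvy⟩
        exact ⟨(FreeGroup.of a)⁻¹ * v, .bwd hv ha (by simpa [hvy] using he), by simp [hvy]⟩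
      · rintro ⟨v, hv, rfl⟩
        exact ⟨FreeGroup.of a * v, .fwd hv ha he, by simp⟩
    simp only [f, this]
  obtain ⟨h1, h2⟩ := ext_path ρ S h
  obtain ⟨h3, -⟩ := ext_path ρ S h'
  have h4 := h2 f
  have h5 : ∑ e, (extRho ρ S w p).2 e * (f (ρ (FreeGroup.of (e.2 : A)) e.1) + f e.1)
      = ∑ e, p.2 e * (f (ρ (FreeGroup.of (e.2 : A)) e.1) + f e.1) := by
    refine Finset.sum_congr rfl fun e _ => ?_
    by_cases he : (e.1, (e.2 : A)) ∈ E ∩ D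
    · rw [hfe e he, CharTwo.add_self_eq_zero]
      simp
    · by_cases hE : (e.1, (e.2 : A)) ∈ E
      · rw [heq, h3 e fun hD => he ⟨hE, hD⟩]
      · rw [h1 e hE]
  simp only [pot, h5, add_left_inj, extRho_fst, hf1] at h4
  by_contra hcon
  have : f (ρ w p.1) = 0 := if_neg hcon
  rw [this] at h4
  exact absurd h4 (by decide)

end ext
/-- `f : Y → X` lifts cycles with at most `m + 1` sides to honest identities. -/
def GoodCover {X Y : Type} (ρ : FreeGroup A →* Perm X) (ρY : FreeGroup A →* Perm Y) (S : Finset A)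
    (f : Y → X) (m : ℕ) : Prop :=
  ∀ (L : List (Set (X × A) × Set X)) (D : Set (X × A)) (y : Y) (w w' : FreeGroup A),
    L.length ≤ m → RChain ρ S L (f y) w → RPath ρ S D (f y) w' → ρY w y = ρY w' y →
    ∃ w'', RChain ρ S L (f y) w'' ∧ RPath ρ S D (f y) w'' ∧ ρ w'' (f y) = ρ w (f y)

theorem exists_goodCover (S : Finset A) (m : ℕ) {X : Type} [Finite X]
    (ρ : FreeGroup A →* Perm X) :
    ∃ (Y : Type) (_ : Finite Y) (ρY : FreeGroup A →* Perm Y) (f : Y → X),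
      Function.Surjective f ∧ (∀ w y, f (ρY w y) = ρ w (f y)) ∧ GoodCover ρ ρY S f m := by
  induction m with
  | zero =>
    refine ⟨X, inferInstance, ρ, id, Function.surjective_id, fun _ _ => rfl, ?_⟩
    intro L D y w w' hL hc hp heq
    obtain rfl : L = [] := List.length_eq_zero_iff.1 (by omega)
    cases hc
    exact ⟨1, rfl, .one, rfl⟩
  | succ m ih =>
    obtain ⟨Y, hY, ρY, f, hfs, hf, hgood⟩ := ih
    refine ⟨Y × (Y × S → ZMod 2), inferInstance, extRho ρY S, fun p => f p.1,
      hfs.comp Prod.fst_surjective, fun w p => by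
        show f (extRho ρY S w p).1 = ρ w (f p.1)
        rw [extRho_fst, hf], ?_⟩
    intro L D p w w' hL hc hp heq
    rcases L with _ | ⟨⟨E, Z⟩, L⟩
    · cases hc
      exact ⟨1, rfl, .one, rfl⟩
    obtain ⟨u, v, hu, hz, hv, rfl⟩ := hc
    have hlen : L.length ≤ m := by simpa using hL
    rw [← hf] at hv
    by_cases hL0 : L = []
    · subst hL0
      cases hv
      rw [one_mul] at heq
      obtain ⟨w'', h1, h2⟩ := ext_inter ρY S (hu.pull hf) (hp.pull hf) heq
      refine ⟨w'', ⟨w'', 1, (h1.mono Set.inter_subset_left).push hf, ?_, rfl, by simp⟩,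
        (h1.mono Set.inter_subset_right).push hf, ?_⟩
      · rw [← hf, h2, hf]; exact hz
      · rw [← hf, h2, hf, one_mul]
    have hm : 1 ≤ m := le_trans (List.length_pos_iff.2 hL0) hlen
    set y0 := p.1 with hy0
    set y1 := ρY (v * u) y0 with hy1
    have hy1' : ρY v (ρY u y0) = y1 := by simp [hy1]
    let R : Y → Prop := fun t => ∃ r, RPath ρY S {e | (f e.1, e.2) ∈ E} y0 r ∧ ρY r y0 = t
    let T : Y → Prop := fun t => Spl ρ ρY S f L (ρY u y0) y1 t
    have hB : RPath ρY S {e | (R e.1 ∧ R (ρY (FreeGroup.of e.2) e.1)) ∨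
        (T e.1 ∧ T (ρY (FreeGroup.of e.2) e.1))} y0 (v * u) := by
      refine RPath.trans (RPath.mono ?_ (hu.pull hf).reach) (RPath.mono ?_ (hv.path_spl hf))
      · exact fun e he => Or.inl he
      · intro e he
        rw [hy1'] at he
        exact Or.inr he
    obtain ⟨q, hq, hqe⟩ := ext_inter ρY S hB (hp.pull hf) heq
    replace hqe : ρY q y0 = y1 := hqe
    -- the branching vertex
    have hs : ∃ s d, RPath ρY S {e | (f e.1, e.2) ∈ D} y0 d ∧ ρY d y0 = s ∧ R s ∧ T s := by
      have key : ∀ r, RPath ρY S ({e | (R e.1 ∧ R (ρY (FreeGroup.of e.2) e.1)) ∨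
          (T e.1 ∧ T (ρY (FreeGroup.of e.2) e.1))} ∩ {e | (f e.1, e.2) ∈ D}) y0 r →
          (∃ s d, RPath ρY S {e | (f e.1, e.2) ∈ D} y0 d ∧ ρY d y0 = s ∧ R s ∧ T s) ∨
            R (ρY r y0) := by
        intro r hr
        induction hr with
        | one => exact Or.inr ⟨1, .one, rfl⟩
        | @fwd r a hr ha he ih =>
          rcases ih with ih | ih
          · exact Or.inl ih
          rcases he.1 with he' | he'
          · exact Or.inr (by simpa using he'.2)
          · exact Or.inl ⟨_, r, hr.mono Set.inter_subset_right, rfl, ih, he'.1⟩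
        | @bwd r a hr ha he ih =>
          rcases ih with ih | ih
          · exact Or.inl ih
          rcases he.1 with he' | he'
          · exact Or.inr he'.1
          · exact Or.inl ⟨_, r, hr.mono Set.inter_subset_right, rfl, ih, by simpa using he'.2⟩
      rcases key q hq with h | h
      · exact h
      · refine ⟨y1, q, hq.mono Set.inter_subset_right, hqe, ?_, ?_⟩
        · rw [← hqe]; exact h
        · obtain ⟨L1, M, Z', L2, hLe, h1, h2⟩ := hv.split_end hL0
          refine ⟨L1, M, Z', L2, hLe, ⟨v, h1, hy1'⟩, 1, ?_, by simp⟩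
          rw [← hf, hy1'] at h2
          exact h2
    obtain ⟨s, d, hd, hds, ⟨r, hr, hrs⟩, L1, M, Z', L2, hLe, ⟨w1, hw1, hw1s⟩, ⟨w2, hw2, hw2s⟩⟩ := hs
    have hd := hd.push hf
    have hr := hr.push hf
    have hlen' : L1.length + 1 + L2.length ≤ m := by
      rw [hLe] at hlen
      simp at hlen
      omega
    have hDs : RPath ρ S D (f s) (q * d⁻¹) := by
      rw [← hds, hf]
      refine hd.symm.trans ?_
      simpa using (hq.mono Set.inter_subset_right).push hf
    have hEs : RPath ρ S E (f (ρY u y0)) (r * u⁻¹) := by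
      rw [hf]
      exact hu.symm.trans (by simpa using hr)
    -- bigon
    obtain ⟨a, ha1, ha2, ha3⟩ := hgood [(E, Set.univ)] D y0 r d (by simpa using hm)
      (RChain.single hr) hd (hrs.trans hds.symm)
    -- first polygon
    obtain ⟨b, hb1, hb2, hb3⟩ := hgood (L1 ++ [(M, Set.univ)]) E (ρY u y0) w1 (r * u⁻¹)
      (by simp; omega) hw1 hEs (by rw [hw1s]; simp [hrs])
    -- second polygon
    obtain ⟨c, hc1, hc2, hc3⟩ := hgood ((M, Z') :: L2) D s w2 (q * d⁻¹)
      (by simp; omega) hw2 hDs (by rw [hw2s]; simp [← hds, hqe])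
    have ha1 := RChain.of_single ha1
    have ha3' : ρ a (f y0) = f s := by rw [ha3, ← hf, hrs]
    have hb3' : ρ b (f (ρY u y0)) = f s := by rw [hb3, ← hf, hw1s]
    have hc3' : ρ c (f s) = f y1 := by rw [hc3, ← hf, hw2s]
    have hba : ρ (b⁻¹ * a) (f y0) = f (ρY u y0) := by
      rw [map_mul, Perm.mul_apply, ha3', ← hb3']
      simp
    refine ⟨c * a, ⟨b⁻¹ * a, c * b, ?_, ?_, ?_, by group⟩, ?_, ?_⟩
    · refine ha1.trans ?_
      rw [ha3', ← hb3']
      exact hb2.symm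
    · show ρ (b⁻¹ * a) (f y0) ∈ Z
      rw [hba, hf]; exact hz
    · show RChain ρ S L (ρ (b⁻¹ * a) (f y0)) (c * b)
      rw [hba, hLe]
      exact hb1.merge (by rw [hb3']; exact hc1)
    · refine ha2.trans ?_
      rw [ha3']
      exact hc2
    · show ρ (c * a) (f y0) = ρ (v * u) (f y0)
      rw [map_mul, Perm.mul_apply, ha3', hc3', hy1, hf]

/-- `L` is recognized by the finite quotient `φ`. -/
def Rec {G : Type} [Group G] (S : Finset A) (φ : FreeGroup A →* G) (K : Set (FreeGroup A)) : Prop :=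
  ∃ E : Set (G × A), (∀ w ∈ K, RPath ((MulAction.toPermHom G G).comp φ) S E 1 w) ∧
    ∀ w ∈ K, ∀ w', RPath ((MulAction.toPermHom G G).comp φ) S E 1 w' → φ w' = φ w → w' ∈ K

theorem Rec.lift {G G' : Type} [Group G] [Group G'] {S : Finset A} {φ : FreeGroup A →* G}
    {φ' : FreeGroup A →* G'} (j : G' →* G) (hj : ∀ w, j (φ' w) = φ w) {K : Set (FreeGroup A)}
    (h : Rec S φ K) : Rec S φ' K := by
  obtain ⟨E, h1, h2⟩ := h
  have hf : ∀ w y, j (((MulAction.toPermHom G' G').comp φ') w y) =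
      ((MulAction.toPermHom G G).comp φ) w (j y) := by
    intro w y
    simp [hj]
  refine ⟨{e | (j e.1, e.2) ∈ E}, fun w hw => ?_, fun w hw w' hw' he => h2 w hw w' ?_ ?_⟩
  · exact RPath.pull hf (by simpa using h1 w hw)
  · simpa using RPath.push hf hw'
  · rw [← hj, he, hj]

/-- Sets recognized by finite quotients, for all large enough finite alphabets. -/
def Adm (K : Set (FreeGroup A)) : Prop :=
  ∃ S0 : Finset A, ∀ S, S0 ⊆ S → ∃ (G : Type) (_ : Group G) (_ : Finite G)
    (φ : FreeGroup A →* G), Rec S φ K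

theorem adm_list (Ks : List (Set (FreeGroup A))) (h : ∀ K ∈ Ks, Adm K) :
    ∃ S0 : Finset A, ∀ S, S0 ⊆ S → ∃ (G : Type) (_ : Group G) (_ : Finite G)
    (φ : FreeGroup A →* G), ∀ K ∈ Ks, Rec S φ K := by
  classical
  induction Ks with
  | nil => exact ⟨∅, fun S _ => ⟨Unit, inferInstance, inferInstance, 1, by simp⟩⟩
  | cons K Ks ih =>
    obtain ⟨S1, h1⟩ := h K (by simp)
    obtain ⟨S2, h2⟩ := ih fun K hK => h K (by simp [hK])
    refine ⟨S1 ∪ S2, fun S hS => ?_⟩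
    obtain ⟨G1, _, _, φ1, hr1⟩ := h1 S (Finset.union_subset_left hS)
    obtain ⟨G2, _, _, φ2, hr2⟩ := h2 S (Finset.union_subset_right hS)
    refine ⟨G1 × G2, inferInstance, inferInstance, φ1.prod φ2, ?_⟩
    intro K' hK'
    rcases List.mem_cons.1 hK' with rfl | hK'
    · exact hr1.lift (MonoidHom.fst G1 G2) fun w => rfl
    · exact (hr2 K' hK').lift (MonoidHom.snd G1 G2) fun w => rfl

/-- Stallings graph. -/
theorem stallings (H : Subgroup (FreeGroup A)) (T : Finset (FreeGroup A)) :
    ∃ S0 : Finset A, ∀ S, S0 ⊆ S → ∃ (Y : Type) (_ : Finite Y) (ρ : FreeGroup A →* Perm Y)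
      (E : Set (Y × A)) (p : Y), (∀ t ∈ T, RPath ρ S E p t) ∧
      ∀ w w', RPath ρ S E p w → RPath ρ S E p w' → (ρ w p = ρ w' p ↔ w⁻¹ * w' ∈ H) := by
  classical
  let V : Set (FreeGroup A ⧸ H) :=
    {q | q = ((1 : FreeGroup A) : FreeGroup A ⧸ H) ∨
      ∃ t ∈ T, ∃ l ∈ t.toWord.tails, q = (FreeGroup.mk l : FreeGroup A ⧸ H)}
  have hV : V.Finite := by
    have : V ⊆ {((1 : FreeGroup A) : FreeGroup A ⧸ H)} ∪ ⋃ t ∈ T,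
        (fun l => (FreeGroup.mk l : FreeGroup A ⧸ H)) '' {l | l ∈ t.toWord.tails} := by
      rintro q (rfl | ⟨t, ht, l, hl, rfl⟩)
      · exact Or.inl rfl
      · refine Or.inr (Set.mem_biUnion ht ⟨l, hl, rfl⟩)
    refine Set.Finite.subset (Set.Finite.union (Set.finite_singleton _)
      (Set.Finite.biUnion T.finite_toSet fun t _ => Set.Finite.image _ ?_)) this
    exact List.finite_toSet _
  have : Finite V := hV
  refine ⟨T.biUnion fun t => (t.toWord.map Prod.fst).toFinset, fun S hS => ?_⟩
  have hperm : ∀ a : A, ∃ σ : Perm V, ∀ v : V, ∀ h : FreeGroup.of a • (v : FreeGroup A ⧸ H) ∈ V,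
      σ v = ⟨_, h⟩ := by
    intro a
    obtain ⟨σ, hσ⟩ := Perm.exists_extending_pair
      (fun v : {v : V // FreeGroup.of a • (v : FreeGroup A ⧸ H) ∈ V} => (v : V))
      (fun v => (⟨_, v.2⟩ : V)) Subtype.val_injective (by
        intro v v' h
        simpa [Subtype.ext_iff] using h)
    exact ⟨σ, fun v h => hσ ⟨v, h⟩⟩
  choose σ hσ using hperm
  let ρ : FreeGroup A →* Perm V := FreeGroup.lift σ
  let E : Set (V × A) := {e | FreeGroup.of e.2 • (e.1 : FreeGroup A ⧸ H) ∈ V}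
  let p : V := ⟨_, Or.inl rfl⟩
  have hE : ∀ (v : V) (a : A), (v, a) ∈ E →
      ((ρ (FreeGroup.of a) v : V) : FreeGroup A ⧸ H) = FreeGroup.of a • (v : FreeGroup A ⧸ H) := by
    intro v a h
    have := hσ a v h
    simp [ρ, this]
  have hpath : ∀ w, RPath ρ S E p w → ((ρ w p : V) : FreeGroup A ⧸ H) = (w : FreeGroup A ⧸ H) := by
    intro w hw
    induction hw with
    | one => simp [p]
    | @fwd w a _ ha he ih =>
      rw [map_mul, Perm.mul_apply, hE _ _ he, ih]
      rfl
    | @bwd w a _ ha he ih =>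
      have := hE _ _ he
      rw [← Perm.mul_apply, ← map_mul, mul_inv_cancel_left, ih] at this
      rw [← inv_smul_eq_iff] at this
      rw [← this]
      rfl
  refine ⟨V, inferInstance, ρ, E, p, ?_, ?_⟩
  · intro t ht
    have key : ∀ l : List (A × Bool), l <:+ t.toWord → RPath ρ S E p (FreeGroup.mk l) := by
      intro l
      induction l with
      | nil => intro _; exact .one
      | cons c l ih =>
        intro hl
        have hl' : l <:+ t.toWord := (List.suffix_cons c l).trans hl
        have ih := ih hl'
        obtain ⟨a, b⟩ := c
        have ha : a ∈ S := by
          apply hS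
          refine Finset.mem_biUnion.2 ⟨t, ht, ?_⟩
          rw [List.mem_toFinset]
          exact List.mem_map.2 ⟨(a, b), hl.subset (by simp), rfl⟩
        have hin : ∀ l, l <:+ t.toWord → (FreeGroup.mk l : FreeGroup A ⧸ H) ∈ V :=
          fun l hl => Or.inr ⟨t, ht, l, (List.mem_tails _ _).2 hl, rfl⟩
        cases b
        · have e1 : FreeGroup.mk ((a, false) :: l) = (FreeGroup.of a)⁻¹ * FreeGroup.mk l := by
            simp [FreeGroup.of, FreeGroup.invRev]
          rw [e1]
          have hv := hin _ hl
          have e3 : (⟨_, hv⟩ : V) = ρ ((FreeGroup.of a)⁻¹ * FreeGroup.mk l) p := by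
            have h2 : ((⟨_, hv⟩ : V), a) ∈ E := by
              show FreeGroup.of a • (FreeGroup.mk ((a, false) :: l) : FreeGroup A ⧸ H) ∈ V
              have := hin _ hl'
              rw [e1]
              show ((FreeGroup.of a * ((FreeGroup.of a)⁻¹ * FreeGroup.mk l) : FreeGroup A) :
                FreeGroup A ⧸ H) ∈ V
              simpa using this
            have h3 := hE _ _ h2
            have h4 : ρ (FreeGroup.of a) (⟨_, hv⟩ : V) = ρ (FreeGroup.mk l) p := by
              apply Subtype.ext
              rw [h3, hpath _ ih]
              show FreeGroup.of a • (FreeGroup.mk ((a, false) :: l) : FreeGroup A ⧸ H) = _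
              rw [e1]
              show ((FreeGroup.of a * ((FreeGroup.of a)⁻¹ * FreeGroup.mk l) : FreeGroup A) :
                FreeGroup A ⧸ H) = _
              simp
            rw [map_mul, Perm.mul_apply, ← h4]
            simp
          refine .bwd ih ha ?_
          rw [← e3]
          show FreeGroup.of a • (FreeGroup.mk ((a, false) :: l) : FreeGroup A ⧸ H) ∈ V
          have := hin _ hl'
          rw [e1]
          show ((FreeGroup.of a * ((FreeGroup.of a)⁻¹ * FreeGroup.mk l) : FreeGroup A) :
            FreeGroup A ⧸ H) ∈ V
          simpa using this
        · have e1 : FreeGroup.mk ((a, true) :: l) = FreeGroup.of a * FreeGroup.mk l := by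
            simp [FreeGroup.of]
          have hv := hin _ hl
          rw [e1] at hv ⊢
          refine .fwd ih ha ?_
          show FreeGroup.of a • ((ρ (FreeGroup.mk l) p : V) : FreeGroup A ⧸ H) ∈ V
          rw [hpath _ ih]
          exact hv
    simpa [FreeGroup.mk_toWord] using key t.toWord List.suffix_rfl
  · intro w w' hw hw'
    rw [← QuotientGroup.eq, ← hpath w hw, ← hpath w' hw', Subtype.ext_iff]

theorem eval_equivariant {Y : Type} (ρ : FreeGroup A →* Perm Y) (p : Y) (w : FreeGroup A)
    (k : Perm Y) : (((MulAction.toPermHom (Perm Y) (Perm Y)).comp ρ) w k) p = ρ w (k p) := by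
  simp

theorem adm_singleton (g : FreeGroup A) : Adm ({g} : Set (FreeGroup A)) := by
  obtain ⟨S0, h⟩ := stallings (⊥ : Subgroup (FreeGroup A)) {g}
  refine ⟨S0, fun S hS => ?_⟩
  obtain ⟨Y, _, ρ, E, p, h1, h2⟩ := h S hS
  have h1 := h1 g (by simp)
  refine ⟨Perm Y, inferInstance, inferInstance, ρ, {e | (e.1 p, e.2) ∈ E}, ?_, ?_⟩
  · rintro w rfl
    exact RPath.pull (f := fun k : Perm Y => k p) (eval_equivariant ρ p) h1
  · rintro w rfl w' hw' he
    have hw' := RPath.push (f := fun k : Perm Y => k p) (eval_equivariant ρ p) hw'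
    have := (h2 w w' h1 hw').1 (by rw [he])
    rw [Subgroup.mem_bot, inv_mul_eq_one] at this
    exact this.symm

theorem adm_fg (H : Subgroup (FreeGroup A)) (hH : H.FG) : Adm (H : Set (FreeGroup A)) := by
  obtain ⟨T, rfl⟩ := hH
  obtain ⟨S0, h⟩ := stallings (Subgroup.closure (T : Set (FreeGroup A))) T
  refine ⟨S0, fun S hS => ?_⟩
  obtain ⟨Y, _, ρ, E, p, h1, h2⟩ := h S hS
  have h3 : ∀ w ∈ Subgroup.closure (T : Set (FreeGroup A)), RPath ρ S E p w ∧ ρ w p = p := by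
    intro w hw
    induction hw using Subgroup.closure_induction with
    | mem x hx =>
      refine ⟨h1 x hx, ?_⟩
      have := (h2 1 x .one (h1 x hx)).2 (by simpa using Subgroup.subset_closure hx)
      simpa using this.symm
    | one => exact ⟨.one, by simp⟩
    | mul x y _ _ hx hy =>
      refine ⟨hy.1.trans (by rw [hy.2]; exact hx.1), by simp [hx.2, hy.2]⟩
    | inv x _ hx =>
      refine ⟨by simpa [hx.2] using hx.1.symm, ?_⟩
      rw [map_inv, Perm.inv_eq_iff_eq, hx.2]
  refine ⟨Perm Y, inferInstance, inferInstance, ρ, {e | (e.1 p, e.2) ∈ E}, ?_, ?_⟩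
  · intro w hw
    exact RPath.pull (f := fun k : Perm Y => k p) (eval_equivariant ρ p) (h3 w hw).1
  · intro w hw w' hw' he
    have hw' := RPath.push (f := fun k : Perm Y => k p) (eval_equivariant ρ p) hw'
    have := (h2 1 w' .one hw').1 (by
      show ρ 1 p = ρ w' p
      rw [he, (h3 w hw).2]; simp)
    simpa using this

/-- Reversed products. -/
def ProdIn : List (Set (FreeGroup A)) → FreeGroup A → Prop
  | [], w => w = 1
  | K :: Ks, w => ∃ u v, u ∈ K ∧ ProdIn Ks v ∧ w = v * u

theorem prodIn_chain {G : Type} [Group G] {S : Finset A} {φ : FreeGroup A →* G}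
    (Ks : List (Set (FreeGroup A))) (hK : ∀ K ∈ Ks, Rec S φ K) (w : FreeGroup A)
    (hw : ProdIn Ks w) (k : G) :
    ∃ L : List (Set (G × A) × Set G), L.length = Ks.length ∧
      RChain ((MulAction.toPermHom G G).comp φ) S L k w ∧
      ∀ w', RChain ((MulAction.toPermHom G G).comp φ) S L k w' → ProdIn Ks w' := by
  induction Ks generalizing w k with
  | nil => exact ⟨[], rfl, hw, fun w' h => h⟩
  | cons K Ks ih =>
    obtain ⟨u, v, hu, hv, rfl⟩ := hw
    obtain ⟨E, h1, h2⟩ := hK K (by simp)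
    obtain ⟨L, hL1, hL2, hL3⟩ := ih (fun K hK' => hK K (by simp [hK'])) v hv (φ u * k)
    have hf : ∀ (w : FreeGroup A) (y : G), ((MulAction.toPermHom G G).comp φ) w y * k⁻¹ =
        ((MulAction.toPermHom G G).comp φ) w (y * k⁻¹) := by
      intro w y
      simp [mul_assoc]
    refine ⟨({e | (e.1 * k⁻¹, e.2) ∈ E}, {φ u * k}) :: L, by simp [hL1],
      ⟨u, v, ?_, ?_, ?_, rfl⟩, ?_⟩
    · exact RPath.pull (f := fun y : G => y * k⁻¹) hf (by simpa using h1 u hu)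
    · simp
    · simpa using hL2
    · rintro w' ⟨u', v', hu', hz, hv', rfl⟩
      have hz : φ u' * k = φ u * k := by simpa using hz
      have hz' : φ u' = φ u := mul_right_cancel hz
      refine ⟨u', v', h2 u hu u' ?_ hz', hL3 v' ?_, rfl⟩
      · have := RPath.push (f := fun y : G => y * k⁻¹) hf hu'
        simpa using this
      · rw [← hz]
        simpa using hv'

theorem main_list (Ks : List (Set (FreeGroup A))) (hK : ∀ K ∈ Ks, Adm K) (g : FreeGroup A)
    (hg : ¬ ProdIn Ks g) :
    ∃ N : Subgroup (FreeGroup A), N.Normal ∧ N.FiniteIndex ∧ ∀ x ∈ N, ¬ ProdIn Ks (x * g) := by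
  obtain ⟨S, hS⟩ := adm_list ({g} :: Ks) (by
    intro K h
    rcases List.mem_cons.1 h with rfl | h
    · exact adm_singleton g
    · exact hK K h)
  obtain ⟨G, _, _, φ, hφ⟩ := hS S subset_rfl
  obtain ⟨Y, _, ρY, f, hfs, hf, hgood⟩ :=
    exists_goodCover S Ks.length ((MulAction.toPermHom G G).comp φ)
  refine ⟨ρY.ker, inferInstance, inferInstance, fun x hx hprod => hg ?_⟩
  obtain ⟨y, hy⟩ := hfs 1
  obtain ⟨L, hL1, hL2, hL3⟩ := prodIn_chain Ks (fun K h => hφ K (by simp [h])) _ hprod 1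
  obtain ⟨E, hE1, hE2⟩ := hφ {g} (by simp)
  rw [← hy] at hL2 hL3 hE1 hE2
  have hxg : ρY (x * g) = ρY g := by
    rw [map_mul, MonoidHom.mem_ker.1 hx, one_mul]
  obtain ⟨w, h1, h2, h3⟩ := hgood L E y (x * g) g hL1.le hL2 (hE1 g rfl) (by rw [hxg])
  have h4 : φ w = φ g := by
    rw [← hf (x * g), hxg, hf, hy] at h3
    simpa using h3
  have : w = g := hE2 g rfl w h2 h4
  rw [← this]
  exact hL3 w h1

theorem prodIn_ofFn {n : ℕ} (H : Fin n → Subgroup (FreeGroup A)) (x : FreeGroup A) :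
    (∃ h : Fin n → FreeGroup A, (∀ i, h i ∈ H i) ∧ x = (List.ofFn h).prod) ↔
      ProdIn (List.ofFn fun i => (H i : Set (FreeGroup A))) x⁻¹ := by
  induction n generalizing x with
  | zero => simp [ProdIn]
  | succ n ih =>
    rw [List.ofFn_succ]
    constructor
    · rintro ⟨h, hh, rfl⟩
      refine ⟨(h 0)⁻¹, ((List.ofFn fun i => h (Fin.succ i)).prod)⁻¹, inv_mem (hh 0), ?_, ?_⟩
      · exact (ih (fun i => H i.succ) _).1 ⟨fun i => h i.succ, fun i => hh _, rfl⟩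
      · simp [List.ofFn_succ]
    · rintro ⟨u, v, hu, hv, hx⟩
      rw [← inv_inv v] at hv
      obtain ⟨h, hh, hvh⟩ := (ih (fun i => H i.succ) _).2 hv
      refine ⟨Fin.cons u⁻¹ h, ?_, ?_⟩
      · intro i
        refine Fin.cases ?_ (fun i => ?_) i
        · exact inv_mem (show u ∈ H 0 from hu)
        · exact hh i
      · rw [List.ofFn_succ]
        simp only [Fin.cons_zero, Fin.cons_succ, List.prod_cons]
        rw [← hvh, ← inv_inv x, hx, mul_inv_rev]

end RZ


/-- **Ribes–Zalesskiĭ theorem.** Let `F` be a free group and `H₁, …, Hₙ` finitely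
generated subgroups of `F`. The product set `H₁H₂⋯Hₙ` is closed in the profinite
topology of `F`: every `g ∉ H₁H₂⋯Hₙ` is separated from it by a coset of a
finite-index normal subgroup. -/
theorem ribes_zalesskii {A : Type} (n : ℕ) (H : Fin n → Subgroup (FreeGroup A))
    (hfg : ∀ i, (H i).FG)
    (g : FreeGroup A)
    (hg : g ∉ {x : FreeGroup A |
      ∃ h : Fin n → FreeGroup A, (∀ i, h i ∈ H i) ∧ x = (List.ofFn h).prod}) :
    ∃ N : Subgroup (FreeGroup A), N.Normal ∧ N.FiniteIndex ∧
      ∀ x ∈ N, g * x ∉ {x : FreeGroup A |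
        ∃ h : Fin n → FreeGroup A, (∀ i, h i ∈ H i) ∧ x = (List.ofFn h).prod} := by
  obtain ⟨N, hN, hfin, h⟩ := RZ.main_list (List.ofFn fun i => (H i : Set (FreeGroup A)))
    (by
      intro K hK
      obtain ⟨i, rfl⟩ := (List.mem_ofFn' _ _).1 hK
      exact RZ.adm_fg (H i) (hfg i)) g⁻¹
    (fun hc => hg ((RZ.prodIn_ofFn H g).2 hc))
  refine ⟨N, hN, hfin, fun x hx hc => h x⁻¹ (inv_mem hx) ?_⟩
  have := (RZ.prodIn_ofFn H (g * x)).1 hc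
  rwa [mul_inv_rev] at this
end

section
/- Let p be a prime, F a free group, and H₁, …, Hₙ finitely generated subgroups of F each of which is closed in the pro-p topology of F. Then the product set H₁H₂⋯Hₙ = {h₁h₂⋯hₙ : hᵢ ∈ Hᵢ} is closed in the pro-p topology of F; explicitly, for every g ∉ H₁H₂⋯Hₙ there exists a normal subgroup N of F with F/N a finite p-group such that gN is disjoint from H₁H₂⋯Hₙ. (Ribes–Zalesskiĭ, pro-p version.) -/
/-- A subset `X` of `G` is closed in the pro-`p` topology of `G` if every `g ∉ X`
is separated from `X` by a coset of a normal subgroup `N` with `G/N` a finite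
`p`-group. -/
def ProPClosed {G : Type} [Group G] (p : ℕ) (X : Set G) : Prop :=
  ∀ g ∉ X, ∃ N : Subgroup G, ∃ _ : N.Normal, Finite (G ⧸ N) ∧ IsPGroup p (G ⧸ N) ∧
    ∀ x ∈ N, g * x ∉ X

namespace RZ

open FreeGroup (mk of invRev invRev_cons inv_mk mul_mk)

variable {A : Type} {G : Type} [Group G] (ρ : FreeGroup A →* G)

/-- The edge of the Cayley graph traversed by reading the letter `a` at `q`. -/
def ed (q : G) (a : A × Bool) : G × A :=
  if a.2 then (q, a.1) else (q * ρ (mk [a]), a.1)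

/-- The sign of a letter. -/
def sgn (p : ℕ) (a : A × Bool) : ZMod p := if a.2 then 1 else -1

/-- The edges traversed by reading a word from `q`. -/
def supp : G → List (A × Bool) → Set (G × A)
  | _, [] => ∅
  | q, a :: L => {ed ρ q a} ∪ supp (q * ρ (mk [a])) L

/-- The vertices visited by reading a word from `q`. -/
def verts (q : G) (L : List (A × Bool)) : Set G :=
  {v | ∃ L₁ L₂, L = L₁ ++ L₂ ∧ v = q * ρ (mk L₁)}

/-- The mod `p` chain of a word read from `q`. -/
noncomputable def chain (p : ℕ) : G → List (A × Bool) → (G × A →₀ ZMod p)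
  | _, [] => 0
  | q, a :: L => Finsupp.single (ed ρ q a) (sgn p a) + chain p (q * ρ (mk [a])) L

lemma mk_cons (a : A × Bool) (L : List (A × Bool)) : mk (a :: L) = mk [a] * mk L := by
  rw [mul_mk]; rfl

lemma mk_app (L M : List (A × Bool)) : mk (L ++ M) = mk L * mk M := by
  rw [mul_mk]

lemma mk_nil : mk ([] : List (A × Bool)) = 1 := rfl

lemma mk_flip (a : A × Bool) : mk [(a.1, !a.2)] = (mk [a])⁻¹ := by
  rw [inv_mk]; rfl

lemma mk_true (x : A) : mk [(x, true)] = of x := rfl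

lemma mk_false (x : A) : mk [(x, false)] = (of x)⁻¹ := rfl

lemma supp_app (q : G) (L M : List (A × Bool)) :
    supp ρ q (L ++ M) = supp ρ q L ∪ supp ρ (q * ρ (mk L)) M := by
  induction L generalizing q with
  | nil => simp [supp, mk_nil]
  | cons a L ih =>
    simp only [List.cons_append, supp, ih, mk_cons a L, map_mul, Set.union_assoc, mul_assoc]

lemma chain_app (p : ℕ) (q : G) (L M : List (A × Bool)) :
    chain ρ p q (L ++ M) = chain ρ p q L + chain ρ p (q * ρ (mk L)) M := by
  induction L generalizing q with
  | nil => simp [chain, mk_nil]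
  | cons a L ih =>
    simp only [List.cons_append, chain, ih, mk_cons a L, map_mul, add_assoc, mul_assoc]

lemma mem_supp_iff (q : G) (L : List (A × Bool)) (e : G × A) :
    e ∈ supp ρ q L ↔ ∃ L₁ c L₂, L = L₁ ++ c :: L₂ ∧ e = ed ρ (q * ρ (mk L₁)) c := by
  constructor
  · induction L generalizing q with
    | nil => simp [supp]
    | cons a L ih =>
      rintro (h | h)
      · exact ⟨[], a, L, rfl, by simpa [mk_nil] using h⟩
      · obtain ⟨L₁, c, L₂, rfl, h'⟩ := ih _ h
        exact ⟨a :: L₁, c, L₂, rfl, by rw [h', mk_cons a L₁, map_mul, mul_assoc]⟩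
  · rintro ⟨L₁, c, L₂, rfl, rfl⟩
    rw [supp_app]
    right; left; rfl

lemma ed_translate (g q : G) (a : A × Bool) : ed ρ (g * q) a = (g * (ed ρ q a).1, (ed ρ q a).2) := by
  unfold ed; split_ifs <;> simp [mul_assoc]

lemma supp_translate (g q : G) (L : List (A × Bool)) (e : G × A) :
    e ∈ supp ρ q L ↔ (g * e.1, e.2) ∈ supp ρ (g * q) L := by
  simp only [mem_supp_iff, mul_assoc, ed_translate]
  refine exists_congr fun L₁ => exists_congr fun c => exists_congr fun L₂ => and_congr_right fun _ => ?_
  rw [Prod.ext_iff, Prod.ext_iff]; simp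

lemma supp_mono_translate (g q : G) (L M : List (A × Bool)) (h : supp ρ q L ⊆ supp ρ q M) :
    supp ρ (g * q) L ⊆ supp ρ (g * q) M := by
  intro e he
  rw [supp_translate ρ g⁻¹] at he ⊢
  rw [inv_mul_cancel_left] at *
  exact h he

lemma chain_support (p : ℕ) (q : G) (L : List (A × Bool)) (e : G × A)
    (h : chain ρ p q L e ≠ 0) : e ∈ supp ρ q L := by
  classical
  induction L generalizing q with
  | nil => simp [chain] at h
  | cons a L ih =>
    by_cases h1 : e = ed ρ q a
    · left; exact h1
    · right
      apply ih
      simpa [chain, Finsupp.single_apply, Ne.symm h1] using h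

lemma ed_eq (q q' : G) (c a : A × Bool) (h : ed ρ q c = ed ρ q' a) :
    (q = q' ∧ c = a) ∨ (q * ρ (mk [c]) = q' ∧ c = (a.1, !a.2)) := by
  obtain ⟨x, b⟩ := c
  obtain ⟨y, b'⟩ := a
  cases b <;> cases b' <;> simp [ed, mk_true, mk_false] at h ⊢ <;> obtain ⟨h, rfl⟩ := h <;> simp_all

/-- Locating an edge in a path. -/
lemma supp_locate (q q' : G) (w : List (A × Bool)) (a : A × Bool) (h : ed ρ q' a ∈ supp ρ q w) :
    ∃ P Q P' Q', w = P ++ Q ∧ w = P' ++ Q' ∧ q * ρ (mk P) = q' ∧ mk P * mk [a] = mk P' := by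
  rw [mem_supp_iff] at h
  obtain ⟨L₁, c, L₂, rfl, h⟩ := h
  rcases ed_eq ρ _ _ _ _ h.symm with ⟨h1, h2⟩ | ⟨h1, h2⟩
  · subst h2
    exact ⟨L₁, c :: L₂, L₁ ++ [c], L₂, rfl, by simp, h1, (mk_app _ _).symm⟩
  · have h3 : mk [a] = (mk [c])⁻¹ := by rw [h2, mk_flip, inv_inv]
    refine ⟨L₁ ++ [c], L₂, L₁, c :: L₂, by simp, rfl, ?_, ?_⟩
    · rw [mk_app, map_mul, ← mul_assoc, h1]
    · rw [mk_app, h3, mul_inv_cancel_right]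

lemma supp_verts (q : G) (w : List (A × Bool)) (e : G × A) (h : e ∈ supp ρ q w) :
    e.1 ∈ verts ρ q w ∧ e.1 * ρ (of e.2) ∈ verts ρ q w := by
  have : e = ed ρ e.1 (e.2, true) := by simp [ed]
  rw [this] at h
  obtain ⟨P, Q, P', Q', h1, h2, h3, h4⟩ := supp_locate ρ _ _ _ _ h
  refine ⟨⟨P, Q, h1, h3.symm⟩, ⟨P', Q', h2, ?_⟩⟩
  rw [← h4, map_mul, ← mul_assoc, h3]; rfl

/-- A set of vertices not separated by the edges in the support of the chain of a path
contains both or none of the end points. -/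
lemma cut (p : ℕ) [Fact p.Prime] (q : G) (L : List (A × Bool)) (V : Set G)
    (h : ∀ e, chain ρ p q L e ≠ 0 → (e.1 ∈ V ↔ e.1 * ρ (of e.2) ∈ V)) :
    q ∈ V ↔ q * ρ (mk L) ∈ V := by
  classical
  let χ : G → ZMod p := fun g => if g ∈ V then 1 else 0
  let θ : (G × A →₀ ZMod p) →ₗ[ZMod p] ZMod p :=
    Finsupp.linearCombination (ZMod p) (fun e : G × A => χ (e.1 * ρ (of e.2)) - χ e.1)
  have key : ∀ (L : List (A × Bool)) (q : G), θ (chain ρ p q L) = χ (q * ρ (mk L)) - χ q := by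
    intro L
    induction L with
    | nil => intro q; simp [chain, mk_nil]
    | cons a L ih =>
      intro q
      have : θ (Finsupp.single (ed ρ q a) (sgn p a)) = χ (q * ρ (mk [a])) - χ q := by
        obtain ⟨x, b⟩ := a
        cases b <;> simp [θ, ed, sgn, mk_true, mk_false]
      simp only [chain, map_add, this, ih]
      rw [mk_cons a L, map_mul, mul_assoc]; ring
  have h0 : θ (chain ρ p q L) = 0 := by
    simp only [θ, Finsupp.linearCombination_apply, Finsupp.sum]
    apply Finset.sum_eq_zero
    intro e he
    have := h e (by simpa using he)
    simp [χ, this]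
  rw [key] at h0
  by_cases h1 : q ∈ V <;> by_cases h2 : q * ρ (mk L) ∈ V <;> simp_all [χ]

lemma start_verts (q : G) (L : List (A × Bool)) : q ∈ verts ρ q L := ⟨[], L, rfl, by simp [mk_nil]⟩

lemma end_verts (q : G) (L : List (A × Bool)) : q * ρ (mk L) ∈ verts ρ q L := ⟨L, [], by simp, rfl⟩

/-- The three paths have a common vertex. -/
lemma touch (p : ℕ) [Fact p.Prime] (u v w : List (A × Bool)) (h1 : ρ (mk (u ++ v ++ w)) = 1)
    (h : chain ρ p 1 (u ++ v ++ w) = 0) :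
    ∃ m, m ∈ verts ρ 1 u ∧ m ∈ verts ρ (ρ (mk u)) v ∧ m ∈ verts ρ (ρ (mk u) * ρ (mk v)) w := by
  by_contra hc
  push Not at hc
  rw [chain_app, chain_app] at h
  simp only [one_mul, mk_app, map_mul] at h h1
  have he := end_verts ρ (ρ (mk u) * ρ (mk v)) w
  rw [h1] at he
  have := (cut ρ p 1 u (verts ρ (ρ (mk u)) v) ?_).2 ?_
  · exact hc 1 (start_verts ρ _ _) this he
  · intro e hu
    by_cases hv : chain ρ p (ρ (mk u)) v e = 0
    · have hw : chain ρ p (ρ (mk u) * ρ (mk v)) w e ≠ 0 := by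
        intro hw
        have := DFunLike.congr_fun h e
        simp [hv, hw] at this
        exact hu this
      have hu := supp_verts ρ _ _ _ (chain_support ρ _ _ _ _ hu)
      have hw := supp_verts ρ _ _ _ (chain_support ρ _ _ _ _ hw)
      exact ⟨fun h => absurd hw.1 (hc _ hu.1 h), fun h => absurd hw.2 (hc _ hu.2 h)⟩
    · have hv := supp_verts ρ _ _ _ (chain_support ρ _ _ _ _ hv)
      simp [hv.1, hv.2]
  · rw [one_mul]; exact start_verts ρ _ _

/-- Reversing a path. -/
lemma supp_inv (q : G) (w : List (A × Bool)) : supp ρ (q * ρ (mk w)) (invRev w) = supp ρ q w := by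
  induction w generalizing q with
  | nil => simp [supp]
  | cons a w ih =>
    rw [invRev_cons, supp_app, mk_cons a w, map_mul, ← mul_assoc, ih, ← inv_mk, map_inv,
      mul_inv_cancel_right, Set.union_comm]
    simp only [supp]
    congr 1
    obtain ⟨x, b⟩ := a
    cases b <;> simp [invRev, supp, ed, mk_true, mk_false]

/-- The bigon case. -/
lemma bigon (p : ℕ) [Fact p.Prime] (u v : List (A × Bool))
    (h : chain ρ p 1 (u ++ v) = 0) :
    ∃ w, ρ (mk w) = ρ (mk u) ∧ supp ρ 1 w ⊆ supp ρ 1 u ∧ supp ρ 1 w ⊆ supp ρ (ρ (mk u)) v := by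
  rw [chain_app, one_mul] at h
  let V : Set G := {g | ∃ w, ρ (mk w) = g ∧ ∀ e ∈ supp ρ 1 w, chain ρ p 1 u e ≠ 0}
  have := (cut ρ p 1 u V ?_).1 ⟨[], by simp [mk_nil], by simp [supp]⟩
  · obtain ⟨w, hw, hs⟩ := this
    refine ⟨w, by simpa using hw, fun e he => chain_support ρ _ _ _ _ (hs e he), fun e he =>
      chain_support ρ p _ _ _ fun h0 => ?_⟩
    have := DFunLike.congr_fun h e
    simp [h0] at this
    exact hs e he this
  · rintro ⟨g, x⟩ he
    constructor
    · rintro ⟨w, hw, hs⟩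
      refine ⟨w ++ [(x, true)], by rw [mk_app, map_mul, hw]; rfl, ?_⟩
      rw [supp_app]
      rintro e (h | h)
      · exact hs e h
      · simp [supp, ed, hw] at h
        rwa [h]
    · rintro ⟨w, hw, hs⟩
      refine ⟨w ++ [(x, false)], by rw [mk_app, map_mul, hw, mk_false]; simp, ?_⟩
      rw [supp_app]
      rintro e (h | h)
      · exact hs e h
      · simp [supp, ed, hw, mk_false] at h
        rwa [h]

/-- `w'` is a path with the same end point as `w` using only edges of `w`. -/
def R (w w' : List (A × Bool)) : Prop := ρ (mk w') = ρ (mk w) ∧ supp ρ 1 w' ⊆ supp ρ 1 w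

lemma R_app {u v u' v' : List (A × Bool)} (h1 : R ρ u u') (h2 : R ρ v v') :
    R ρ (u ++ v) (u' ++ v') := by
  refine ⟨by rw [mk_app, mk_app, map_mul, map_mul, h1.1, h2.1], ?_⟩
  rw [supp_app, supp_app, one_mul, one_mul, h1.1]
  refine Set.union_subset_union h1.2 ?_
  have := supp_mono_translate ρ (ρ (mk u)) 1 _ _ h2.2
  rwa [mul_one] at this

end RZ

namespace RZ

open FreeGroup (mk of invRev invRev_cons inv_mk mul_mk)

variable {A : Type}

/-- Normal subgroups with quotient a finite `p`-group. -/
def PO (p : ℕ) (N : Subgroup (FreeGroup A)) : Prop :=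
  N.Normal ∧ N.FiniteIndex ∧ ∀ g, ∃ k, g ^ p ^ k ∈ N

lemma PO_of (p : ℕ) (N : Subgroup (FreeGroup A)) (hN : N.Normal) (hf : Finite (FreeGroup A ⧸ N))
    (h : IsPGroup p (FreeGroup A ⧸ N)) : PO p N := by
  refine ⟨hN, Subgroup.finiteIndex_of_finite_quotient, fun g => ?_⟩
  obtain ⟨k, hk⟩ := (isPGroup_iff_pow_pow_eq_one.1 h) (g : FreeGroup A ⧸ N)
  exact ⟨k, by rwa [← QuotientGroup.eq_one_iff, QuotientGroup.mk_pow]⟩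

lemma PO.finite {p : ℕ} {N : Subgroup (FreeGroup A)} (h : PO p N) : Finite (FreeGroup A ⧸ N) := by
  have := h.2.1
  infer_instance

lemma PO.isPGroup {p : ℕ} {N : Subgroup (FreeGroup A)} (h : PO p N) :
    haveI := h.1
    IsPGroup p (FreeGroup A ⧸ N) := by
  have := h.1
  rw [isPGroup_iff_pow_pow_eq_one]
  intro g
  induction g using QuotientGroup.induction_on with
  | H g =>
    obtain ⟨k, hk⟩ := h.2.2 g
    exact ⟨k, by rwa [← QuotientGroup.mk_pow, QuotientGroup.eq_one_iff]⟩

lemma PO_iInf (p : ℕ) {ι : Type} [Finite ι] (N : ι → Subgroup (FreeGroup A)) (h : ∀ i, PO p (N i)) :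
    PO p (⨅ i, N i) := by
  refine ⟨Subgroup.normal_iInf_normal fun i => (h i).1,
    Subgroup.finiteIndex_iInf fun i => (h i).2.1, fun g => ?_⟩
  classical
  have := Fintype.ofFinite ι
  choose k hk using fun i => (h i).2.2 g
  refine ⟨∑ i, k i, ?_⟩
  rw [Subgroup.mem_iInf]
  intro i
  rw [← Finset.add_sum_erase _ _ (Finset.mem_univ i), pow_add, pow_mul]
  exact Subgroup.pow_mem _ (hk i) _

/-- `L` is a word over `S`. -/
def Over (S : Set A) (L : List (A × Bool)) : Prop := ∀ a ∈ L, a.1 ∈ S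

/-- The universal elementary abelian `p`-extension (relative to finitely many letters). -/
lemma expand (p : ℕ) [hp : Fact p.Prime] (S : Set A) (hS : S.Finite)
    (N : Subgroup (FreeGroup A)) [N.Normal] (hN : PO p N) :
    ∃ N', PO p N' ∧ N' ≤ N ∧ ∀ L, Over S L → mk L ∈ N' →
      chain (QuotientGroup.mk' N) p 1 L = 0 := by
  classical
  have := hN.finite
  have : Finite S := hS
  have : NeZero p := ⟨hp.out.ne_zero⟩
  let G := FreeGroup A ⧸ N
  let D := S → Multiplicative (ZMod p)
  have : Finite D := inferInstance
  let ρ : FreeGroup A →* G := QuotientGroup.mk' N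
  let Φ : FreeGroup A →* RegularWreathProduct D G := FreeGroup.lift fun x =>
    ⟨fun g s => if g = 1 ∧ (s : A) = x then Multiplicative.ofAdd 1 else 1, ρ (of x)⟩
  have hright : ∀ g, (Φ g).right = ρ g := by
    have : (RegularWreathProduct.rightHom).comp Φ = ρ := by
      ext x; simp [Φ]
    intro g
    exact DFunLike.congr_fun this g
  have hof : ∀ (x : A) (g : G) (s : S), (Φ (of x)).left g s =
      if g = 1 ∧ (s : A) = x then Multiplicative.ofAdd 1 else 1 := by
    intro x g s
    simp [Φ]
  have hleft : ∀ L : List (A × Bool), Over S L → ∀ (q g : G) (s : S),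
      (Φ (mk L)).left (q⁻¹ * g) s = Multiplicative.ofAdd (chain ρ p q L (g, s)) := by
    intro L
    induction L with
    | nil => intro _ q g s; simp [mk_nil, chain]; rfl
    | cons a L ih =>
      intro hL q g s
      have ih := ih (fun a ha => hL a (List.mem_cons_of_mem _ ha)) (q * ρ (mk [a])) g s
      rw [mk_cons, map_mul, RegularWreathProduct.mul_left, Pi.mul_apply, Pi.mul_apply, hright]
      rw [← mul_assoc, ← mul_inv_rev, ih, chain, Finsupp.add_apply, ofAdd_add]
      congr 1
      obtain ⟨x, b⟩ := a
      cases b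
      · have h1 : (Φ (mk [(x, false)])).left (q⁻¹ * g) s =
            ((Φ (of x)).left (ρ (of x) * (q⁻¹ * g)) s)⁻¹ := by
          rw [mk_false, map_inv, RegularWreathProduct.inv_left, hright]; rfl
        have h2 : (q * (ρ (of x))⁻¹ = g ∧ x = s) ↔ (ρ (of x) * (q⁻¹ * g) = 1 ∧ (s : A) = x) := by
          rw [← mul_assoc, mul_eq_one_iff_inv_eq, mul_inv_rev, inv_inv, eq_comm (a := x)]
        rw [h1, hof]
        simp only [Finsupp.single_apply, ed, sgn, mk_false, map_inv, Prod.mk.injEq, h2,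
          Bool.false_eq_true, if_false]
        split_ifs <;> simp
      · have h2 : (q = g ∧ x = s) ↔ (q⁻¹ * g = 1 ∧ (s : A) = x) := by
          rw [inv_mul_eq_one, eq_comm (a := x)]
        rw [mk_true, hof]
        simp only [Finsupp.single_apply, ed, sgn, Prod.mk.injEq, h2, if_true]
        split_ifs <;> simp
  refine ⟨Φ.ker, ⟨inferInstance, inferInstance, fun g => ?_⟩, fun g hg => ?_, fun L hL hg => ?_⟩
  · have : IsPGroup p (RegularWreathProduct D G) := by
      obtain ⟨m, hm⟩ := (IsPGroup.iff_card).1 hN.isPGroup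
      have hm : Nat.card G = p ^ m := hm
      have hD : Nat.card D = p ^ Nat.card S := by
        simp [D, Nat.card_fun]
      apply IsPGroup.of_card (n := Nat.card S * p ^ m + m)
      rw [RegularWreathProduct.card, hD, hm, ← pow_mul, ← pow_add]
    obtain ⟨k, hk⟩ := isPGroup_iff_pow_pow_eq_one.1 this (Φ g)
    exact ⟨k, by rwa [MonoidHom.mem_ker, map_pow]⟩
  · rw [← QuotientGroup.eq_one_iff]
    have := hright g
    rw [MonoidHom.mem_ker.1 hg] at this
    exact this.symm
  · ext ⟨g, x⟩
    by_contra hne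
    have hx : x ∈ S := by
      have := chain_support _ _ _ _ _ hne
      rw [mem_supp_iff] at this
      obtain ⟨L₁, c, L₂, rfl, h⟩ := this
      have : x = c.1 := by
        have := congrArg Prod.snd h
        unfold ed at this
        split_ifs at this <;> exact this
      rw [this]
      exact hL _ (by simp)
    have := hleft L hL 1 g ⟨x, hx⟩
    rw [MonoidHom.mem_ker.1 hg] at this
    apply hne
    simp only [inv_one, one_mul] at this
    have h3 : (1 : RegularWreathProduct D G).left g ⟨x, hx⟩ =
      Multiplicative.ofAdd (0 : ZMod p) := rfl
    rw [Finsupp.zero_apply]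
    exact Multiplicative.ofAdd.injective (this.symm.trans h3)

/-- Every product relation modulo a suitable subgroup lifts to a relation in the free group. -/
lemma polygon (p : ℕ) [hp : Fact p.Prime] (S : Set A) (hS : S.Finite)
    (N₀ : Subgroup (FreeGroup A)) [N₀.Normal] (hN₀ : PO p N₀) (k : ℕ) :
    ∃ N, PO p N ∧ N ≤ N₀ ∧ ∀ ws : List (List (A × Bool)), ws.length ≤ k + 1 →
      (∀ w ∈ ws, Over S w) → mk ws.flatten ∈ N →
      ∃ ws', List.Forall₂ (R (QuotientGroup.mk' N₀)) ws ws' ∧ mk ws'.flatten = 1 := by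
  induction k with
  | zero =>
    refine ⟨N₀, hN₀, le_rfl, ?_⟩
    intro ws hl _ hN
    match ws with
    | [] => exact ⟨[], List.Forall₂.nil, rfl⟩
    | [w] =>
      refine ⟨[[]], List.Forall₂.cons ⟨?_, by simp [supp]⟩ List.Forall₂.nil, rfl⟩
      simp only [List.flatten_cons, List.flatten_nil, List.append_nil] at hN
      rw [← QuotientGroup.eq_one_iff] at hN
      simp [hN, mk_nil]
    | _ :: _ :: _ => simp at hl
  | succ k ih =>
    obtain ⟨N, hN, hle, h⟩ := ih
    have := hN.1
    obtain ⟨N', hN', hle', h'⟩ := expand p S hS N hN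
    cases k with
    | zero =>
      obtain ⟨N', hN', hle', h'⟩ := expand p S hS N₀ hN₀
      obtain ⟨M, hM⟩ : ∃ M, M = N' ⊓ N := ⟨_, rfl⟩
      refine ⟨⨅ i : Bool, if i then N' else N, PO_iInf p _ (by rintro (_ | _) <;> simpa),
        (iInf_le _ false).trans (by simpa), ?_⟩
      intro ws hl hS hm
      have hm' : mk ws.flatten ∈ N' := by simpa using Subgroup.mem_iInf.1 hm true
      have hm : mk ws.flatten ∈ N := by simpa using Subgroup.mem_iInf.1 hm false
      by_cases hl' : ws.length ≤ 0 + 1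
      · exact h ws hl' hS hm
      match ws with
      | [] => simp at hl'
      | [w] => simp at hl'
      | [u, v] =>
        simp only [List.flatten_cons, List.flatten_nil, List.append_nil] at hm'
        have hO : Over S (u ++ v) := by
          intro a ha
          rcases List.mem_append.1 ha with ha | ha
          · exact hS u (by simp) a ha
          · exact hS v (by simp) a ha
        obtain ⟨w, hw, hu, hv⟩ := bigon _ p u v (h' _ hO hm')
        have h1 : (QuotientGroup.mk' N₀) (mk u) * (QuotientGroup.mk' N₀) (mk v) = 1 := by
          rw [← map_mul, ← mk_app]
          exact (QuotientGroup.eq_one_iff _).2 (hle' hm')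
        refine ⟨[w, invRev w], List.Forall₂.cons ⟨hw, hu⟩ (List.Forall₂.cons ⟨?_, ?_⟩
          List.Forall₂.nil), ?_⟩
        · rw [← inv_mk, map_inv, hw]
          exact inv_eq_of_mul_eq_one_right h1
        · intro e he
          rw [supp_translate _ ((QuotientGroup.mk' N₀) (mk u))] at he ⊢
          rw [mul_one] at *
          apply hv
          rw [← supp_inv, one_mul, hw]
          exact he
        · simp [mk_app, ← inv_mk]
      | _ :: _ :: _ :: _ => simp at hl
    | succ k =>
      refine ⟨N', hN', hle'.trans hle, ?_⟩
      intro ws hl hO hm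
      by_cases hl' : ws.length ≤ k + 1 + 1
      · exact h ws hl' hO (hle' hm)
      match ws with
      | [] => simp at hl'
      | [w] => simp at hl'
      | w₁ :: w₂ :: rest =>
        have hrest : rest ≠ [] := by rintro rfl; simp at hl'
        have hOf : Over S (w₁ ++ w₂ ++ rest.flatten) := by
          intro a ha
          simp only [List.mem_append, List.mem_flatten] at ha
          rcases ha with (ha | ha) | ⟨l, hl, ha⟩
          · exact hO w₁ (by simp) a ha
          · exact hO w₂ (by simp) a ha
          · exact hO l (by simp [hl]) a ha
        have hfl : (w₁ :: w₂ :: rest).flatten = w₁ ++ w₂ ++ rest.flatten := by simp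
        rw [hfl] at hm
        have h1 := (QuotientGroup.eq_one_iff _).2 (hle' hm)
        obtain ⟨m, ⟨u₁, v₁, hw₁, hm₁⟩, ⟨u₂, v₂, hw₂, hm₂⟩, ⟨u₃, v₃, hw₃, hm₃⟩⟩ :=
          touch (QuotientGroup.mk' N) p w₁ w₂ rest.flatten h1 (h' _ hOf hm)
        have hsplit : ∃ B s t C, rest = B ++ (s ++ t) :: C ∧ u₃ = B.flatten ++ s ∧
            v₃ = t ++ C.flatten := by
          rcases List.flatten_eq_append_iff.1 hw₃ with ⟨as, bs, h1, h2, h3⟩ |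
            ⟨as, bs, c, cs, ds, h1, h2, h3⟩
          · rcases List.eq_nil_or_concat as with rfl | ⟨as', a, rfl⟩
            · match bs with
              | [] => exact absurd h1 hrest
              | b :: bs => exact ⟨[], [], b, bs, by simpa using h1, by simpa using h2, by simpa using h3⟩
            · exact ⟨as', a, [], bs, by simpa using h1, by simpa using h2, by simpa using h3⟩
          · exact ⟨as, bs, c :: cs, ds, h1, h2, h3⟩
        obtain ⟨B, s, t, C, hr, hu₃, hv₃⟩ := hsplit
        have hlen : B.length + C.length ≤ k := by
          rw [hr] at hl; simp at hl; omega
        have hO1 := hO w₁ (by simp)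
        have hO2 := hO w₂ (by simp)
        have hOB : ∀ w ∈ B, Over S w := fun w hw => hO w (by simp [hr, hw])
        have hOC : ∀ w ∈ C, Over S w := fun w hw => hO w (by simp [hr, hw])
        have hOj : Over S (s ++ t) := hO _ (by simp [hr])
        have hOl : ∀ {a b : List (A × Bool)}, Over S (a ++ b) → Over S a :=
          fun h x hx => h x (by simp [hx])
        have hOr : ∀ {a b : List (A × Bool)}, Over S (a ++ b) → Over S b :=
          fun h x hx => h x (by simp [hx])
        rw [hw₁] at hO1
        rw [hw₂] at hO2
        have tot : (QuotientGroup.mk' N) (mk w₁) * (QuotientGroup.mk' N) (mk w₂) *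
            ((QuotientGroup.mk' N) (mk u₃) * (QuotientGroup.mk' N) (mk v₃)) = 1 := by
          rw [← map_mul, ← map_mul, ← map_mul, ← mk_app, ← mk_app, ← mk_app, ← hw₃]
          exact h1
        generalize hρ : QuotientGroup.mk' N = ρ at *
        have hker : ∀ g, ρ g = 1 → g ∈ N := by
          intro g hg; rw [← hρ] at hg; exact (QuotientGroup.eq_one_iff _).1 hg
        have e1 : ρ (mk w₁) = ρ (mk u₁) * ρ (mk v₁) := by rw [hw₁, mk_app, map_mul]
        have e2 : ρ (mk w₂) = ρ (mk u₂) * ρ (mk v₂) := by rw [hw₂, mk_app, map_mul]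
        rw [one_mul] at hm₁
        obtain ⟨x1, hx1, hx1'⟩ := h [v₁, u₂] (by simp)
          (by
            intro w hw
            simp only [List.mem_cons, List.not_mem_nil, or_false] at hw
            rcases hw with rfl | rfl
            · exact hOr hO1
            · exact hOl hO2)
          (by
            apply hker
            simp only [List.flatten_cons, List.flatten_nil, List.append_nil, mk_app, map_mul]
            rw [hm₁, e1, mul_assoc] at hm₂
            exact left_eq_mul.1 hm₂)
        obtain ⟨x2, hx2, hx2'⟩ := h (v₂ :: (B ++ [s])) (by simp; omega)
          (by
            intro w hw
            simp only [List.mem_cons, List.mem_append, List.not_mem_nil, or_false] at hw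
            rcases hw with rfl | hw | rfl
            · exact hOr hO2
            · exact hOB w hw
            · exact hOl hOj)
          (by
            apply hker
            have : (v₂ :: (B ++ [s])).flatten = v₂ ++ u₃ := by simp [hu₃]
            rw [this, mk_app, map_mul]
            rw [hm₂, e2, ← mul_assoc, mul_assoc] at hm₃
            exact left_eq_mul.1 hm₃)
        obtain ⟨x3, hx3, hx3'⟩ := h (t :: (C ++ [u₁])) (by simp; omega)
          (by
            intro w hw
            simp only [List.mem_cons, List.mem_append, List.not_mem_nil, or_false] at hw
            rcases hw with rfl | hw | rfl
            · exact hOr hOj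
            · exact hOC w hw
            · exact hOl hO1)
          (by
            apply hker
            have : (t :: (C ++ [u₁])).flatten = v₃ ++ u₁ := by simp [hv₃]
            rw [this, mk_app, map_mul]
            rw [← mul_assoc, ← hm₃, hm₁] at tot
            rw [mul_eq_one_iff_eq_inv] at tot
            rw [tot, mul_inv_cancel])
        obtain ⟨v₁', r1, hv₁, hr1, rfl⟩ := List.forall₂_cons_left_iff.1 hx1
        obtain ⟨u₂', r1', hu₂, hr1', rfl⟩ := List.forall₂_cons_left_iff.1 hr1
        obtain rfl := List.forall₂_nil_left_iff.1 hr1'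
        obtain ⟨v₂', r2, hv₂, hr2, rfl⟩ := List.forall₂_cons_left_iff.1 hx2
        obtain ⟨t', r3, ht, hr3, rfl⟩ := List.forall₂_cons_left_iff.1 hx3
        have happ : ∀ (B : List (List (A × Bool))) (s : List (A × Bool)) (r : List (List (A × Bool))),
            List.Forall₂ (R (QuotientGroup.mk' N₀)) (B ++ [s]) r →
            ∃ B' s', r = B' ++ [s'] ∧ List.Forall₂ (R (QuotientGroup.mk' N₀)) B B' ∧
              R (QuotientGroup.mk' N₀) s s' := by
          intro B s
          induction B with
          | nil =>
            intro r hr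
            obtain ⟨s', r', hs, hr', rfl⟩ := List.forall₂_cons_left_iff.1 hr
            obtain rfl := List.forall₂_nil_left_iff.1 hr'
            exact ⟨[], s', rfl, List.Forall₂.nil, hs⟩
          | cons b B ih =>
            intro r hr
            obtain ⟨b', r', hs, hr', rfl⟩ := List.forall₂_cons_left_iff.1 hr
            obtain ⟨B', s', rfl, hB, hs'⟩ := ih _ hr'
            exact ⟨b' :: B', s', rfl, List.Forall₂.cons hs hB, hs'⟩
        obtain ⟨B', s', rfl, hB, hs⟩ := happ _ _ _ hr2
        obtain ⟨C', u₁', rfl, hC, hu₁⟩ := happ _ _ _ hr3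
        refine ⟨(u₁' ++ v₁') :: (u₂' ++ v₂') :: (B' ++ (s' ++ t') :: C'), ?_, ?_⟩
        · rw [hw₁, hw₂, hr]
          refine List.Forall₂.cons (R_app _ hu₁ hv₁) (List.Forall₂.cons (R_app _ hu₂ hv₂) ?_)
          exact List.rel_append hB (List.Forall₂.cons (R_app _ hs ht) hC)
        · simp only [List.flatten_cons, List.flatten_append, List.flatten_nil, List.append_nil,
            mk_app] at hx1' hx2' hx3' ⊢
          calc _ = mk u₁' * (mk v₁' * mk u₂') * (mk v₂' * (mk B'.flatten * mk s')) *
                (mk t' * (mk C'.flatten * mk u₁')) * (mk u₁')⁻¹ := by group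
            _ = 1 := by rw [hx1', hx2', hx3']; group

end RZ

namespace RZ

open FreeGroup (mk of invRev invRev_cons inv_mk mul_mk)

variable {A : Type}

/-- Free groups are residually finite-`p`, in terms of reduced words. -/
lemma residual_word (p : ℕ) [hp : Fact p.Prime] (n : ℕ) : ∀ L : List (A × Bool), L.length = n →
    FreeGroup.IsReduced L → L ≠ [] → ∃ N, PO p N ∧ mk L ∉ N := by
  induction n using Nat.strong_induction_on with
  | _ n ih =>
  intro L hlen hred hne
  obtain ⟨a, L', rfl⟩ := List.exists_cons_of_ne_nil hne
  by_cases hcase : ∃ M, L' = M ++ [(a.1, !a.2)]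
  · obtain ⟨M, rfl⟩ := hcase
    have hM : M ≠ [] := by
      rintro rfl
      have := hred
      obtain ⟨x, b⟩ := a
      cases b <;> simp [FreeGroup.IsReduced] at this
    obtain ⟨N, hN, hm⟩ := ih M.length (by simp at hlen; omega) M rfl
      (hred.infix ⟨[a], [(a.1, !a.2)], by simp⟩) hM
    refine ⟨N, hN, fun h => hm ?_⟩
    have := hN.1.conj_mem _ h (mk [a])⁻¹
    rw [mk_cons a (M ++ _), mk_app, mk_flip] at this
    have e : (mk [a])⁻¹ * (mk [a] * (mk M * (mk [a])⁻¹)) * (mk [a])⁻¹⁻¹ = mk M := by group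
    rwa [e] at this
  · have hpre : ∀ i : Fin L'.length, ∃ N, PO p N ∧ mk (a :: L'.take i) ∉ N := by
      intro i
      refine ih (i + 1) (by simp at hlen; omega) _ (by simp) ?_ (by simp)
      exact hred.infix ⟨[], L'.drop i, by simp⟩
    choose N hN hNi using hpre
    have hinf := PO_iInf p N hN
    have := hinf.1
    obtain ⟨N', hN', -, h'⟩ := expand p {x | ∃ b, (x, b) ∈ a :: L'}
      (by
        refine ((a :: L').map Prod.fst).finite_toSet.subset ?_
        rintro x ⟨b, hb⟩
        exact List.mem_map_of_mem (f := Prod.fst) hb) _ hinf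
    refine ⟨N', hN', fun hmem => ?_⟩
    have h0 := h' _ (fun c hc => ⟨c.2, hc⟩) hmem
    generalize hρ : QuotientGroup.mk' (⨅ i, N i) = ρ at *
    have hker : ∀ L₁ L₂, L₂ ≠ [] → L' = L₁ ++ L₂ → ρ (mk (a :: L₁)) ≠ 1 := by
      intro L₁ L₂ hL₂ hL hone
      have hlt : L₁.length < L'.length := by
        rw [hL]; simp; exact List.length_pos_of_ne_nil hL₂
      rw [← hρ] at hone
      have := (QuotientGroup.eq_one_iff _).1 hone
      refine hNi ⟨L₁.length, hlt⟩ ?_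
      have h2 := Subgroup.mem_iInf.1 this ⟨L₁.length, hlt⟩
      simpa [hL] using h2
    have hns : ed ρ 1 a ∉ supp ρ (1 * ρ (mk [a])) L' := by
      intro hs
      rw [mem_supp_iff] at hs
      obtain ⟨L₁, c, L₂, hL, he⟩ := hs
      rcases ed_eq ρ _ _ _ _ he.symm with ⟨h1, h2⟩ | ⟨h1, h2⟩
      · refine hker L₁ (c :: L₂) (by simp) hL ?_
        rw [mk_cons, map_mul]; simpa using h1
      · by_cases hL₂ : L₂ = []
        · exact hcase ⟨L₁, by rw [hL, hL₂, h2]⟩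
        · refine hker (L₁ ++ [c]) L₂ hL₂ (by simp [hL]) ?_
          rw [mk_cons, map_mul, mk_app, map_mul]
          simpa [mul_assoc] using h1
    have h1 : chain ρ p (1 * ρ (mk [a])) L' (ed ρ 1 a) = 0 := by
      by_contra h
      exact hns (chain_support _ _ _ _ _ h)
    have h2 := DFunLike.congr_fun h0 (ed ρ 1 a)
    rw [chain, Finsupp.add_apply, h1] at h2
    simp [sgn] at h2
    split_ifs at h2 <;> simp at h2

lemma exists_word (x : FreeGroup A) : ∃ L, mk L = x := by
  classical
  exact ⟨x.toWord, FreeGroup.mk_toWord⟩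

lemma bot_closed (p : ℕ) [hp : Fact p.Prime] :
    ProPClosed p ((⊥ : Subgroup (FreeGroup A)) : Set (FreeGroup A)) := by
  classical
  intro g hg
  have hg : g ≠ 1 := by simpa using hg
  obtain ⟨N, hN, hm⟩ := residual_word p _ g.toWord rfl FreeGroup.isReduced_toWord
    (by simpa using hg)
  rw [FreeGroup.mk_toWord] at hm
  refine ⟨N, hN.1, hN.finite, hN.isPGroup, fun x hx h => hm ?_⟩
  have : g * x = 1 := by simpa using h
  rw [mul_eq_one_iff_eq_inv.1 this]
  exact N.inv_mem hx

/-- Words for the elements of a coset `Hg` of a closed subgroup: paths through a finite set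
of cosets. -/
lemma coset (p : ℕ) (H : Subgroup (FreeGroup A)) (hfg : H.FG)
    (hcl : ProPClosed p (H : Set (FreeGroup A))) (g : FreeGroup A) :
    ∃ (S : Set A) (N : Subgroup (FreeGroup A)), S.Finite ∧ PO p N ∧
      ∀ h ∈ H, ∃ w, Over S w ∧ mk w = h * g ∧
        ∀ N₀ : Subgroup (FreeGroup A), ∀ _ : N₀.Normal, N₀ ≤ N → ∀ w',
          R (QuotientGroup.mk' N₀) w w' → mk w' * g⁻¹ ∈ H := by
  classical
  obtain ⟨X, hX⟩ := hfg
  let W : Finset (List (A × Bool)) := insert g.toWord (X.image FreeGroup.toWord)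
  let T : Finset (FreeGroup A) := W.biUnion fun L => (L.inits.map mk).toFinset
  let S : Finset A := W.biUnion fun L => (L.map Prod.fst).toFinset
  have hT : ∀ L ∈ W, ∀ L₁ L₂, L = L₁ ++ L₂ → mk L₁ ∈ T := by
    intro L hL L₁ L₂ h
    simp only [T, Finset.mem_biUnion, List.mem_toFinset, List.mem_map, List.mem_inits]
    exact ⟨L, hL, L₁, ⟨L₂, h.symm⟩, rfl⟩
  have hS : ∀ L ∈ W, Over (S : Set A) L := by
    intro L hL a ha
    simp only [S, Finset.mem_coe, Finset.mem_biUnion, List.mem_toFinset, List.mem_map]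
    exact ⟨L, hL, a, ha, rfl⟩
  have hgW : g.toWord ∈ W := by simp [W]
  have h1T : (1 : FreeGroup A) ∈ T := hT _ hgW [] _ rfl
  have hgT : g ∈ T := by
    have := hT _ hgW g.toWord [] (by simp)
    rwa [FreeGroup.mk_toWord] at this
  have hsep : ∀ t : T × T, ∃ N, PO p N ∧ ∀ x ∈ N,
      (t.1 : FreeGroup A) * (t.2 : FreeGroup A)⁻¹ * x ∈ H →
      (t.1 : FreeGroup A) * (t.2 : FreeGroup A)⁻¹ ∈ H := by
    intro t
    by_cases ht : (t.1 : FreeGroup A) * (t.2 : FreeGroup A)⁻¹ ∈ H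
    · refine ⟨⊤, ⟨inferInstance, inferInstance, fun g => ⟨0, trivial⟩⟩, fun _ _ _ => ht⟩
    · obtain ⟨N, hN, hf, hP, h⟩ := hcl _ ht
      exact ⟨N, PO_of p N hN hf hP, fun x hx hh => absurd hh (h x hx)⟩
  choose N hN hNs using hsep
  refine ⟨S, ⨅ t, N t, S.finite_toSet, PO_iInf p N hN, ?_⟩
  have hgood : ∀ h ∈ H, ∃ w, Over (S : Set A) w ∧ mk w = h ∧
      ∀ L₁ L₂, w = L₁ ++ L₂ → ∃ t ∈ T, mk L₁ * t⁻¹ ∈ H := by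
    intro h hh
    have hh' : h ∈ Subgroup.closure (X : Set (FreeGroup A)) := by rwa [hX]
    induction hh' using Subgroup.closure_induction with
    | mem x hx =>
      have hxW : x.toWord ∈ W := by
        simp only [W, Finset.mem_insert, Finset.mem_image]
        exact Or.inr ⟨x, hx, rfl⟩
      refine ⟨x.toWord, hS _ hxW, FreeGroup.mk_toWord, fun L₁ L₂ h => ⟨mk L₁, hT _ hxW _ _ h, ?_⟩⟩
      rw [mul_inv_cancel]; exact H.one_mem
    | one =>
      refine ⟨[], by simp [Over], rfl, fun L₁ L₂ h => ⟨1, h1T, ?_⟩⟩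
      obtain ⟨rfl, -⟩ := List.append_eq_nil_iff.1 h.symm
      simp [mk_nil, H.one_mem]
    | mul x y hx hy ihx ihy =>
      rw [hX] at hx hy
      obtain ⟨u, hu1, hu2, hu3⟩ := ihx hx
      obtain ⟨v, hv1, hv2, hv3⟩ := ihy hy
      refine ⟨u ++ v, ?_, by rw [mk_app, hu2, hv2], ?_⟩
      · intro a ha
        rcases List.mem_append.1 ha with ha | ha
        · exact hu1 a ha
        · exact hv1 a ha
      · intro L₁ L₂ h
        rcases List.append_eq_append_iff.1 h with ⟨c, rfl, h2⟩ | ⟨c, h2, -⟩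
        · obtain ⟨t, ht, htH⟩ := hv3 _ _ h2
          refine ⟨t, ht, ?_⟩
          rw [mk_app, hu2, mul_assoc]
          exact H.mul_mem hx htH
        · exact hu3 _ _ h2
    | inv x hx ihx =>
      rw [hX] at hx
      obtain ⟨u, hu1, hu2, hu3⟩ := ihx hx
      refine ⟨invRev u, ?_, by rw [← inv_mk, hu2], ?_⟩
      · intro a ha
        simp only [invRev, List.mem_reverse, List.mem_map] at ha
        obtain ⟨b, hb, rfl⟩ := ha
        exact hu1 b hb
      · intro L₁ L₂ h
        have hu : u = invRev L₂ ++ invRev L₁ := by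
          rw [← FreeGroup.invRev_append, ← h, FreeGroup.invRev_invRev]
        obtain ⟨t, ht, htH⟩ := hu3 _ _ hu
        refine ⟨t, ht, ?_⟩
        have : mk L₁ = x⁻¹ * mk (invRev L₂) := by
          rw [← hu2, hu, mk_app, ← inv_mk, ← inv_mk]; group
        rw [this, mul_assoc]
        exact H.mul_mem (H.inv_mem hx) htH
  intro h hh
  obtain ⟨u, hu1, hu2, hu3⟩ := hgood h hh
  have hpre : ∀ L₁ L₂, u ++ g.toWord = L₁ ++ L₂ → ∃ t ∈ T, mk L₁ * t⁻¹ ∈ H := by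
    intro L₁ L₂ h'
    rcases List.append_eq_append_iff.1 h' with ⟨c, rfl, h2⟩ | ⟨c, h2, -⟩
    · refine ⟨mk c, hT _ hgW _ _ h2, ?_⟩
      rw [mk_app, hu2, mul_inv_cancel_right]
      exact hh
    · exact hu3 _ _ h2
  refine ⟨u ++ g.toWord, ?_, by rw [mk_app, hu2, FreeGroup.mk_toWord], ?_⟩
  · intro a ha
    rcases List.mem_append.1 ha with ha | ha
    · exact hu1 a ha
    · exact hS _ hgW a ha
  generalize hw : u ++ g.toWord = w at *
  have hmkw : mk w = h * g := by rw [← hw, mk_app, hu2, FreeGroup.mk_toWord]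
  intro N₀ hN₀ hle w' hR
  have hsep : ∀ (x y t s : FreeGroup A), t ∈ T → s ∈ T → x * t⁻¹ ∈ H → y * s⁻¹ ∈ H →
      QuotientGroup.mk' N₀ x = QuotientGroup.mk' N₀ y → y * x⁻¹ ∈ H := by
    intro x y t s ht hs hx hy hxy
    have hn : (x * t⁻¹)⁻¹ * (x * y⁻¹) * (x * t⁻¹) ∈ N₀ := by
      have : x * y⁻¹ ∈ N₀ := by
        rw [← QuotientGroup.eq_one_iff, QuotientGroup.mk_mul, QuotientGroup.mk_inv]
        exact mul_inv_eq_one.2 hxy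
      simpa using hN₀.conj_mem _ this (x * t⁻¹)⁻¹
    have hn' := Subgroup.mem_iInf.1 (hle hn) (⟨s, hs⟩, ⟨t, ht⟩)
    have := hNs (⟨s, hs⟩, ⟨t, ht⟩) _ hn' (by
      have e : s * t⁻¹ * ((x * t⁻¹)⁻¹ * (x * y⁻¹) * (x * t⁻¹)) =
        (y * s⁻¹)⁻¹ * (x * t⁻¹) := by group
      rw [e]
      exact H.mul_mem (H.inv_mem hy) hx)
    have e : y * x⁻¹ = (y * s⁻¹) * (s * t⁻¹) * (x * t⁻¹)⁻¹ := by group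
    rw [e]
    exact H.mul_mem (H.mul_mem hy this) (H.inv_mem hx)
  have hinv : ∀ (L : List (A × Bool)) (v : FreeGroup A), (∃ t ∈ T, v * t⁻¹ ∈ H) →
      supp (QuotientGroup.mk' N₀) (QuotientGroup.mk' N₀ v) L ⊆ supp (QuotientGroup.mk' N₀) 1 w →
      ∃ t ∈ T, v * mk L * t⁻¹ ∈ H := by
    intro L
    induction L with
    | nil => intro v hv _; simpa [mk_nil] using hv
    | cons a L ih =>
      rintro v ⟨t, ht, hvt⟩ hs
      have ha := hs (Or.inl rfl)
      obtain ⟨P, Q, P', Q', h1, h2, h3, h4⟩ := supp_locate _ _ _ _ _ ha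
      obtain ⟨s, hs1, hs2⟩ := hpre _ _ h1
      obtain ⟨s', hs1', hs2'⟩ := hpre _ _ h2
      have hvP : v * (mk P)⁻¹ ∈ H := hsep (mk P) v s t hs1 ht hs2 hvt (by simpa using h3)
      rw [mk_cons, ← mul_assoc]
      refine ih _ ⟨s', hs1', ?_⟩ ?_
      · have e : v * mk [a] * s'⁻¹ = v * (mk P)⁻¹ * (mk P' * s'⁻¹) := by
          rw [← h4]; group
        rw [e]
        exact H.mul_mem hvP hs2'
      · rw [map_mul]
        exact fun e he => hs (Or.inr he)
  obtain ⟨t, ht, htH⟩ := hinv w' 1 ⟨1, h1T, by simp [H.one_mem]⟩ (by rw [map_one]; exact hR.2)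
  rw [one_mul] at htH
  have hwH : mk w * g⁻¹ ∈ H := by rw [hmkw]; simpa using hh
  have h5 := hsep _ _ _ _ hgT ht hwH htH hR.1.symm
  have e : mk w' * g⁻¹ = (mk w' * (mk w)⁻¹) * (mk w * g⁻¹) := by group
  rw [e]
  exact H.mul_mem h5 hwH

lemma forall₂_ofFn {X : Type} (Q : X → X → Prop) (n : ℕ) : ∀ (w : Fin n → X) (z : X) (ws' : List X),
    List.Forall₂ Q (List.ofFn w ++ [z]) ws' →
    ∃ (w' : Fin n → X) (z' : X), ws' = List.ofFn w' ++ [z'] ∧ (∀ i, Q (w i) (w' i)) ∧ Q z z' := by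
  induction n with
  | zero =>
    intro w z ws' h
    simp only [List.ofFn_zero, List.nil_append] at h
    obtain ⟨z', r, hz, hr, rfl⟩ := List.forall₂_cons_left_iff.1 h
    obtain rfl := List.forall₂_nil_left_iff.1 hr
    exact ⟨Fin.elim0, z', by simp, fun i => i.elim0, hz⟩
  | succ n ih =>
    intro w z ws' h
    rw [List.ofFn_succ, List.cons_append] at h
    obtain ⟨x, r, hx, hr, rfl⟩ := List.forall₂_cons_left_iff.1 h
    obtain ⟨w', z', rfl, hw, hz⟩ := ih _ _ _ hr
    refine ⟨Fin.cons x w', z', by simp [List.ofFn_succ], fun i => ?_, hz⟩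
    refine Fin.cases ?_ (fun i => ?_) i
    · simpa using hx
    · simpa using hw i

lemma mk_flatten (l : List (List (A × Bool))) : mk l.flatten = (l.map mk).prod := by
  induction l with
  | nil => rfl
  | cons a l ih => simp [mk_app, ih]

end RZ

/-- **Ribes–Zalesskiĭ, pro-`p` version.** Let `p` be a prime, `F` a free group and
`H₁, …, Hₙ` finitely generated subgroups of `F`, each closed in the pro-`p` topology
of `F`. Then the product set `H₁H₂⋯Hₙ` is closed in the pro-`p` topology of `F`. -/
theorem ribes_zalesskii_pro_p {A : Type} (p : ℕ) (hp : p.Prime)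
    (n : ℕ) (H : Fin n → Subgroup (FreeGroup A))
    (hfg : ∀ i, (H i).FG)
    (hclosed : ∀ i, ProPClosed p ((H i : Set (FreeGroup A)))) :
    ProPClosed p {x : FreeGroup A |
      ∃ h : Fin n → FreeGroup A, (∀ i, h i ∈ H i) ∧ x = (List.ofFn h).prod} := by
  have : Fact p.Prime := ⟨hp⟩
  intro g hg
  choose S N hS hN hw using fun i => RZ.coset p (H i) (hfg i) (hclosed i) 1
  obtain ⟨S', N', hS', hN', hw'⟩ := RZ.coset (A := A) p ⊥
    ⟨∅, by simp⟩ (RZ.bot_closed p) g⁻¹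
  let M : Option (Fin n) → Subgroup (FreeGroup A) := fun o => o.elim N' N
  have hM : RZ.PO p (⨅ o, M o) := RZ.PO_iInf p M (by rintro (_ | i) <;> simp [M, hN', hN])
  have hM1 := hM.1
  obtain ⟨K, hK, -, hpoly⟩ := RZ.polygon p (S' ∪ ⋃ i, S i)
    (hS'.union (Set.finite_iUnion hS)) (⨅ o, M o) hM n
  refine ⟨K, hK.1, hK.finite, hK.isPGroup, ?_⟩
  rintro x hx ⟨h, hh, hprod⟩
  choose w hO hmk hlift using fun i => hw i (h i) (hh i)
  obtain ⟨z, hzO, hzmk, hzlift⟩ := hw' 1 (Subgroup.one_mem _)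
  obtain ⟨ws', hws, hone⟩ := hpoly (List.ofFn w ++ [z]) (by simp)
    (by
      intro v hv a ha
      rcases List.mem_append.1 hv with hv | hv
      · obtain ⟨i, rfl⟩ := (List.mem_ofFn' _ _).1 hv
        exact Or.inr (Set.mem_iUnion.2 ⟨i, hO i a ha⟩)
      · rw [List.mem_singleton.1 hv] at ha
        exact Or.inl (hzO a ha))
    (by
      have e : (List.ofFn w).map FreeGroup.mk = List.ofFn h := by
        rw [List.map_ofFn]
        congr 1
        funext i
        simpa using hmk i
      rw [RZ.mk_flatten, List.map_append, e, List.prod_append, ← hprod]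
      simp only [List.map_cons, List.map_nil, List.prod_singleton, hzmk, one_mul]
      exact hK.1.conj_mem x hx g)
  obtain ⟨w', z', rfl, hw1, hz1⟩ := RZ.forall₂_ofFn _ _ _ _ _ hws
  apply hg
  refine ⟨fun i => FreeGroup.mk (w' i), fun i => ?_, ?_⟩
  · have := hlift i _ hM1 (iInf_le M (some i)) (w' i) (hw1 i)
    simpa using this
  · have := hzlift _ hM1 (iInf_le M none) z' hz1
    have hz : FreeGroup.mk z' = g⁻¹ := by
      rw [Subgroup.mem_bot, inv_inv] at this
      exact eq_inv_of_mul_eq_one_left this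
    rw [RZ.mk_flatten, List.map_append, List.map_ofFn, List.prod_append] at hone
    simp only [List.map_cons, List.map_nil, List.prod_singleton, hz] at hone
    exact (mul_inv_eq_one.1 hone).symm
end

section
/- The Straubing–Thérien hierarchy is strict: for every natural number n there exist a finite alphabet A and a language L ⊆ A* such that L belongs to level n+1 of the hierarchy over A but not to level n. (Strictness of the concatenation hierarchy, after Brzozowski–Knast.) -/
/-- Marked products `L₀a₁L₁a₂⋯a_kL_k` (`k ≥ 0`) of languages from a class `C`. -/
inductive MarkedProd {A : Type} (C : Language A → Prop) : Language A → Prop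
  | base {L : Language A} : C L → MarkedProd C L
  | step {L : Language A} (a : A) {M : Language A} :
      C L → MarkedProd C M → MarkedProd C (L * {[a]} * M)

/-- Closure of a class of languages under finite unions, finite intersections and
complementation within `A*`. -/
inductive BoolClosure {A : Type} (C : Language A → Prop) : Language A → Prop
  | base {L : Language A} : C L → BoolClosure C L
  | union {L M : Language A} :
      BoolClosure C L → BoolClosure C M → BoolClosure C (L + M)
  | inter {L M : Language A} :
      BoolClosure C L → BoolClosure C M → BoolClosure C (L ⊓ M)
  | compl {L : Language A} : BoolClosure C L → BoolClosure C Lᶜ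

/-- The Straubing–Thérien hierarchy: level `0` consists of `∅` and `A*`; level `n+1`
is the Boolean closure of the marked products of languages of level `n`. -/
def STLevel (A : Type) : ℕ → Language A → Prop
  | 0 => fun L => L = (0 : Language A) ∨ L = (⊤ : Language A)
  | n + 1 => BoolClosure (MarkedProd (STLevel A n))

namespace ST

/-- Powers of a word. -/
def pw {A : Type} (w : List A) : ℕ → List A
  | 0 => []
  | n + 1 => w ++ pw w n

theorem pw_add {A : Type} (w : List A) (m n : ℕ) : pw w (m + n) = pw w m ++ pw w n := by
  induction m with
  | zero => simp [pw]
  | succ m ih => rw [Nat.succ_add]; simp [pw, ih]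

theorem pw_one {A : Type} (w : List A) : pw w 1 = w := by simp [pw]

theorem pw_mul {A : Type} (w : List A) (m n : ℕ) : pw (pw w m) n = pw w (m * n) := by
  induction n with
  | zero => simp [pw]
  | succ n ih => rw [Nat.mul_succ, Nat.add_comm (m * n) m, pw_add w, ← ih]; rfl

/-- One block of moves in the game. -/
def Step {A : Type} (S : List A → List A → Prop) : ℕ → List A → List A → Prop
  | 0 => fun u v => S v u
  | k + 1 => fun u v => S v u ∧ ∀ u0 a u1, u = u0 ++ a :: u1 →
      ∃ v0 v1, v = v0 ++ a :: v1 ∧ Step S k u0 v0 ∧ Step S k u1 v1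

/-- The preorder of level `n`, with `r` moves in each block. -/
def Le {A : Type} (r : ℕ) : ℕ → List A → List A → Prop
  | 0 => fun _ _ => True
  | n + 1 => Step (Le r n) r

section
variable {A : Type} {S : List A → List A → Prop}

theorem Step.back {k : ℕ} {u v : List A} (h : Step S k u v) : S v u := by
  cases k with
  | zero => exact h
  | succ k => exact h.1

theorem Step.mono {k : ℕ} : ∀ {u v : List A}, Step S (k + 1) u v → Step S k u v := by
  induction k with
  | zero => intro u v h; exact h.1
  | succ k ih =>
    intro u v h
    refine ⟨h.1, fun u0 a u1 e => ?_⟩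
    obtain ⟨v0, v1, h1, h2, h3⟩ := h.2 u0 a u1 e
    exact ⟨v0, v1, h1, ih h2, ih h3⟩

theorem Step.refl (hS : ∀ u, S u u) (k : ℕ) : ∀ u, Step S k u u := by
  induction k with
  | zero => exact hS
  | succ k ih => exact fun u => ⟨hS u, fun u0 a u1 e => ⟨u0, u1, e, ih _, ih _⟩⟩

theorem Step.trans (hS : ∀ u v w, S u v → S v w → S u w) (k : ℕ) :
    ∀ u v w, Step S k u v → Step S k v w → Step S k u w := by
  induction k with
  | zero => exact fun u v w h1 h2 => hS _ _ _ h2 h1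
  | succ k ih =>
    intro u v w h1 h2
    refine ⟨hS _ _ _ h2.1 h1.1, fun u0 a u1 e => ?_⟩
    obtain ⟨v0, v1, e1, h3, h4⟩ := h1.2 u0 a u1 e
    obtain ⟨w0, w1, e2, h5, h6⟩ := h2.2 v0 a v1 e1
    exact ⟨w0, w1, e2, ih _ _ _ h3 h5, ih _ _ _ h4 h6⟩

theorem split_mark {u v w0 w1 : List A} {a : A} (h : u ++ v = w0 ++ a :: w1) :
    (∃ t, u = w0 ++ a :: t ∧ w1 = t ++ v) ∨ (∃ t, w0 = u ++ t ∧ v = t ++ a :: w1) := by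
  rcases List.append_eq_append_iff.1 h with ⟨t, h1, h2⟩ | ⟨t, h1, h2⟩
  · exact Or.inr ⟨t, h1, h2⟩
  · cases t with
    | nil => exact Or.inr ⟨[], by simpa using h1.symm, by simpa using h2.symm⟩
    | cons b t =>
      simp only [List.cons_append, List.cons.injEq] at h2
      obtain ⟨rfl, rfl⟩ := h2
      exact Or.inl ⟨t, h1, rfl⟩

theorem Step.app (hS : ∀ u u' v v', S u u' → S v v' → S (u ++ v) (u' ++ v')) (k : ℕ) :
    ∀ u u' v v', Step S k u u' → Step S k v v' → Step S k (u ++ v) (u' ++ v') := by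
  induction k with
  | zero => exact fun u u' v v' h1 h2 => hS _ _ _ _ h1 h2
  | succ k ih =>
    intro u u' v v' h1 h2
    refine ⟨hS _ _ _ _ h1.1 h2.1, fun w0 a w1 e => ?_⟩
    rcases split_mark e with ⟨t, e1, e2⟩ | ⟨t, e1, e2⟩
    · obtain ⟨v0, v1, e3, h3, h4⟩ := h1.2 _ _ _ e1
      exact ⟨v0, v1 ++ v', by simp [e3], h3, e2 ▸ ih _ _ _ _ h4 h2.mono⟩
    · obtain ⟨v0, v1, e3, h3, h4⟩ := h2.2 _ _ _ e2
      exact ⟨u' ++ v0, v1, by simp [e3], e1 ▸ ih _ _ _ _ h1.mono h3, h4⟩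

/-- The free block lemma. -/
theorem Step.block (hR : ∀ u, S u u)
    (hS : ∀ u u' v v', S u u' → S v v' → S (u ++ v) (u' ++ v')) (e : List A) (k : ℕ) :
    ∀ (p q v : List A),
      (∀ i j, i + j + 1 = 2 ^ k → ∃ g, S g e ∧ v = p ++ (pw e i ++ (g ++ (pw e j ++ q)))) →
      Step S k (p ++ (pw e (2 ^ k) ++ q)) v := by
  have base : ∀ (k : ℕ) (p q v : List A),
      (∀ i j, i + j + 1 = 2 ^ k → ∃ g, S g e ∧ v = p ++ (pw e i ++ (g ++ (pw e j ++ q)))) →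
      S v (p ++ (pw e (2 ^ k) ++ q)) := by
    intro k p q v h
    have hk : 0 + (2 ^ k - 1) + 1 = 2 ^ k := by have := Nat.one_le_two_pow (n := k); omega
    obtain ⟨g, hg, rfl⟩ := h 0 (2 ^ k - 1) hk
    have : pw e (2 ^ k) = e ++ pw e (2 ^ k - 1) := by
      conv_lhs => rw [← hk, Nat.zero_add]
      rfl
    rw [this, List.append_assoc]
    rw [show pw e 0 = [] from rfl, List.nil_append]
    exact hS _ _ _ _ (hR p) (hS g e _ _ hg (hR (pw e (2 ^ k - 1) ++ q)))
  induction k with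
  | zero => exact fun p q v h => base 0 p q v h
  | succ k ih =>
    intro p q v h
    refine ⟨base _ p q v h, fun u0 a u1 eq => ?_⟩
    have hpos := Nat.one_le_two_pow (n := k)
    have h2 : 2 ^ (k + 1) = 2 ^ k + 2 ^ k := by ring
    rw [h2, pw_add, show p ++ (pw e (2 ^ k) ++ pw e (2 ^ k) ++ q)
      = (p ++ pw e (2 ^ k)) ++ (pw e (2 ^ k) ++ q) by simp] at eq
    rcases split_mark eq with ⟨t, e1, e2⟩ | ⟨t, e1, e2⟩
    · have key : ∀ i j, i + j + 1 = 2 ^ k → ∃ g, S g e ∧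
          v = u0 ++ a :: (t ++ (pw e i ++ (g ++ (pw e j ++ q)))) := by
        intro i j hij
        obtain ⟨g, hg, hv⟩ := h (2 ^ k + i) j (by omega)
        refine ⟨g, hg, ?_⟩
        rw [hv, pw_add, List.append_assoc, ← List.append_assoc p, e1]
        simp
      obtain ⟨g0, _, hv0⟩ := key 0 (2 ^ k - 1) (by omega)
      refine ⟨u0, _, hv0, Step.refl hR _ _, ?_⟩
      rw [e2]
      refine ih _ _ _ fun i j hij => ?_
      obtain ⟨g, hg, hv⟩ := key i j hij
      refine ⟨g, hg, ?_⟩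
      rw [hv0] at hv
      simpa using hv
    · have key : ∀ i j, i + j + 1 = 2 ^ k → ∃ g, S g e ∧
          v = (p ++ (pw e i ++ (g ++ (pw e j ++ t)))) ++ a :: u1 := by
        intro i j hij
        obtain ⟨g, hg, hv⟩ := h i (j + 2 ^ k) (by omega)
        refine ⟨g, hg, ?_⟩
        rw [hv, pw_add, List.append_assoc, e2]
        simp
      obtain ⟨g0, _, hv0⟩ := key 0 (2 ^ k - 1) (by omega)
      refine ⟨_, u1, hv0, ?_, Step.refl hR _ _⟩
      rw [e1, List.append_assoc]
      refine ih _ _ _ fun i j hij => ?_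
      obtain ⟨g, hg, hv⟩ := key i j hij
      refine ⟨g, hg, ?_⟩
      rw [hv0] at hv
      exact List.append_cancel_right hv

end

section
variable {A : Type} (r : ℕ)

theorem Le.refl (n : ℕ) : ∀ u : List A, Le r n u u := by
  induction n with
  | zero => exact fun _ => trivial
  | succ n ih => exact Step.refl ih r

theorem Le.trans (n : ℕ) : ∀ u v w : List A, Le r n u v → Le r n v w → Le r n u w := by
  induction n with
  | zero => exact fun _ _ _ _ _ => trivial
  | succ n ih => exact Step.trans ih r

theorem Le.app (n : ℕ) : ∀ u u' v v' : List A, Le r n u u' → Le r n v v' →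
    Le r n (u ++ v) (u' ++ v') := by
  induction n with
  | zero => exact fun _ _ _ _ _ _ => trivial
  | succ n ih => exact Step.app ih r

theorem Le.pump (n : ℕ) : ∃ M, ∀ w : List A,
    Le r n (pw w M) (pw w (M + 1)) ∧ Le r n (pw w (M + 1)) (pw w M) := by
  induction n with
  | zero => exact ⟨0, fun _ => ⟨trivial, trivial⟩⟩
  | succ n ih =>
    obtain ⟨M, hM⟩ := ih
    refine ⟨(M + 1) * 2 ^ r, fun w => ⟨?_, ?_⟩⟩
    · have := Step.block (S := Le r n) (Le.refl r n) (Le.app r n) (pw w (M + 1)) r [] []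
        (pw w ((M + 1) * 2 ^ r + 1)) (fun i j hij => ⟨pw w (1 + (M + 1)), ?_, ?_⟩)
      · rw [pw_mul, List.append_nil] at this
        exact this
      · rw [pw_add w 1 (M + 1), Nat.add_comm M 1, pw_add w 1 M]
        refine Le.app r n _ _ _ _ (Le.refl r n _) ?_
        rw [← pw_add, Nat.add_comm 1 M]
        exact (hM w).2
      · rw [pw_mul, pw_mul, List.append_nil, List.nil_append, ← pw_add, ← pw_add, ← hij]
        congr 1; ring
    · have := Step.block (S := Le r n) (Le.refl r n) (Le.app r n) (pw w (M + 1)) r w []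
        (pw w ((M + 1) * 2 ^ r)) (fun i j hij => ⟨pw w M, (hM w).1, ?_⟩)
      · rw [pw_mul, List.append_nil] at this
        exact this
      · rw [pw_mul, pw_mul, List.append_nil, ← pw_add, ← pw_add]
        have h1 : ∀ m, w ++ pw w m = pw w (m + 1) := fun m => rfl
        rw [h1, ← hij]
        congr 1; ring

theorem Le.pump_le (n M : ℕ) (w : List A) (h : Le r n (pw w (M + 1)) (pw w M)) (d : ℕ) :
    Le r n (pw w (M + d)) (pw w M) := by
  induction d with
  | zero => exact Le.refl r n _
  | succ d ih =>
    refine Le.trans r n _ _ _ ?_ ih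
    rw [show M + (d + 1) = (M + 1) + d by ring, pw_add, pw_add w M d]
    exact Le.app r n _ _ _ _ h (Le.refl r n _)

end

/-- Positive closure of the complements of a class under marked products. -/
inductive PolC {A : Type} (C : Language A → Prop) : Language A → Prop
  | co {L : Language A} : C L → PolC C Lᶜ
  | union {L M : Language A} : PolC C L → PolC C M → PolC C (L + M)
  | inter {L M : Language A} : PolC C L → PolC C M → PolC C (L ⊓ M)
  | mark {L M : Language A} (a : A) : PolC C L → PolC C M → PolC C (L * {[a]} * M)

/-- Half levels. -/
def SC (A : Type) : ℕ → Language A → Prop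
  | 0 => fun L => L = (0 : Language A) ∨ L = (⊤ : Language A)
  | n + 1 => PolC (SC A n)

theorem compl_zero' {A : Type} : (0 : Language A)ᶜ = ⊤ := compl_bot
theorem compl_top' {A : Type} : (⊤ : Language A)ᶜ = 0 := compl_top
theorem compl_add' {A : Type} (L M : Language A) : (L + M)ᶜ = Lᶜ ⊓ Mᶜ := compl_sup
theorem compl_inf' {A : Type} (L M : Language A) : (L ⊓ M)ᶜ = Lᶜ + Mᶜ := compl_inf

theorem PolC.mono {A : Type} {C D : Language A → Prop} (h : ∀ L, C L → D L) (L : Language A)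
    (hL : PolC C L) : PolC D L := by
  induction hL with
  | co h1 => exact .co (h _ h1)
  | union _ _ h1 h2 => exact .union h1 h2
  | inter _ _ h1 h2 => exact .inter h1 h2
  | mark a _ _ h1 h2 => exact .mark a h1 h2

theorem SC.mono {A : Type} (n : ℕ) : ∀ L : Language A, SC A n L → SC A (n + 1) L := by
  induction n with
  | zero =>
    rintro L (rfl | rfl)
    · rw [← compl_top']; exact PolC.co (Or.inr rfl)
    · rw [← compl_zero']; exact PolC.co (Or.inl rfl)
  | succ n ih => exact fun L h => PolC.mono ih L h

theorem level_SC {A : Type} (n : ℕ) : ∀ L : Language A, STLevel A n L →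
    SC A (n + 1) L ∧ SC A (n + 1) Lᶜ := by
  induction n with
  | zero => exact fun L h => ⟨SC.mono 0 L h, PolC.co h⟩
  | succ n ih =>
    intro L hL
    have hm : ∀ L : Language A, MarkedProd (STLevel A n) L → SC A (n + 1) L := by
      intro L h
      induction h with
      | base h => exact (ih _ h).1
      | step a h _ h2 => exact PolC.mark a (ih _ h).1 h2
    change BoolClosure _ L at hL
    induction hL with
    | base h => exact ⟨SC.mono _ _ (hm _ h), PolC.co (hm _ h)⟩
    | union _ _ h1 h2 =>
      rw [compl_add']; exact ⟨PolC.union h1.1 h2.1, PolC.inter h1.2 h2.2⟩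
    | inter _ _ h1 h2 =>
      rw [compl_inf']; exact ⟨PolC.inter h1.1 h2.1, PolC.union h1.2 h2.2⟩
    | compl _ h1 => rw [compl_compl]; exact ⟨h1.2, h1.1⟩

theorem mem_mark {A : Type} (L M : Language A) (a : A) (u : List A) :
    u ∈ L * {[a]} * M ↔ ∃ u0 u1, u = u0 ++ a :: u1 ∧ u0 ∈ L ∧ u1 ∈ M := by
  constructor
  · rintro ⟨x, ⟨y, hy, z, hz, rfl⟩, t, ht, rfl⟩
    obtain rfl : z = [a] := hz
    exact ⟨y, t, by simp, hy, ht⟩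
  · rintro ⟨y, t, rfl, hy, ht⟩
    exact ⟨y ++ [a], ⟨y, hy, [a], rfl, rfl⟩, t, ht, by simp⟩

theorem mem_compl' {A : Type} (L : Language A) (u : List A) : u ∈ Lᶜ ↔ u ∉ L := Iff.rfl

theorem SC.up {A : Type} (n : ℕ) : ∀ L : Language A, SC A n L →
    ∃ r0, ∀ r, r0 ≤ r → ∀ u v, Le r n u v → u ∈ L → v ∈ L := by
  induction n with
  | zero =>
    rintro L (rfl | rfl)
    · exact ⟨0, fun r _ u v _ h => h.elim⟩
    · exact ⟨0, fun r _ u v _ h => trivial⟩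
  | succ n ih =>
    intro L hL
    have : ∃ r0, ∀ r, r0 ≤ r → ∀ k, r0 ≤ k → ∀ u v, Step (Le r n) k u v → u ∈ L → v ∈ L := by
      change PolC _ L at hL
      induction hL with
      | co h =>
        obtain ⟨r0, h0⟩ := ih _ h
        exact ⟨r0, fun r hr k _ u v huv hu hv => hu (h0 r hr _ _ huv.back hv)⟩
      | union _ _ h1 h2 =>
        obtain ⟨r1, h1⟩ := h1
        obtain ⟨r2, h2⟩ := h2
        refine ⟨max r1 r2, fun r hr k hk u v huv hu => ?_⟩
        rcases hu with hu | hu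
        · exact Or.inl (h1 r (by omega) k (by omega) u v huv hu)
        · exact Or.inr (h2 r (by omega) k (by omega) u v huv hu)
      | inter _ _ h1 h2 =>
        obtain ⟨r1, h1⟩ := h1
        obtain ⟨r2, h2⟩ := h2
        refine ⟨max r1 r2, fun r hr k hk u v huv hu => ?_⟩
        exact ⟨h1 r (by omega) k (by omega) u v huv hu.1,
          h2 r (by omega) k (by omega) u v huv hu.2⟩
      | mark a _ _ h1 h2 =>
        obtain ⟨r1, h1⟩ := h1
        obtain ⟨r2, h2⟩ := h2
        refine ⟨max r1 r2 + 1, fun r hr k hk u v huv hu => ?_⟩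
        obtain ⟨k, rfl⟩ : ∃ k', k = k' + 1 := ⟨k - 1, by omega⟩
        rw [mem_mark] at hu ⊢
        obtain ⟨u0, u1, e, hu0, hu1⟩ := hu
        obtain ⟨v0, v1, e', hv0, hv1⟩ := huv.2 _ _ _ e
        exact ⟨v0, v1, e', h1 r (by omega) k (by omega) _ _ hv0 hu0,
          h2 r (by omega) k (by omega) _ _ hv1 hu1⟩
    obtain ⟨r0, h0⟩ := this
    exact ⟨r0, fun r hr => h0 r hr r hr⟩

/-- The words that contain the letter `a`. -/
def has {A : Type} (a : A) : Language A := ⊤ * {[a]} * ⊤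

/-- The witnessing languages. -/
def T {A : Type} (c : ℕ → A) : ℕ → Language A
  | 0 => has (c 0)
  | n + 1 => ⊤ * {[c (n + 1)]} * (((T c n)ᶜ ⊓ (has (c (n + 1)))ᶜ) * {[c (n + 1)]} * ⊤)

theorem level_mono {A : Type} (n : ℕ) (L : Language A) (h : STLevel A n L) :
    STLevel A (n + 1) L := BoolClosure.base (MarkedProd.base h)

theorem level_top {A : Type} (n : ℕ) : STLevel A n (⊤ : Language A) := by
  induction n with
  | zero => exact Or.inr rfl
  | succ n ih => exact level_mono n _ ih

theorem level_has {A : Type} (n : ℕ) (a : A) : STLevel A (n + 1) (has a) :=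
  BoolClosure.base (MarkedProd.step a (level_top n) (MarkedProd.base (level_top n)))

theorem level_T {A : Type} (c : ℕ → A) (n : ℕ) : STLevel A (n + 1) (T c n) := by
  induction n with
  | zero => exact level_has 0 _
  | succ n ih =>
    have h1 : STLevel A (n + 1) ((T c n)ᶜ ⊓ (has (c (n + 1)))ᶜ) :=
      BoolClosure.inter (BoolClosure.compl ih) (BoolClosure.compl (level_has n _))
    exact BoolClosure.base (MarkedProd.step _ (level_top _)
      (MarkedProd.step _ h1 (MarkedProd.base (level_top _))))

theorem mem_has {A : Type} (a : A) (u : List A) : u ∈ has a ↔ a ∈ u := by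
  rw [has, mem_mark, List.mem_iff_append]
  constructor
  · rintro ⟨s, t, h, _, _⟩; exact ⟨s, t, h⟩
  · rintro ⟨s, t, h⟩; exact ⟨s, t, h, trivial, trivial⟩

theorem mem_T_succ {A : Type} (c : ℕ → A) (n : ℕ) (u : List A) :
    u ∈ T c (n + 1) ↔ ∃ s z t, u = s ++ c (n + 1) :: (z ++ c (n + 1) :: t) ∧
      z ∉ T c n ∧ c (n + 1) ∉ z := by
  rw [T, mem_mark]
  constructor
  · rintro ⟨s, u1, rfl, _, h⟩
    rw [mem_mark] at h
    obtain ⟨z, t, rfl, ⟨h1, h2⟩, _⟩ := h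
    exact ⟨s, z, t, rfl, h1, fun h => h2 ((mem_has _ _).2 h)⟩
  · rintro ⟨s, z, t, rfl, h1, h2⟩
    refine ⟨s, _, rfl, trivial, ?_⟩
    rw [mem_mark]
    exact ⟨z, t, rfl, ⟨h1, fun h => h2 ((mem_has _ _).1 h)⟩, trivial⟩

theorem ends {A : Type} (c : A) (x : List A) (m : ℕ) :
    ∃ t, c :: pw (x ++ [c]) m = t ++ [c] := by
  induction m with
  | zero => exact ⟨[], rfl⟩
  | succ m ih =>
    obtain ⟨t, ht⟩ := ih
    refine ⟨c :: (x ++ t), ?_⟩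
    simp [pw, ht]

theorem uniq {A : Type} {c : A} {x z b : List A} (hx : c ∉ x) (hz : c ∉ z) (m : ℕ) :
    ∀ a, c :: pw (x ++ [c]) m = a ++ c :: (z ++ c :: b) → z = x := by
  induction m with
  | zero =>
    intro a h
    have := congrArg List.length h
    simp [pw] at this
    omega
  | succ m ih =>
    intro a h
    cases a with
    | nil =>
      simp only [pw, List.nil_append, List.cons.injEq, true_and, List.append_assoc,
        List.cons_append] at h
      rcases split_mark h with ⟨t, e1, _⟩ | ⟨t, e1, e2⟩
      · exact absurd (by simp [e1]) hx
      · cases t with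
        | nil => simpa using e1
        | cons d t =>
          simp only [List.cons_append, List.cons.injEq] at e2
          exact absurd (by simp [e1, ← e2.1]) hz
    | cons d a =>
      simp only [pw, List.cons_append, List.cons.injEq, List.append_assoc,
        List.nil_append] at h
      rcases split_mark h.2 with ⟨t, e1, _⟩ | ⟨t, e1, e2⟩
      · exact absurd (by simp [e1]) hx
      · exact ih t e2

theorem pw_letters {A : Type} {P : A → Prop} {w : List A} (h : ∀ a ∈ w, P a) (m : ℕ) :
    ∀ a ∈ pw w m, P a := by
  induction m with
  | zero => simp [pw]
  | succ m ih =>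
    intro a ha
    rcases List.mem_append.1 ha with ha | ha
    · exact h a ha
    · exact ih a ha

theorem main {A : Type} (c : ℕ → A) (N r : ℕ)
    (hc : ∀ i j, i ≤ N → j ≤ N → c i = c j → i = j) (n : ℕ) (hn : n ≤ N) :
    ∃ x y : List A, x ∈ T c n ∧ y ∉ T c n ∧ (∀ a ∈ x, ∃ i ≤ n, a = c i) ∧
      (∀ a ∈ y, ∃ i ≤ n, a = c i) ∧ Le r (n + 1) y x := by
  induction n with
  | zero =>
    refine ⟨[c 0], [], (mem_has _ _).2 (by simp), fun h => by simpa using (mem_has _ _).1 h,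
      by simp, by simp, ?_⟩
    change Step (fun _ _ => True) r [] [c 0]
    cases r with
    | zero => trivial
    | succ r => exact ⟨trivial, fun u0 a u1 h => by simp at h⟩
  | succ n ih =>
    obtain ⟨x, y, hxT, hyT, hx, hy, hle⟩ := ih (by omega)
    obtain ⟨M, hM⟩ := Le.pump (A := A) r (n + 1)
    have hcx : c (n + 1) ∉ x := by
      intro h
      obtain ⟨i, hi, e⟩ := hx _ h
      have := hc _ _ hn (by omega) e
      omega
    have hcy : c (n + 1) ∉ y := by
      intro h
      obtain ⟨i, hi, e⟩ := hy _ h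
      have := hc _ _ hn (by omega) e
      omega
    set d := c (n + 1) with hd
    set w := x ++ [d] with hw
    set e := pw w M with he
    have hwl : ∀ a ∈ w, ∃ i ≤ n + 1, a = c i := by
      intro a ha
      rcases List.mem_append.1 ha with ha | ha
      · obtain ⟨i, hi, e⟩ := hx a ha
        exact ⟨i, by omega, e⟩
      · exact ⟨n + 1, le_rfl, by simpa using ha⟩
    have hel : ∀ a ∈ pw e (2 ^ r), ∃ i ≤ n + 1, a = c i := pw_letters (pw_letters hwl M) _
    refine ⟨[d] ++ (pw e (2 ^ r) ++ (y ++ [d] ++ pw e (2 ^ r))), [d] ++ pw e (2 ^ r),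
      ?_, ?_, ?_, ?_, ?_⟩
    · rw [mem_T_succ]
      obtain ⟨t, ht⟩ := ends d x (M * 2 ^ r)
      refine ⟨t, y, pw e (2 ^ r), ?_, hyT, hcy⟩
      rw [he, pw_mul, ← List.append_assoc, List.singleton_append, hw, ht]
      simp [← hd, ht]
    · rw [mem_T_succ]
      rintro ⟨s, z, t, h, hz, hdz⟩
      rw [he, pw_mul, List.singleton_append] at h
      exact hz (uniq hcx hdz _ _ h ▸ hxT)
    · intro a ha
      simp only [List.mem_append, List.mem_singleton] at ha
      rcases ha with ha | ha | (ha | ha) | ha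
      · exact ⟨n + 1, le_rfl, ha⟩
      · exact hel a ha
      · obtain ⟨i, hi, e⟩ := hy a ha
        exact ⟨i, by omega, e⟩
      · exact ⟨n + 1, le_rfl, ha⟩
      · exact hel a ha
    · intro a ha
      simp only [List.mem_append, List.mem_singleton] at ha
      rcases ha with ha | ha
      · exact ⟨n + 1, le_rfl, ha⟩
      · exact hel a ha
    · refine Le.app r (n + 2) _ _ _ _ (Le.refl r _ _) ?_
      have := Step.block (S := Le r (n + 1)) (Le.refl r _) (Le.app r _) e r [] []
        (pw e (2 ^ r) ++ (y ++ [d] ++ pw e (2 ^ r)))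
        (fun i j hij => ⟨pw e (j + 1) ++ (y ++ [d] ++ pw e (i + 1)), ?_, ?_⟩)
      · rw [List.append_nil] at this
        exact this
      · have h1 : Le r (n + 1) (pw e (j + 1) ++ (y ++ [d] ++ pw e (i + 1)))
            (pw e (j + 1) ++ (w ++ pw e (i + 1))) :=
          Le.app r _ _ _ _ _ (Le.refl r _ _) (Le.app r _ _ _ _ _
            (Le.app r _ _ _ _ _ hle (Le.refl r _ _)) (Le.refl r _ _))
        refine Le.trans r _ _ _ _ h1 ?_
        have h2 : pw e (j + 1) ++ (w ++ pw e (i + 1))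
            = pw w (M + (M * j + 1 + M * (i + 1))) := by
          rw [he, pw_mul, pw_mul]
          have h1 : ∀ m, w ++ pw w m = pw w (m + 1) := fun m => rfl
          rw [h1, ← pw_add]
          congr 1; ring
        rw [h2]
        exact Le.pump_le r _ M w (hM w).2 _
      · have h3 : pw e (2 ^ r) = pw e i ++ pw e (j + 1) := by
          rw [← pw_add, ← hij]; rfl
        have h4 : pw e (2 ^ r) = pw e (i + 1) ++ pw e j := by
          rw [← pw_add, ← hij]; congr 1; ring
        calc _ = (pw e i ++ pw e (j + 1)) ++ (y ++ [d] ++ (pw e (i + 1) ++ pw e j)) := by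
              rw [← h3, ← h4]
          _ = _ := by simp

theorem not_level_T {A : Type} (c : ℕ → A) (n : ℕ)
    (hc : ∀ i j, i ≤ n → j ≤ n → c i = c j → i = j) : ¬ STLevel A n (T c n) := by
  intro h
  obtain ⟨r, hr⟩ := SC.up (n + 1) _ (level_SC n _ h).2
  obtain ⟨x, y, hx, hy, _, _, hle⟩ := main c n r hc n le_rfl
  exact hr r le_rfl y x hle hy hx

end ST

/-- **Strictness of the Straubing–Thérien hierarchy** (after Brzozowski–Knast):
for every `n` there are a finite alphabet `A` and a language over `A` lying in
level `n+1` but not in level `n`. -/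
theorem straubing_therien_strict (n : ℕ) :
    ∃ (A : Type) (_ : Fintype A) (L : Language A),
      STLevel A (n + 1) L ∧ ¬ STLevel A n L := by
  refine ⟨Fin (n + 1), inferInstance, ST.T (fun i => Fin.ofNat (n + 1) i) n,
    ST.level_T _ n, ST.not_level_T _ n ?_⟩
  intro i j hi hj h
  have := congrArg Fin.val h
  simpa [Fin.ofNat, Nat.mod_eq_of_lt (Nat.lt_succ_of_le hi),
    Nat.mod_eq_of_lt (Nat.lt_succ_of_le hj)] using this
end
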